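/- Let f be a transcendental meromorphic function on ℂ such that all but finitely many zeros of f lie on a ray L_0, all but finitely many 1-points lie on a ray L_1, and all but finitely many poles lie on a ray L_∞, where L_0, L_1, L_∞ are three distinct, equally spaced rays. Let n(r) = n(r,0) + n(r,1) + n(r,∞), where n(r,a) counts the a-points of f (with multiplicity) of modulus at most r. Let (r_k) be a sequence tending to ∞ such that the functions f_k(z) = f(r_k z) converge locally uniformly on ℂ \ {0} with respect to the spherical metric to a meromorphic limit function. Then (r_k) has a subsequence which is a sequence of Pólya peaks of order 0, of both the first and the second kind, for n(r). -/

import Mathlib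

open Complex Filter Set Topology

noncomputable section

/-- The open ray emanating from the origin with direction angle `θ`. -/
def Ray (θ : ℝ) : Set ℂ :=
  {z : ℂ | ∃ t : ℝ, 0 < t ∧ z = (t : ℂ) * Complex.exp ((θ : ℂ) * Complex.I)}

/-- Three rays are equally spaced if their direction angles differ pairwise by `2π/3` mod `2π`. -/
def EquallySpaced (L₀ L₁ L₂ : Set ℂ) : Prop :=
  ∃ θ : ℝ, ({L₀, L₁, L₂} : Set (Set ℂ)) =
    {Ray θ, Ray (θ + 2 * Real.pi / 3), Ray (θ + 4 * Real.pi / 3)}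

/-- `f` is meromorphic on the open set `U` with pole set `P`. -/
def MeromOn (f : ℂ → ℂ) (P : Set ℂ) (U : Set ℂ) : Prop :=
  P ⊆ U ∧ AnalyticOnNhd ℂ f (U \ P) ∧
    (∀ p ∈ P, Tendsto (fun z => ‖f z‖) (𝓝[≠] p) atTop) ∧
    ∀ z ∈ U, ¬ AccPt z (𝓟 P)

/-- `f` (meromorphic on `ℂ` with pole set `P`) is a rational function. -/
def IsRationalFn (f : ℂ → ℂ) (P : Set ℂ) : Prop :=
  ∃ p q : Polynomial ℂ, q ≠ 0 ∧ ∀ z ∉ P, q.eval z ≠ 0 → f z = p.eval z / q.eval z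

-- The Riemann-sphere valued map associated with a meromorphic function with pole set `P`.
open Classical in
def toSphere (f : ℂ → ℂ) (P : Set ℂ) (z : ℂ) : Option ℂ :=
  if z ∈ P then Option.none else Option.some (f z)

/-- The chordal (spherical) distance on the Riemann sphere `ℂ ∪ {∞} = Option ℂ`. -/
def sphDist : Option ℂ → Option ℂ → ℝ
  | Option.some z, Option.some w =>
      2 * dist z w / (Real.sqrt (1 + ‖z‖ ^ 2) * Real.sqrt (1 + ‖w‖ ^ 2))
  | Option.some z, Option.none => 2 / Real.sqrt (1 + ‖z‖ ^ 2)
  | Option.none, Option.some w => 2 / Real.sqrt (1 + ‖w‖ ^ 2)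
  | Option.none, Option.none => 0

/-- Local uniform convergence on compact subsets of `V` w.r.t. the spherical metric. -/
def SphConvOn (F : ℕ → ℂ → Option ℂ) (g : ℂ → Option ℂ) (V : Set ℂ) : Prop :=
  ∀ K : Set ℂ, K ⊆ V → IsCompact K → ∀ ε > (0 : ℝ),
    ∀ᶠ k in atTop, ∀ z ∈ K, sphDist (F k z) (g z) < ε

/-- The order of the pole of `f` at `z`. -/
def poleOrder (f : ℂ → ℂ) (z : ℂ) : ℕ :=
  sInf {m : ℕ | ∃ h : ℂ → ℂ, AnalyticAt ℂ h z ∧ h z ≠ 0 ∧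
    ∀ᶠ w in 𝓝[≠] z, f w = h w / (w - z) ^ m}

/-- The order of vanishing of `g` at `z`. -/
def vOrder (g : ℂ → ℂ) (z : ℂ) : ℕ :=
  sInf {m : ℕ | ∃ h : ℂ → ℂ, AnalyticAt ℂ h z ∧ h z ≠ 0 ∧
    ∀ᶠ w in 𝓝 z, g w = (w - z) ^ m * h w}

/-- The number of poles of `f` of modulus at most `t`, counted with multiplicity. -/
def nPoles (f : ℂ → ℂ) (P : Set ℂ) (t : ℝ) : ℝ :=
  ∑ᶠ z ∈ {z : ℂ | ‖z‖ ≤ t ∧ z ∈ P}, (poleOrder f z : ℝ)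

/-- The number of `a`-points of `f` of modulus at most `t`, counted with multiplicity. -/
def nValue (f : ℂ → ℂ) (P : Set ℂ) (a : ℂ) (t : ℝ) : ℝ :=
  ∑ᶠ z ∈ {z : ℂ | ‖z‖ ≤ t ∧ z ∉ P ∧ f z = a}, (vOrder (fun w => f w - a) z : ℝ)

/-- `n(r) = n(r,0) + n(r,1) + n(r,∞)`. -/
def nTotal (f : ℂ → ℂ) (P : Set ℂ) (t : ℝ) : ℝ :=
  nValue f P 0 t + nValue f P 1 t + nPoles f P t

/-- `(sₖ)` is a sequence of Pólya peaks of the first kind of order `lam` for `g`. -/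
def PolyaPeaks1 (g : ℝ → ℝ) (s : ℕ → ℝ) (lam : ℝ) : Prop :=
  Tendsto s atTop atTop ∧
    ∀ ε > (0 : ℝ), ∀ᶠ k in atTop, ∀ t : ℝ, ε ≤ t → t ≤ ε⁻¹ →
      g (t * s k) ≤ (1 + ε) * t ^ lam * g (s k)

/-- `(sₖ)` is a sequence of Pólya peaks of the second kind of order `lam` for `g`. -/
def PolyaPeaks2 (g : ℝ → ℝ) (s : ℕ → ℝ) (lam : ℝ) : Prop :=
  Tendsto s atTop atTop ∧
    ∀ ε > (0 : ℝ), ∀ᶠ k in atTop, ∀ t : ℝ, ε ≤ t → t ≤ ε⁻¹ →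
      (1 - ε) * t ^ lam * g (s k) ≤ g (t * s k)

/-- Bloch-Landau: a holomorphic function whose image misses a `4`-net has small derivative. -/
lemma bloch_aux {G : ℂ → ℂ} {z : ℂ} {d : ℝ} (hd : 0 < d)
    (hG : DifferentiableOn ℂ G (Metric.ball z d))
    (hno : ∀ w : ℂ, ∃ l : ℂ, l ∉ G '' Metric.ball z d ∧ dist l w < 4) :
    ‖deriv G z‖ ≤ 600 / d := by
  set e := d / 2 with he
  have he0 : 0 < e := by positivity
  have hsub : Metric.closedBall z e ⊆ Metric.ball z d :=
    Metric.closedBall_subset_ball (by linarith)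
  have hG' : DifferentiableOn ℂ (deriv G) (Metric.ball z d) := hG.deriv Metric.isOpen_ball
  have hcont : ContinuousOn (fun w => (e - dist w z) * ‖deriv G w‖) (Metric.closedBall z e) := by
    apply ContinuousOn.mul
    · fun_prop
    · exact (hG'.continuousOn.mono hsub).norm
  obtain ⟨w0, hw0, hmax⟩ := (isCompact_closedBall z e).exists_isMaxOn
    ⟨z, Metric.mem_closedBall_self he0.le⟩ hcont
  have hmax' : ∀ w ∈ Metric.closedBall z e,
      (e - dist w z) * ‖deriv G w‖ ≤ (e - dist w0 z) * ‖deriv G w0‖ := fun w hw => hmax hw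
  have hz := hmax' z (Metric.mem_closedBall_self he0.le)
  simp only [dist_self, sub_zero] at hz
  set lam := ‖deriv G w0‖ with hlam
  by_contra hcon
  push Not at hcon
  have hzpos : 0 < ‖deriv G z‖ := lt_trans (by positivity) hcon
  have hpos : 0 < (e - dist w0 z) * lam := lt_of_lt_of_le (by positivity) hz
  have hle : dist w0 z ≤ e := hw0
  have ht0 : 0 < e - dist w0 z := by
    rcases (sub_nonneg.2 hle).lt_or_eq with h | h
    · exact h
    · rw [← h] at hpos; simp at hpos
  have hlam0 : 0 < lam := by
    by_contra h
    have : lam = 0 := le_antisymm (not_lt.1 h) (norm_nonneg _)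
    rw [this] at hpos; simp at hpos
  set t := (e - dist w0 z) / 2 with ht
  have htpos : 0 < t := by positivity
  have hbig : 300 < 2 * t * lam := by
    have h1 : e * (600 / d) = 300 := by rw [he]; field_simp; norm_num
    have h2 : e * (600 / d) < e * ‖deriv G z‖ := by gcongr
    have : 2 * t = e - dist w0 z := by rw [ht]; ring
    rw [this]; linarith
  have hballsub : Metric.ball w0 t ⊆ Metric.closedBall z e := by
    intro w hw
    rw [Metric.mem_ball] at hw
    rw [Metric.mem_closedBall]
    have := dist_triangle w w0 z
    linarith
  have hder : ∀ w ∈ Metric.ball w0 t, ‖deriv G w‖ ≤ 2 * lam := by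
    intro w hw
    have h1 := hmax' w (hballsub hw)
    have h2 : t ≤ e - dist w z := by
      rw [Metric.mem_ball] at hw
      have := dist_triangle w w0 z
      linarith
    have h3 : t * ‖deriv G w‖ ≤ 2 * t * lam := by
      calc t * ‖deriv G w‖ ≤ (e - dist w z) * ‖deriv G w‖ := by gcongr
        _ ≤ (e - dist w0 z) * lam := h1
        _ = 2 * t * lam := by rw [ht]; ring
    nlinarith
  have hdiffder : ∀ w ∈ Metric.ball w0 t, ‖deriv G w - deriv G w0‖ ≤ 4 * lam / t * dist w w0 := by
    intro w hw
    have := Complex.dist_le_div_mul_dist_of_mapsTo_ball (f := deriv G) (c := w0) (z := w)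
      (R₁ := t) (R₂ := 4 * lam) (hG'.mono (hballsub.trans hsub)) ?_ hw
    · rwa [dist_eq_norm] at this
    · intro v hv
      rw [Metric.mem_closedBall, dist_eq_norm]
      calc ‖deriv G v - deriv G w0‖ ≤ ‖deriv G v‖ + ‖deriv G w0‖ := norm_sub_le _ _
        _ ≤ 2 * lam + lam := by gcongr; exact hder v hv
        _ ≤ 4 * lam := by linarith
  set s := t / 8 with hs
  have hspos : 0 < s := by positivity
  have hssub : Metric.closedBall w0 s ⊆ Metric.ball w0 t :=
    Metric.closedBall_subset_ball (by rw [hs]; linarith)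
  have hGat : ∀ w ∈ Metric.closedBall w0 s, DifferentiableAt ℂ G w := fun w hw =>
    hG.differentiableAt (Metric.isOpen_ball.mem_nhds (hsub (hballsub (hssub hw))))
  have hdev : ∀ w ∈ Metric.closedBall w0 s,
      ‖(G w - deriv G w0 * w) - (G w0 - deriv G w0 * w0)‖ ≤ lam / 2 * ‖w - w0‖ := by
    intro w hw
    have hh := Convex.norm_image_sub_le_of_norm_deriv_le
      (f := fun v => G v - deriv G w0 * v) (C := lam / 2)
      (s := Metric.closedBall w0 s) (x := w0) (y := w) ?_ ?_ (convex_closedBall _ _)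
      (Metric.mem_closedBall_self hspos.le) hw
    · exact hh
    · intro v hv
      exact (hGat v hv).sub ((differentiableAt_id).const_mul _)
    · intro v hv
      have : deriv (fun v => G v - deriv G w0 * v) v = deriv G v - deriv G w0 := by
        have := ((hGat v hv).hasDerivAt.fun_sub ((hasDerivAt_id v).const_mul (deriv G w0))).deriv
        simpa using this
      rw [this]
      refine (hdiffder v (hssub hv)).trans ?_
      rw [Metric.mem_closedBall] at hv
      calc 4 * lam / t * dist v w0 ≤ 4 * lam / t * s := by gcongr
        _ = lam / 2 := by rw [hs]; field_simp; norm_num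
  have hsphere : ∀ w ∈ Metric.sphere w0 s, lam * s / 2 ≤ ‖G w - G w0‖ := by
    intro w hw
    have h1 := hdev w (Metric.sphere_subset_closedBall hw)
    have hws : ‖w - w0‖ = s := by rw [← dist_eq_norm]; exact hw
    rw [hws] at h1
    have h2 : G w - G w0 = deriv G w0 * (w - w0) +
      ((G w - deriv G w0 * w) - (G w0 - deriv G w0 * w0)) := by ring
    have h3 : ‖deriv G w0 * (w - w0)‖ = lam * s := by rw [norm_mul, hws]
    rw [h2]
    have h4 := norm_sub_le_norm_add (deriv G w0 * (w - w0))
      ((G w - deriv G w0 * w) - (G w0 - deriv G w0 * w0))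
    linarith
  have hdc : DiffContOnCl ℂ G (Metric.ball w0 s) := by
    apply DifferentiableOn.diffContOnCl
    rw [closure_ball _ hspos.ne']
    intro w hw
    exact (hGat w hw).differentiableWithinAt
  have himg := hdc.ball_subset_image_closedBall hspos hsphere ?_
  · obtain ⟨l, hl, hld⟩ := hno (G w0)
    apply hl
    have : l ∈ Metric.ball (G w0) (lam * s / 2 / 2) := by
      rw [Metric.mem_ball]
      refine hld.trans_le ?_
      rw [hs]
      nlinarith
    obtain ⟨v, hv, hv2⟩ := himg this
    exact ⟨v, hsub (hballsub (hssub hv)), hv2⟩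
  · have h1 : ∀ᶠ w in 𝓝[≠] w0, G w ≠ G w0 :=
      (hGat w0 (Metric.mem_closedBall_self hspos.le)).hasDerivAt.eventually_ne
        (norm_pos_iff.1 hlam0)
    exact h1.frequently.filter_mono nhdsWithin_le_nhds

/-- Holomorphic logarithm on an open convex set, normalised at a point. -/
lemma exists_hlog {Ω : Set ℂ} (hc : Convex ℝ Ω) (ho : IsOpen Ω) {b : ℂ} (hb : b ∈ Ω)
    {g : ℂ → ℂ} (hg : DifferentiableOn ℂ g Ω) (h0 : ∀ z ∈ Ω, g z ≠ 0) :
    ∃ L : ℂ → ℂ, DifferentiableOn ℂ L Ω ∧ (∀ z ∈ Ω, exp (L z) = g z) ∧ L b = log (g b) := by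
  have hsc : IsSimplyConnected Ω := by
    have : ContractibleSpace Ω := hc.contractibleSpace ⟨b, hb⟩
    exact (inferInstance : SimplyConnectedSpace Ω)
  obtain ⟨L, hLc, hL⟩ := Complex.exists_continuousOn_eqOn_exp_comp hsc ho hg.continuousOn
    (by rintro ⟨z, hz, hz0⟩; exact h0 z hz hz0)
  have hL' : ∀ z ∈ Ω, exp (L z) = g z := fun z hz => hL hz
  refine ⟨fun z => L z - L b + log (g b), ?_, ?_, by simp⟩
  · have : DifferentiableOn ℂ L Ω := by
      intro z hz
      apply DifferentiableAt.differentiableWithinAt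
      have hcz : ContinuousAt L z := hLc.continuousAt (ho.mem_nhds hz)
      have h1 : ∀ᶠ w in 𝓝 z, ‖L w - L z‖ < 1 := by
        have : Tendsto (fun w => ‖L w - L z‖) (𝓝 z) (𝓝 0) := by
          have := (hcz.sub (continuousAt_const (y := L z))).norm
          simpa [ContinuousAt] using this
        exact this.eventually (gt_mem_nhds one_pos)
      have h2 : L =ᶠ[𝓝 z] fun w => L z + log (g w / g z) := by
        filter_upwards [h1, ho.mem_nhds hz] with w hw hwΩ
        rw [← hL' w hwΩ, ← hL' z hz, ← exp_sub, log_exp]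
        · ring
        · have := neg_le_of_abs_le (abs_im_le_norm (L w - L z))
          have := Real.pi_gt_three
          linarith
        · have := le_of_abs_le (abs_im_le_norm (L w - L z))
          have := Real.pi_gt_three
          linarith
      refine DifferentiableAt.congr_of_eventuallyEq ?_ h2
      have hgz : DifferentiableAt ℂ g z := hg.differentiableAt (ho.mem_nhds hz)
      refine DifferentiableAt.const_add _ (DifferentiableAt.clog (hgz.div_const _) ?_)
      rw [div_self (h0 z hz)]
      exact one_mem_slitPlane
    exact (this.sub_const _).add_const _
  · intro z hz
    rw [exp_add, exp_sub, hL' z hz, hL' b hb, exp_log (h0 b hb), div_mul_cancel₀ _ (h0 b hb)]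

/-- The points with `cosh` an odd integer form a `4`-net. -/
lemma cosh_net (w : ℂ) : ∃ l : ℂ, (∃ n : ℤ, cosh l = 2 * n - 1) ∧ dist l w < 4 := by
  obtain ⟨x, y⟩ := w
  have hc1 : 1 ≤ Real.cosh x := Real.one_le_cosh x
  set k : ℤ := ⌊(Real.cosh x - 1) / 2⌋ with hk
  have hk0 : 0 ≤ k := Int.floor_nonneg.2 (by linarith)
  have hk1 : (k : ℝ) ≤ (Real.cosh x - 1) / 2 := Int.floor_le _
  have hk2 : (Real.cosh x - 1) / 2 < k + 1 := Int.lt_floor_add_one _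
  have hk0' : (0 : ℝ) ≤ k := by exact_mod_cast hk0
  obtain ⟨x0, hx0, hx0c⟩ : ∃ x0 : ℝ, 0 ≤ x0 ∧ Real.cosh x0 = 2 * k + 1 := by
    have := intermediate_value_Icc (abs_nonneg x) (Real.continuous_cosh.continuousOn
      (s := Icc 0 |x|))
    have hm : (2 * k + 1 : ℝ) ∈ Icc (Real.cosh 0) (Real.cosh |x|) := by
      rw [Real.cosh_zero, Real.cosh_abs]; constructor <;> linarith
    obtain ⟨x0, h1, h2⟩ := this hm
    exact ⟨x0, h1.1, h2⟩
  have hle : x0 ≤ |x| := by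
    have : Real.cosh x0 ≤ Real.cosh x := by rw [hx0c]; linarith
    rw [Real.cosh_le_cosh, abs_of_nonneg hx0] at this
    exact this
  have hlt : |x| < x0 + 2 := by
    by_contra hcon
    push Not at hcon
    have h1 : Real.cosh (x0 + 2) ≤ Real.cosh x := by
      rw [Real.cosh_le_cosh, abs_of_nonneg (by linarith)]; exact hcon
    have h2 : 3 * Real.cosh x0 ≤ Real.cosh (x0 + 2) := by
      rw [Real.cosh_add]
      have h3 : 3 ≤ Real.cosh 2 := by
        rw [Real.cosh_eq]
        have h4 := Real.exp_one_gt_d9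
        have h5 : Real.exp 2 = Real.exp 1 * Real.exp 1 := by rw [← Real.exp_add]; norm_num
        have h6 := Real.exp_pos (-2)
        nlinarith
      have h4 : 0 ≤ Real.sinh x0 := Real.sinh_nonneg_iff.2 hx0
      have h5 : 0 ≤ Real.sinh 2 := Real.sinh_nonneg_iff.2 (by norm_num)
      have h6 := Real.cosh_pos x0
      nlinarith [mul_nonneg h4 h5]
    rw [hx0c] at h2
    linarith
  obtain ⟨x1, hx1c, hx1d⟩ : ∃ x1 : ℝ, Real.cosh x1 = 2 * k + 1 ∧ |x1 - x| < 2 := by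
    rcases le_total 0 x with hx | hx
    · rw [abs_of_nonneg hx] at hle hlt
      exact ⟨x0, hx0c, by rw [abs_lt]; constructor <;> linarith⟩
    · rw [abs_of_nonpos hx] at hle hlt
      exact ⟨-x0, by rw [Real.cosh_neg, hx0c], by rw [abs_lt]; constructor <;> linarith⟩
  set m : ℤ := round (y / Real.pi) with hm
  have hpi := Real.pi_pos
  have hm1 : |y / Real.pi - m| ≤ 1 / 2 := abs_sub_round _
  have hm2 : |m * Real.pi - y| ≤ 1 / 2 * Real.pi := by
    have : (m * Real.pi - y) = -((y / Real.pi - m) * Real.pi) := by field_simp; ring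
    rw [this, abs_neg, abs_mul, abs_of_pos hpi]
    gcongr
  refine ⟨⟨x1, m * Real.pi⟩, ?_, ?_⟩
  · have h1 : (⟨x1, m * Real.pi⟩ : ℂ) = (x1 : ℂ) + (m : ℂ) * Real.pi * I := by
      apply Complex.ext <;> simp
    have h3 : cosh (x1 : ℂ) = 2 * k + 1 := by
      rw [← ofReal_cosh, hx1c]; push_cast; rfl
    rw [h1, cosh_add, sinh_mul_I, Complex.sin_int_mul_pi, cosh_mul_I, h3]
    rcases Int.even_or_odd m with hev | hodd
    · refine ⟨k + 1, ?_⟩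
      have : Complex.cos (m * Real.pi) = 1 := by
        obtain ⟨j, hj⟩ := hev
        rw [hj]; push_cast
        rw [show ((j : ℂ) + j) * Real.pi = j * (2 * Real.pi) by ring]
        exact Complex.cos_int_mul_two_pi j
      rw [this]; push_cast; ring
    · refine ⟨-k, ?_⟩
      have : Complex.cos (m * Real.pi) = -1 := by
        obtain ⟨j, hj⟩ := hodd
        rw [hj]; push_cast
        rw [show (2 * (j : ℂ) + 1) * Real.pi = j * (2 * Real.pi) + Real.pi by ring]
        exact Complex.cos_int_mul_two_pi_add_pi j
      rw [this]; push_cast; ring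
  · rw [dist_eq_norm]
    refine (norm_le_abs_re_add_abs_im _).trans_lt ?_
    simp only [sub_re, sub_im]
    have := Real.pi_lt_four
    linarith

/-- The Landau-Schottky uniformisation by `cosh`. -/
lemma schottky_lift {Ω : Set ℂ} (hc : Convex ℝ Ω) (ho : IsOpen Ω) {b : ℂ} (hb : b ∈ Ω)
    {h : ℂ → ℂ} (hh : DifferentiableOn ℂ h Ω) (h0 : ∀ z ∈ Ω, h z ≠ 0) (h1 : ∀ z ∈ Ω, h z ≠ 1)
    (hhb : ‖h b‖ ≤ 1 / 2) :
    ∃ G : ℂ → ℂ, DifferentiableOn ℂ G Ω ∧ ‖G b‖ ≤ 10 ∧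
      (∀ w : ℂ, ∃ l : ℂ, l ∉ G '' Ω ∧ dist l w < 4) ∧
      ∀ z ∈ Ω, ‖h z‖ ≤ 1 + Real.exp (Real.pi * (1 + Real.exp ‖G z‖)) := by
  obtain ⟨L, hLd, hLe, hLb⟩ := exists_hlog hc ho hb (g := fun z => 1 - h z)
    (hh.const_sub 1) (fun z hz => sub_ne_zero.2 (h1 z hz).symm)
  have hpi := Real.pi_pos
  have hpiC : (2 * Real.pi * I : ℂ) ≠ 0 := by
    simp [Real.pi_ne_zero]
  set w : ℂ → ℂ := fun z => 2 * (L z / (2 * Real.pi * I)) - 1 with hw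
  have hwd : DifferentiableOn ℂ w Ω := ((hLd.div_const _).const_mul 2).sub_const 1
  have hwodd : ∀ z ∈ Ω, ∀ n : ℤ, w z ≠ 2 * n - 1 := by
    intro z hz n hn
    have : L z = n * (2 * Real.pi * I) := by
      simp only [hw] at hn
      have h2 : L z / (2 * Real.pi * I) = n := by linear_combination hn / 2
      rw [div_eq_iff hpiC] at h2
      exact h2
    have h3 := hLe z hz
    rw [this, Complex.exp_int_mul_two_pi_mul_I] at h3
    exact h0 z hz (by linear_combination h3)
  have hw1 : ∀ z ∈ Ω, w z ^ 2 - 1 ≠ 0 := by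
    intro z hz hzz
    have : (w z - 1) * (w z + 1) = 0 := by linear_combination hzz
    rcases mul_eq_zero.1 this with h | h
    · exact hwodd z hz 1 (by push_cast; linear_combination h)
    · exact hwodd z hz 0 (by push_cast; linear_combination h)
  obtain ⟨S, hSd, hSe, -⟩ := exists_hlog hc ho hb (g := fun z => w z ^ 2 - 1)
    ((hwd.pow 2).sub_const 1) hw1
  set σ : ℂ → ℂ := fun z => exp (S z / 2) with hσ
  have hσd : DifferentiableOn ℂ σ Ω := (hSd.div_const 2).cexp
  have hσ2 : ∀ z ∈ Ω, σ z ^ 2 = w z ^ 2 - 1 := by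
    intro z hz
    rw [← hSe z hz, hσ]
    simp only
    rw [← Complex.exp_nat_mul]; congr 1; push_cast; ring
  have hprod : ∀ z ∈ Ω, (w z + σ z) * (w z - σ z) = 1 := by
    intro z hz; linear_combination - hσ2 z hz
  have hne : ∀ z ∈ Ω, w z + σ z ≠ 0 := by
    intro z hz h; have := hprod z hz; rw [h] at this; simp at this
  obtain ⟨G, hGd, hGe, hGb⟩ := exists_hlog hc ho hb (g := fun z => w z + σ z)
    (hwd.add hσd) hne
  have hcosh : ∀ z ∈ Ω, cosh (G z) = w z := by
    intro z hz
    have h2 : exp (-G z) = w z - σ z := by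
      rw [Complex.exp_neg, hGe z hz]
      exact inv_eq_of_mul_eq_one_right (hprod z hz)
    rw [Complex.cosh, h2, hGe z hz]; ring
  refine ⟨G, hGd, ?_, ?_, ?_⟩
  · have hLb' : ‖L b‖ ≤ 3 / 4 := by
      rw [hLb]
      have := Complex.norm_log_one_add_half_le_self (z := -h b) (by rw [norm_neg]; exact hhb)
      rw [norm_neg] at this
      rw [sub_eq_add_neg]
      linarith
    have hwb : ‖w b‖ ≤ 2 := by
      have h3 : ‖(2 * Real.pi * I : ℂ)‖ = 2 * Real.pi := by simp [abs_of_pos hpi]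
      have h4 := Real.pi_gt_three
      calc ‖w b‖ ≤ ‖2 * (L b / (2 * Real.pi * I))‖ + ‖(1 : ℂ)‖ := norm_sub_le _ _
        _ = 2 * (‖L b‖ / (2 * Real.pi)) + 1 := by
          rw [norm_mul, norm_div, h3]; simp
        _ ≤ 2 * ((3/4) / (2 * 3)) + 1 := by gcongr
        _ ≤ 2 := by norm_num
    have hσb : ‖σ b‖ ≤ 3 := by
      have h5 : ‖σ b‖ ^ 2 ≤ 5 := by
        rw [← norm_pow, hσ2 b hb]
        calc ‖w b ^ 2 - 1‖ ≤ ‖w b ^ 2‖ + ‖(1 : ℂ)‖ := norm_sub_le _ _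
          _ ≤ 2 ^ 2 + 1 := by rw [norm_pow]; simp only [norm_one]; gcongr
          _ = 5 := by norm_num
      nlinarith [norm_nonneg (σ b)]
    have hA : ‖w b + σ b‖ ≤ 5 := (norm_add_le _ _).trans (by linarith)
    have hB : ‖w b - σ b‖ ≤ 5 := (norm_sub_le _ _).trans (by linarith)
    have hAB : ‖w b + σ b‖ * ‖w b - σ b‖ = 1 := by rw [← norm_mul, hprod b hb, norm_one]
    have hApos : 0 < ‖w b + σ b‖ := norm_pos_iff.2 (hne b hb)
    rw [hGb]
    refine (norm_le_abs_re_add_abs_im _).trans ?_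
    rw [log_re, log_im]
    have h6 := abs_arg_le_pi (w b + σ b)
    have h7 := Real.pi_lt_four
    have h8 : |Real.log ‖w b + σ b‖| ≤ 4 := by
      rw [abs_le]
      constructor
      · rw [neg_le, ← Real.log_inv]
        have : ‖w b + σ b‖⁻¹ = ‖w b - σ b‖ := inv_eq_of_mul_eq_one_right hAB
        rw [this]
        have hBpos : 0 < ‖w b - σ b‖ := by
          rw [← this]; positivity
        have := Real.log_le_sub_one_of_pos hBpos
        linarith
      · have := Real.log_le_sub_one_of_pos hApos
        linarith
    linarith
  · intro v
    obtain ⟨l, ⟨n, hn⟩, hl⟩ := cosh_net v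
    refine ⟨l, ?_, hl⟩
    rintro ⟨z, hz, rfl⟩
    rw [hcosh z hz] at hn
    exact hwodd z hz n hn
  · intro z hz
    have h2 : h z = 1 - exp (L z) := by rw [hLe z hz]; ring
    have h3 : L z = Real.pi * I * (1 + cosh (G z)) := by
      rw [hcosh z hz, hw]; simp only; field_simp; ring
    have h4 : ‖L z‖ ≤ Real.pi * (1 + Real.exp ‖G z‖) := by
      rw [h3, norm_mul, norm_mul]
      simp only [norm_real, norm_I, mul_one, Real.norm_eq_abs, abs_of_pos hpi]
      gcongr
      refine (norm_add_le _ _).trans ?_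
      rw [norm_one]
      gcongr
      rw [Complex.cosh, norm_div]
      have e1 : ‖exp (G z)‖ ≤ Real.exp ‖G z‖ := Complex.norm_exp_le_exp_norm _
      have e2 : ‖exp (-G z)‖ ≤ Real.exp ‖G z‖ := by
        have := Complex.norm_exp_le_exp_norm (-G z)
        rwa [norm_neg] at this
      have e3 := norm_add_le (exp (G z)) (exp (-G z))
      have : ‖(2 : ℂ)‖ = 2 := by simp
      rw [this, div_le_iff₀ (by norm_num)]
      linarith
    rw [h2]
    refine (norm_sub_le _ _).trans ?_
    rw [norm_one]
    gcongr
    exact (Complex.norm_exp_le_exp_norm _).trans (Real.exp_le_exp.2 h4)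

/-- Growth of the lift along segments. -/
lemma lift_growth {Ω : Set ℂ} (hc : Convex ℝ Ω) {G : ℂ → ℂ}
    (hG : DifferentiableOn ℂ G Ω) (hno : ∀ w : ℂ, ∃ l : ℂ, l ∉ G '' Ω ∧ dist l w < 4)
    {b z : ℂ} {δ d D : ℝ} (hd : 0 < d) (hdδ : d ≤ δ / 2) (hbδ : Metric.ball b δ ⊆ Ω)
    (hzd : Metric.ball z d ⊆ Ω) (hD : dist b z ≤ D) :
    ‖G z‖ ≤ ‖G b‖ + 1200 * D / δ * Real.log (δ / d) := by
  have hδ : 0 < δ := by linarith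
  have hD0 : 0 ≤ D := dist_nonneg.trans hD
  set p : ℝ → ℂ := fun t => z + t * (b - z) with hp
  set ρ : ℝ → ℝ := fun t => d + t * (δ - d) with hρ
  have hρpos : ∀ t, 0 ≤ t → 0 < ρ t := by
    intro t ht
    have : 0 ≤ t * (δ - d) := mul_nonneg ht (by linarith)
    simp only [hρ]; linarith
  have hball : ∀ t ∈ Icc (0 : ℝ) 1, Metric.ball (p t) (ρ t) ⊆ Ω := by
    intro t ht w hw
    set e : ℂ := (w - p t) / (ρ t : ℂ) with he
    have hρt := hρpos t ht.1
    have hρC : (ρ t : ℂ) ≠ 0 := by exact_mod_cast hρt.ne'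
    have he1 : ‖e‖ < 1 := by
      rw [he, norm_div, norm_real, Real.norm_of_nonneg hρt.le, div_lt_one hρt, ← dist_eq_norm]
      exact hw
    have h1 : z + d * e ∈ Ω := hzd (by
      rw [Metric.mem_ball, dist_eq_norm, add_sub_cancel_left, norm_mul, norm_real,
        Real.norm_of_nonneg hd.le]
      nlinarith)
    have h2 : b + δ * e ∈ Ω := hbδ (by
      rw [Metric.mem_ball, dist_eq_norm, add_sub_cancel_left, norm_mul, norm_real,
        Real.norm_of_nonneg hδ.le]
      nlinarith)
    have h3 := hc h1 h2 (sub_nonneg.2 ht.2) ht.1 (by ring)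
    have h4 : (1 - t) • (z + d * e) + t • (b + δ * e) = w := by
      have h5 : (ρ t : ℂ) * e = w - p t := by rw [he]; field_simp
      simp only [hp, hρ] at h5
      push_cast at h5
      simp only [real_smul]
      push_cast
      linear_combination h5
    rwa [h4] at h3
  have hder : ∀ t ∈ Icc (0 : ℝ) 1, ‖deriv G (p t)‖ ≤ 600 / ρ t := by
    intro t ht
    apply bloch_aux (hρpos t ht.1) (hG.mono (hball t ht))
    intro w
    obtain ⟨l, hl, hl2⟩ := hno w
    exact ⟨l, fun h => hl (image_mono (hball t ht) h), hl2⟩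
  have hGp : ∀ t ∈ Icc (0 : ℝ) 1,
      HasDerivAt (fun t : ℝ => G (p t) - G b) (deriv G (p t) * (b - z)) t := by
    intro t ht
    have h1 : HasDerivAt G (deriv G (p t)) (p t) := by
      have : Metric.ball (p t) (ρ t) ∈ 𝓝 (p t) := Metric.ball_mem_nhds _ (hρpos t ht.1)
      exact ((hG.mono (hball t ht)).differentiableAt this).hasDerivAt
    have h2 : HasDerivAt (fun s : ℂ => z + s * (b - z)) (b - z) (t : ℂ) := by
      simpa using ((hasDerivAt_id (t : ℂ)).mul_const (b - z)).const_add z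
    have h3 : HasDerivAt (fun s : ℂ => G (z + s * (b - z))) (deriv G (p t) * (b - z)) (t : ℂ) :=
      HasDerivAt.comp (t : ℂ) (h₂ := G) (h := fun s : ℂ => z + s * (b - z)) h1 h2
    exact (h3.comp_ofReal).sub_const _
  set K := 1200 * D / δ with hK
  have hK0 : 0 ≤ K := by positivity
  -- reverse the parametrisation
  have key := image_norm_le_of_norm_deriv_right_le_deriv_boundary' (a := 0) (b := 1)
    (f := fun t : ℝ => G (p (1 - t)) - G b)
    (f' := fun t : ℝ => - (deriv G (p (1 - t)) * (b - z)))
    (B := fun t => K * (Real.log δ - Real.log (ρ (1 - t))))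
    (B' := fun t => K * ((δ - d) / ρ (1 - t))) ?_ ?_ ?_ ?_ ?_ ?_ (x := 1) (by simp)
  · have h1 : ‖G z - G b‖ ≤ K * Real.log (δ / d) := by
      have h2 : p (1 - 1) = z := by simp [hp]
      have h3 : ρ (1 - 1) = d := by simp [hρ]
      rw [h2, h3] at key
      rwa [Real.log_div hδ.ne' hd.ne']
    have := norm_add_le (G z - G b) (G b)
    rw [sub_add_cancel] at this
    linarith
  · intro t ht
    have := (hGp (1 - t) ⟨by linarith [ht.2], by linarith [ht.1]⟩).continuousAt
    exact (ContinuousAt.comp (f := fun t : ℝ => 1 - t) (g := fun t : ℝ => G (p t) - G b)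
      this (by fun_prop)).continuousWithinAt
  · intro t ht
    have h1 := (hGp (1 - t) ⟨by linarith [ht.2], by linarith [ht.1]⟩)
    have h2 : HasDerivAt (fun t : ℝ => 1 - t) (-1) t := by
      simpa using (hasDerivAt_id t).const_sub 1
    have h3 := HasDerivAt.scomp t (h := fun t : ℝ => 1 - t) (g₁ := fun t : ℝ => G (p t) - G b) h1 h2
    simp only [neg_smul, one_smul] at h3
    exact h3.hasDerivWithinAt
  · simp [hp, hρ]
  · intro t ht
    have hpos : ρ (1 - t) ≠ 0 := (hρpos (1 - t) (by linarith [ht.2])).ne'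
    apply ContinuousAt.continuousWithinAt
    have : ContinuousAt (fun t => ρ (1 - t)) t := by simp only [hρ]; fun_prop
    exact (continuousAt_const.sub (this.log hpos)).const_mul K
  · intro t ht
    have hpos : ρ (1 - t) ≠ 0 := (hρpos (1 - t) (by linarith [ht.2])).ne'
    have h1 : HasDerivAt (fun t => ρ (1 - t)) (-(δ - d)) t := by
      have := (((hasDerivAt_id t).const_sub 1).mul_const (δ - d)).const_add d
      simpa [hρ] using this
    have h2 := ((h1.log hpos).const_sub (Real.log δ)).const_mul K
    have h3 : K * -(-(δ - d) / ρ (1 - t)) = K * ((δ - d) / ρ (1 - t)) := by ring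
    rw [h3] at h2
    exact h2.hasDerivWithinAt
  · intro t ht
    have ht' : (1 - t) ∈ Icc (0 : ℝ) 1 := ⟨by linarith [ht.2], by linarith [ht.1]⟩
    have hpos := hρpos (1 - t) ht'.1
    rw [norm_neg, norm_mul]
    have h1 : ‖b - z‖ ≤ D := by rw [← dist_eq_norm]; exact hD
    calc ‖deriv G (p (1 - t))‖ * ‖b - z‖ ≤ 600 / ρ (1 - t) * D := by
          gcongr; exact hder _ ht'
      _ = K * ((δ / 2) / ρ (1 - t)) := by rw [hK]; field_simp; ring
      _ ≤ K * ((δ - d) / ρ (1 - t)) := by gcongr; linarith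

/-- Quantitative Schottky in a bounded convex domain. -/
lemma schottky_bound {Ω : Set ℂ} (hc : Convex ℝ Ω) (ho : IsOpen Ω) {b : ℂ} (hb : b ∈ Ω)
    {D : ℝ} (hD : ∀ z ∈ Ω, dist b z ≤ D) :
    ∃ (A : ℕ) (K d0 : ℝ), 1 ≤ A ∧ 0 < K ∧ 0 < d0 ∧
      ∀ h : ℂ → ℂ, DifferentiableOn ℂ h Ω → (∀ z ∈ Ω, h z ≠ 0) → (∀ z ∈ Ω, h z ≠ 1) →
        ‖h b‖ ≤ 1 / 2 → ∀ z d, 0 < d → d ≤ d0 → Metric.ball z d ⊆ Ω →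
        ‖h z‖ ≤ Real.exp (K / d ^ A) := by
  obtain ⟨δ, hδ, hδΩ⟩ := Metric.isOpen_iff.1 ho b hb
  have hD0 : 0 ≤ D := dist_nonneg.trans (hD b hb)
  set k := 1200 * D / δ with hk
  obtain ⟨A, hA⟩ := exists_nat_ge (k + 1)
  have hk0 : 0 ≤ k := by positivity
  have hA1 : (1 : ℝ) ≤ A := by linarith
  refine ⟨A, (5 + 4 * Real.exp 10) * δ ^ A, δ / 2, by exact_mod_cast hA1, by positivity,
    by positivity, ?_⟩
  intro h hh h0 h1 hhb z d hd hdd hzd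
  obtain ⟨G, hGd, hGb, hGno, hGh⟩ := schottky_lift hc ho hb hh h0 h1 hhb
  have hz : z ∈ Ω := hzd (Metric.mem_ball_self hd)
  have hg := lift_growth hc hGd hGno hd hdd hδΩ hzd (hD z hz)
  have hq : 1 ≤ δ / d := by rw [le_div_iff₀ hd]; linarith
  have hlog : 0 ≤ Real.log (δ / d) := Real.log_nonneg hq
  set q := δ / d with hqd
  have hexp : Real.exp ‖G z‖ ≤ Real.exp 10 * q ^ A := by
    calc Real.exp ‖G z‖ ≤ Real.exp (10 + A * Real.log q) := by
          apply Real.exp_le_exp.2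
          have : k * Real.log q ≤ A * Real.log q := by gcongr; linarith
          linarith
      _ = Real.exp 10 * q ^ A := by
          rw [Real.exp_add, mul_comm (A : ℝ), ← Real.rpow_def_of_pos (by linarith),
            Real.rpow_natCast]
  have hqA : 1 ≤ q ^ A := one_le_pow₀ hq
  have hpi := Real.pi_pos
  have hpi4 := Real.pi_lt_four
  refine (hGh z hz).trans ?_
  set x := Real.pi * (1 + Real.exp ‖G z‖) with hx
  have hx0 : 0 ≤ x := by positivity
  have hx1 : x ≤ 4 * (1 + Real.exp 10 * q ^ A) := by rw [hx]; gcongr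
  have h2 : 1 + Real.exp x ≤ Real.exp (x + 1) := by
    rw [Real.exp_add]
    have := Real.one_le_exp hx0
    have := Real.exp_one_gt_d9
    nlinarith
  refine h2.trans (Real.exp_le_exp.2 ?_)
  have : (5 + 4 * Real.exp 10) * δ ^ A / d ^ A = (5 + 4 * Real.exp 10) * q ^ A := by
    rw [hqd, div_pow]; ring
  rw [this]
  nlinarith

lemma re_inv_pow_ge {A : ℕ} (hA : 1 ≤ A) {u : ℂ} (hu : 0 < u.re) (hi : A * |u.im| ≤ u.re) :
    1 / 2 * (‖u‖ ^ A)⁻¹ ≤ ((u ^ A)⁻¹).re := by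
  have hA' : (1 : ℝ) ≤ A := by exact_mod_cast hA
  have hu0 : u ≠ 0 := by rintro rfl; simp at hu
  have hn : 0 < ‖u‖ := norm_pos_iff.2 hu0
  set θ := arg u with hθ
  have hθ1 : |θ| < Real.pi / 2 := abs_arg_lt_pi_div_two_iff.2 (Or.inl hu)
  have hθ2 : |θ| ≤ |u.im| / u.re := by
    have ht : Real.tan θ = u.im / u.re := tan_arg u
    rcases le_total 0 θ with h | h
    · rw [abs_of_nonneg h] at hθ1 ⊢
      have := Real.le_tan h hθ1
      rw [ht] at this
      exact this.trans (by gcongr; exact le_abs_self _)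
    · rw [abs_of_nonpos h] at hθ1 ⊢
      have := Real.le_tan (neg_nonneg.2 h) hθ1
      rw [Real.tan_neg, ht, ← neg_div] at this
      exact this.trans (by gcongr; exact neg_le_abs _)
  have hθ3 : |A * θ| ≤ 1 := by
    rw [abs_mul, Nat.abs_cast]
    calc (A : ℝ) * |θ| ≤ A * (|u.im| / u.re) := by gcongr
      _ = A * |u.im| / u.re := by ring
      _ ≤ 1 := by rw [div_le_one hu]; exact hi
  have hcos : 1 / 2 ≤ Real.cos (A * θ) := by
    have := Real.one_sub_sq_div_two_le_cos (x := A * θ)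
    have h2 : (A * θ) ^ 2 ≤ 1 := by rw [sq_le_one_iff_abs_le_one]; exact hθ3
    linarith
  have hpow : (u ^ A)⁻¹ = ((‖u‖ ^ A)⁻¹ : ℝ) * exp ((-(A * θ) : ℝ) * I) := by
    conv_lhs => rw [← norm_mul_exp_arg_mul_I u, mul_pow, ← Complex.exp_nat_mul, mul_inv,
      ← Complex.exp_neg]
    push_cast
    congr 2
    ring
  rw [hpow, re_ofReal_mul, exp_ofReal_mul_I_re, Real.cos_neg, mul_comm]
  gcongr

lemma rhombus_bound {A : ℕ} (hA : 1 ≤ A) {K r : ℝ} (hK : 0 < K) (hr : 0 < r) :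
    ∃ C r' : ℝ, 0 < r' ∧ ∀ F : ℂ → ℂ, DifferentiableOn ℂ F (Metric.ball 0 (2 * r)) →
      (∀ w, ‖w‖ ≤ r → w.im ≠ 0 → ‖F w‖ ≤ Real.exp (K / |w.im| ^ A)) →
      ∀ w, ‖w‖ ≤ r' → ‖F w‖ ≤ C := by
  have hA' : (1 : ℝ) ≤ A := by exact_mod_cast hA
  have hA0 : (0 : ℝ) < A := by linarith
  set K1 : ℝ := 2 * K * (2 * A) ^ A with hK1
  have hK1p : 0 < K1 := by positivity
  refine ⟨Real.exp (2 * K1 * ((r / 2) ^ A)⁻¹), r / (4 * A), by positivity, ?_⟩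
  intro F hF hFb
  have hFcont : ContinuousOn F (Metric.closedBall 0 r) :=
    hF.continuousOn.mono (Metric.closedBall_subset_ball (by linarith))
  obtain ⟨M, hM⟩ := (isCompact_closedBall (0 : ℂ) r).exists_bound_of_continuousOn hFcont
  -- choose s
  obtain ⟨s, hs0, hs1, hs2⟩ : ∃ s : ℝ, 0 < s ∧ s ≤ r / 2 ∧ M ≤ K1 / 2 * ((2 * s) ^ A)⁻¹ := by
    refine ⟨min (r / 2) (min (1 / 2) (K1 / (4 * (|M| + 1)))), by positivity, min_le_left _ _, ?_⟩
    set s := min (r / 2) (min (1 / 2) (K1 / (4 * (|M| + 1)))) with hs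
    have hs0 : 0 < s := by positivity
    have h1 : s ≤ 1 / 2 := (min_le_right _ _).trans (min_le_left _ _)
    have h2 : s ≤ K1 / (4 * (|M| + 1)) := (min_le_right _ _).trans (min_le_right _ _)
    have h3 : (2 * s) ^ A ≤ 2 * s := by
      calc (2 * s) ^ A ≤ (2 * s) ^ 1 := pow_le_pow_of_le_one (by positivity) (by linarith) hA
        _ = 2 * s := pow_one _
    have h4 : (2 * s)⁻¹ ≤ ((2 * s) ^ A)⁻¹ := inv_anti₀ (by positivity) h3
    have h5 : s * (4 * (|M| + 1)) ≤ K1 := by rwa [le_div_iff₀ (by positivity)] at h2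
    calc M ≤ |M| + 1 := by linarith [le_abs_self M]
      _ ≤ K1 / 2 * (2 * s)⁻¹ := by
        rw [← div_eq_mul_inv, le_div_iff₀ (by positivity)]; nlinarith
      _ ≤ _ := by gcongr
  set U : Set ℂ := {w | A * |w.im| < r - |w.re| ∧ |w.re| < r - s} with hU
  set Kc : Set ℂ := {w | A * |w.im| ≤ r - |w.re| ∧ |w.re| ≤ r - s} with hKc
  have hKcl : IsClosed Kc := by
    exact (isClosed_le (f := fun w : ℂ => A * |w.im|) (g := fun w : ℂ => r - |w.re|)
      (by fun_prop) (by fun_prop)).inter (isClosed_le (f := fun w : ℂ => |w.re|)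
      (g := fun _ : ℂ => r - s) (by fun_prop) (by fun_prop))
  have hUo : IsOpen U := by
    exact (isOpen_lt (f := fun w : ℂ => A * |w.im|) (g := fun w : ℂ => r - |w.re|)
      (by fun_prop) (by fun_prop)).inter (isOpen_lt (f := fun w : ℂ => |w.re|)
      (g := fun _ : ℂ => r - s) (by fun_prop) (by fun_prop))
  have hUK : U ⊆ Kc := fun w hw => ⟨hw.1.le, hw.2.le⟩
  have hclU : closure U ⊆ Kc := closure_minimal hUK hKcl
  have hKr : ∀ w ∈ Kc, ‖w‖ ≤ r := by
    intro w hw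
    refine (norm_le_abs_re_add_abs_im w).trans ?_
    have := hw.1
    nlinarith [abs_nonneg w.im]
  have hu : ∀ w ∈ Kc, ∀ u : ℂ, (u = w + r ∨ u = r - w) →
      r - |w.re| ≤ u.re ∧ s ≤ u.re ∧ A * |u.im| ≤ u.re ∧ |u.im| = |w.im| ∧ u ≠ 0 := by
    intro w hw u hu
    have h0 : r - |w.re| ≤ u.re ∧ |u.im| = |w.im| := by
      rcases hu with rfl | rfl
      · simp only [add_re, ofReal_re, add_im, ofReal_im, add_zero, and_true]
        linarith [neg_abs_le w.re]
      · simp only [sub_re, ofReal_re, sub_im, ofReal_im, zero_sub, abs_neg, and_true]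
        linarith [le_abs_self w.re]
    have h1 := hw.1
    have h2 := hw.2
    refine ⟨h0.1, by linarith [h0.1], by rw [h0.2]; linarith [h0.1], h0.2, ?_⟩
    rintro rfl
    have := h0.1
    simp at this
    linarith
  set E : ℂ → ℂ := fun w => exp (-(K1 * (((w + r) ^ A)⁻¹ + ((r - w) ^ A)⁻¹))) with hE
  set H : ℂ → ℂ := fun w => F w * E w with hH
  have hEn : ∀ w, ‖E w‖ =
      Real.exp (-(K1 * ((((w + r) ^ A)⁻¹).re + (((r - w) ^ A)⁻¹).re))) := by
    intro w
    rw [hE]; simp only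
    rw [Complex.norm_exp, neg_re, re_ofReal_mul, add_re]
  have hEle : ∀ w ∈ Kc, ∀ u : ℂ, (u = w + r ∨ u = r - w) →
      ‖E w‖ ≤ Real.exp (-(K1 / 2 * (‖u‖ ^ A)⁻¹)) := by
    intro w hw u hu'
    rw [hEn]
    apply Real.exp_le_exp.2
    have h1 := hu w hw (w + r) (Or.inl rfl)
    have h2 := hu w hw (r - w) (Or.inr rfl)
    have h3 := re_inv_pow_ge hA (by linarith) h1.2.2.1
    have h4 := re_inv_pow_ge hA (by linarith) h2.2.2.1
    have h5 : 0 ≤ (‖w + r‖ ^ A)⁻¹ := by positivity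
    have h6 : 0 ≤ (‖r - w‖ ^ A)⁻¹ := by positivity
    rcases hu' with rfl | rfl
    · nlinarith
    · nlinarith
  have hHd : DiffContOnCl ℂ H U := by
    apply DifferentiableOn.diffContOnCl
    intro w hw
    have hw' := hclU hw
    have h1 := (hu w hw' (w + r) (Or.inl rfl)).2.2.2.2
    have h2 := (hu w hw' (r - w) (Or.inr rfl)).2.2.2.2
    apply DifferentiableAt.differentiableWithinAt
    have hFw : DifferentiableAt ℂ F w := hF.differentiableAt
      (Metric.isOpen_ball.mem_nhds (by
        rw [Metric.mem_ball, dist_zero_right]; linarith [hKr w hw']))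
    apply hFw.mul
    have h3 : DifferentiableAt ℂ (fun w : ℂ => ((w + r) ^ A)⁻¹) w :=
      DifferentiableAt.fun_inv (by fun_prop) (pow_ne_zero _ h1)
    have h4 : DifferentiableAt ℂ (fun w : ℂ => ((r - w) ^ A)⁻¹) w :=
      DifferentiableAt.fun_inv (by fun_prop) (pow_ne_zero _ h2)
    exact ((h3.add h4).const_mul _).neg.cexp
  have hUb : Bornology.IsBounded U := by
    apply (Metric.isBounded_closedBall (x := (0 : ℂ)) (r := r)).subset
    intro w hw
    rw [Metric.mem_closedBall, dist_zero_right]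
    exact hKr w (hUK hw)
  have hfr : ∀ w ∈ frontier U, ‖H w‖ ≤ 1 := by
    intro w hw
    have hwK : w ∈ Kc := hclU hw.1
    have hwU : w ∉ U := by rw [← hUo.interior_eq]; exact hw.2
    obtain ⟨u, hu', huw⟩ : ∃ u : ℂ, (u = w + r ∨ u = r - w) ∧ u.re = r - |w.re| := by
      rcases le_total 0 w.re with h | h
      · exact ⟨r - w, Or.inr rfl, by simp [abs_of_nonneg h]⟩
      · exact ⟨w + r, Or.inl rfl, by simp [abs_of_nonpos h]; ring⟩
    obtain ⟨h1, h2, h3, h4, h5⟩ := hu w hwK u hu'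
    have hunorm : ‖u‖ ≤ 2 * u.re := by
      refine (norm_le_abs_re_add_abs_im u).trans ?_
      rw [abs_of_pos (by linarith)]
      nlinarith [abs_nonneg u.im]
    have hunpos : 0 < ‖u‖ := norm_pos_iff.2 h5
    rw [hH]; simp only
    rw [norm_mul]
    by_cases hedge : A * |w.im| = r - |w.re|
    · have him : |w.im| = u.re / A := by rw [huw, ← hedge]; field_simp
      have himpos : 0 < |w.im| := by rw [him]; exact div_pos (by linarith) hA0
      have hFw := hFb w (hKr w hwK) (abs_pos.1 himpos)
      have hEw := hEle w hwK u hu'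
      calc ‖F w‖ * ‖E w‖ ≤ Real.exp (K / |w.im| ^ A) * Real.exp (-(K1 / 2 * (‖u‖ ^ A)⁻¹)) := by
            gcongr
        _ = Real.exp (K / |w.im| ^ A - K1 / 2 * (‖u‖ ^ A)⁻¹) := by
            rw [← Real.exp_add]; ring_nf
        _ ≤ Real.exp 0 := by
            apply Real.exp_le_exp.2
            rw [sub_nonpos]
            have h6 : ‖u‖ ≤ 2 * A * |w.im| := by rw [him]; field_simp; linarith
            have h7 : ‖u‖ ^ A ≤ (2 * A * |w.im|) ^ A := by gcongr
            have h8 : ((2 * A * |w.im|) ^ A)⁻¹ ≤ (‖u‖ ^ A)⁻¹ := inv_anti₀ (by positivity) h7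
            calc K / |w.im| ^ A = K1 / 2 * ((2 * A * |w.im|) ^ A)⁻¹ := by
                  rw [hK1, mul_pow (2 * (A : ℝ))]; field_simp
              _ ≤ _ := by gcongr
        _ = 1 := Real.exp_zero
    · have hre : |w.re| = r - s := by
        by_contra hne
        exact hwU ⟨lt_of_le_of_ne hwK.1 hedge, lt_of_le_of_ne hwK.2 hne⟩
      have hus : ‖u‖ ≤ 2 * s := by rw [huw, hre] at hunorm; linarith
      have hEw := hEle w hwK u hu'
      have h7 : ‖u‖ ^ A ≤ (2 * s) ^ A := by gcongr
      have h8 : ((2 * s) ^ A)⁻¹ ≤ (‖u‖ ^ A)⁻¹ := inv_anti₀ (by positivity) h7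
      have h9 : ‖F w‖ ≤ M := hM w (by rw [Metric.mem_closedBall, dist_zero_right]; exact hKr w hwK)
      have h10 : M ≤ K1 / 2 * (‖u‖ ^ A)⁻¹ := hs2.trans (by gcongr)
      calc ‖F w‖ * ‖E w‖ ≤ Real.exp (K1 / 2 * (‖u‖ ^ A)⁻¹) * Real.exp (-(K1 / 2 * (‖u‖ ^ A)⁻¹)) := by
            gcongr
            have := Real.add_one_le_exp (K1 / 2 * (‖u‖ ^ A)⁻¹)
            linarith
        _ = 1 := by rw [← Real.exp_add]; simp
  have hmax := fun w hw => Complex.norm_le_of_forall_mem_frontier_norm_le hUb hHd hfr (z := w)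
    (subset_closure hw)
  intro w hw
  have hwr : |w.re| ≤ r / (4 * A) := (abs_re_le_norm w).trans hw
  have hwi : |w.im| ≤ r / (4 * A) := (abs_im_le_norm w).trans hw
  have hr4 : r / (4 * A) ≤ r / 4 := by
    apply div_le_div_of_nonneg_left hr.le (by norm_num); linarith
  have hAr : A * (r / (4 * A)) = r / 4 := by field_simp
  have hwU : w ∈ U := by
    refine ⟨?_, by linarith⟩
    have : A * |w.im| ≤ A * (r / (4 * A)) := by gcongr
    linarith
  have h1 := hmax w hwU
  have hwK := hUK hwU
  rw [hH] at h1; simp only at h1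
  rw [norm_mul, hEn, Real.exp_neg, ← div_eq_mul_inv, div_le_one (Real.exp_pos _)] at h1
  refine h1.trans (Real.exp_le_exp.2 ?_)
  have hinv : ∀ u : ℂ, (u = w + r ∨ u = r - w) → ((u ^ A)⁻¹).re ≤ ((r / 2) ^ A)⁻¹ := by
    intro u hu'
    have h2 := hu w hwK u hu'
    refine (re_le_norm _).trans ?_
    rw [norm_inv, norm_pow]
    have : r / 2 ≤ ‖u‖ := by
      have := re_le_norm u
      linarith [h2.1]
    gcongr
  have h2 := hinv _ (Or.inl rfl)
  have h3 := hinv _ (Or.inr rfl)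
  nlinarith

/-- Uniform bound near the real line for functions omitting `0, 1` off the real line. -/
lemma schottky_line {r : ℝ} (hr : 0 < r) {b : ℂ} (hb : ‖b‖ < r) (hbi : 0 < b.im) :
    ∃ C r' : ℝ, 0 < r' ∧ ∀ F : ℂ → ℂ, DifferentiableOn ℂ F (Metric.ball 0 r) →
      (∀ w, ‖w‖ < r → w.im ≠ 0 → F w ≠ 0 ∧ F w ≠ 1) →
      ‖F b‖ ≤ 1 / 2 → ‖F ((starRingEnd ℂ) b)‖ ≤ 1 / 2 →
      ∀ w, ‖w‖ ≤ r' → ‖F w‖ ≤ C := by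
  set Ω : Set ℂ := Metric.ball 0 r ∩ {w | 0 < w.im} with hΩ
  have hc : Convex ℝ Ω := (convex_ball _ _).inter (convex_halfSpace_im_gt 0)
  have ho : IsOpen Ω := Metric.isOpen_ball.inter (isOpen_lt continuous_const continuous_im)
  have hbΩ : b ∈ Ω := ⟨by rwa [Metric.mem_ball, dist_zero_right], hbi⟩
  obtain ⟨A, K, d0, hA, hK, hd0, hmain⟩ := schottky_bound hc ho hbΩ (D := 2 * r) (by
    intro z hz
    have h1 := Metric.mem_ball.1 hz.1
    rw [dist_zero_right] at h1
    have := dist_le_norm_add_norm b z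
    linarith)
  set r1 := min (r / 2) d0 with hr1
  have hr1p : 0 < r1 := by positivity
  have hr1r : r1 ≤ r / 2 := min_le_left _ _
  have hr1d : r1 ≤ d0 := min_le_right _ _
  obtain ⟨C, r', hr', hC⟩ := rhombus_bound hA hK hr1p
  refine ⟨C, r', hr', ?_⟩
  intro F hF hF01 hFb hFb'
  apply hC F (hF.mono (Metric.ball_subset_ball (by linarith)))
  have hballs : ∀ w : ℂ, ‖w‖ ≤ r1 → 0 < w.im → Metric.ball w w.im ⊆ Ω := by
    intro w hw hwi v hv
    rw [Metric.mem_ball, dist_eq_norm] at hv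
    have h1 := le_of_abs_le (abs_im_le_norm w)
    constructor
    · rw [Metric.mem_ball, dist_zero_right]
      have := norm_add_le (v - w) w
      rw [sub_add_cancel] at this
      linarith
    · have h2 := neg_le_of_abs_le (abs_im_le_norm (v - w))
      rw [sub_im] at h2
      show 0 < v.im
      linarith
  have hup : ∀ F : ℂ → ℂ, DifferentiableOn ℂ F (Metric.ball 0 r) →
      (∀ w, ‖w‖ < r → w.im ≠ 0 → F w ≠ 0 ∧ F w ≠ 1) → ‖F b‖ ≤ 1 / 2 →
      ∀ w : ℂ, ‖w‖ ≤ r1 → 0 < w.im → ‖F w‖ ≤ Real.exp (K / |w.im| ^ A) := by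
    intro F hF hF01 hFb w hw hwi
    have hz : ∀ z ∈ Ω, F z ≠ 0 ∧ F z ≠ 1 := fun z hz =>
      hF01 z (by have := Metric.mem_ball.1 hz.1; rwa [dist_zero_right] at this)
        (ne_of_gt hz.2)
    rw [abs_of_pos hwi]
    have h1 := le_of_abs_le (abs_im_le_norm w)
    exact hmain F (hF.mono inter_subset_left) (fun z hz' => (hz z hz').1)
      (fun z hz' => (hz z hz').2) hFb w w.im hwi (by linarith) (hballs w hw hwi)
  intro w hw hwi
  rcases lt_or_gt_of_ne hwi with h | h
  · have := hup (fun z => (starRingEnd ℂ) (F ((starRingEnd ℂ) z))) ?_ ?_ ?_ ((starRingEnd ℂ) w)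
      (by rwa [norm_conj]) (by rw [conj_im]; linarith)
    · simpa using this
    · intro z hz
      rw [Metric.mem_ball, dist_zero_right] at hz
      have h2 : DifferentiableAt ℂ F ((starRingEnd ℂ) z) :=
        hF.differentiableAt (Metric.isOpen_ball.mem_nhds (by
          rw [Metric.mem_ball, dist_zero_right, norm_conj]; exact hz))
      have h3 := h2.conj_conj
      rw [conj_conj] at h3
      exact h3.differentiableWithinAt
    · intro z hz hzi
      have := hF01 ((starRingEnd ℂ) z) (by rwa [norm_conj]) (by rw [conj_im]; simpa using hzi)
      constructor
      · intro h2
        exact this.1 (by simpa using h2)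
      · intro h2
        apply this.2
        have := congrArg (starRingEnd ℂ) h2
        simpa using this
    · simpa using hFb'
  · exact hup F hF hF01 hFb w hw h

/-- Montel's theorem along an ultrafilter. -/
lemma montel_ultra {𝒰 : Ultrafilter ℕ} {F : ℕ → ℂ → ℂ} {V : Set ℂ} (hV : IsOpen V) {C : ℝ}
    (hF : ∀ᶠ k in (𝒰 : Filter ℕ), DifferentiableOn ℂ (F k) V ∧ ∀ z ∈ V, ‖F k z‖ ≤ C) :
    ∃ g : ℂ → ℂ, DifferentiableOn ℂ g V ∧ TendstoLocallyUniformlyOn F g (𝒰 : Filter ℕ) V := by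
  have hlim : ∀ z ∈ V, ∃ x : ℂ, Tendsto (fun k => F k z) (𝒰 : Filter ℕ) (𝓝 x) := by
    intro z hz
    have h1 : ∀ᶠ k in (𝒰 : Filter ℕ), F k z ∈ Metric.closedBall (0 : ℂ) C := by
      filter_upwards [hF] with k hk
      rw [Metric.mem_closedBall, dist_zero_right]
      exact hk.2 z hz
    obtain ⟨x, -, hx⟩ := (isCompact_closedBall (0 : ℂ) C).ultrafilter_le_nhds
      (𝒰.map (fun k => F k z)) (by rw [le_principal_iff]; exact h1)
    exact ⟨x, hx⟩
  choose! g hg using hlim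
  have hloc : TendstoLocallyUniformlyOn F g (𝒰 : Filter ℕ) V := by
    rw [Metric.tendstoLocallyUniformlyOn_iff]
    intro ε hε z0 hz0
    obtain ⟨ρ, hρ, hρV⟩ := Metric.isOpen_iff.1 hV z0 hz0
    set M := 2 * |C| + 1 with hM
    have hM0 : 0 < M := by positivity
    set η := min ρ (ε / 4 * ρ / M) with hη
    have hη0 : 0 < η := by positivity
    have hηρ : η ≤ ρ := min_le_left _ _
    have hηe : η ≤ ε / 4 * ρ / M := min_le_right _ _
    refine ⟨Metric.ball z0 η, mem_nhdsWithin_of_mem_nhds (Metric.ball_mem_nhds _ hη0), ?_⟩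
    have hlip : ∀ᶠ k in (𝒰 : Filter ℕ), ∀ z ∈ Metric.ball z0 η, dist (F k z) (F k z0) ≤ ε / 4 := by
      filter_upwards [hF] with k hk z hz
      have := Complex.dist_le_div_mul_dist_of_mapsTo_ball (f := F k) (c := z0) (z := z)
        (R₁ := ρ) (R₂ := M) (hk.1.mono hρV) ?_ (Metric.ball_subset_ball hηρ hz)
      · refine this.trans ?_
        have h2 : dist z z0 ≤ ε / 4 * ρ / M := (Metric.mem_ball.1 hz).le.trans hηe
        calc M / ρ * dist z z0 ≤ M / ρ * (ε / 4 * ρ / M) := by gcongr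
          _ = ε / 4 := by field_simp
      · intro v hv
        rw [Metric.mem_closedBall]
        have h1 := hk.2 v (hρV hv)
        have h2 := hk.2 z0 hz0
        have := dist_le_norm_add_norm (F k v) (F k z0)
        have := le_abs_self C
        linarith
    have hpt : ∀ᶠ k in (𝒰 : Filter ℕ), dist (F k z0) (g z0) < ε / 4 :=
      (hg z0 hz0).eventually (Metric.ball_mem_nhds _ (by positivity))
    have hgl : ∀ z ∈ Metric.ball z0 η, dist (g z) (g z0) ≤ ε / 4 := by
      intro z hz
      have hzV : z ∈ V := hρV (Metric.ball_subset_ball hηρ hz)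
      have h1 := (hg z hzV).dist (hg z0 hz0)
      exact le_of_tendsto h1 (hlip.mono fun k hk => hk z hz)
    filter_upwards [hlip, hpt] with k hk1 hk2 z hz
    have h1 := hk1 z hz
    have h2 := hgl z hz
    calc dist (g z) (F k z) ≤ dist (g z) (g z0) + dist (g z0) (F k z0) + dist (F k z0) (F k z) :=
          dist_triangle4 _ _ _ _
      _ ≤ ε / 4 + dist (g z0) (F k z0) + ε / 4 := by
          gcongr; rw [dist_comm]; exact h1
      _ < ε := by rw [dist_comm (g z0)]; linarith
  refine ⟨g, ?_, hloc⟩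
  exact hloc.differentiableOn (hF.mono fun k hk => hk.1) hV

lemma annulus_preconnected {α β : ℝ} (hα : 0 < α) :
    IsPreconnected {z : ℂ | α < ‖z‖ ∧ ‖z‖ < β} := by
  have : {z : ℂ | α < ‖z‖ ∧ ‖z‖ < β} =
      (fun p : ℝ × ℝ => (p.1 : ℂ) * exp (p.2 * I)) '' (Ioo α β ×ˢ univ) := by
    ext z
    constructor
    · intro hz
      exact ⟨(‖z‖, arg z), ⟨hz, mem_univ _⟩, norm_mul_exp_arg_mul_I z⟩
    · rintro ⟨⟨t, θ⟩, ⟨ht, -⟩, rfl⟩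
      have : 0 < t := hα.trans ht.1
      simp only [mem_ofPred_eq, norm_mul, norm_real, norm_exp_ofReal_mul_I, mul_one,
        Real.norm_of_nonneg this.le]
      exact ht
  rw [this]
  apply IsPreconnected.image
  · exact isPreconnected_Ioo.prod isPreconnected_univ
  · fun_prop

/-- A holomorphic function on an annulus which is not identically zero is zero-free on
some circle. -/
lemma exists_zero_free_circle {α β : ℝ} (hα : 0 < α) (hαβ : α < β) {g : ℂ → ℂ}
    (hg : DifferentiableOn ℂ g {z : ℂ | α < ‖z‖ ∧ ‖z‖ < β})
    (hne : ∃ z, α < ‖z‖ ∧ ‖z‖ < β ∧ g z ≠ 0) :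
    ∃ s, α < s ∧ s < β ∧ ∀ z, ‖z‖ = s → g z ≠ 0 := by
  set A := {z : ℂ | α < ‖z‖ ∧ ‖z‖ < β} with hA
  have hAo : IsOpen A := (isOpen_lt continuous_const continuous_norm).inter
    (isOpen_lt continuous_norm continuous_const)
  have han : AnalyticOnNhd ℂ g A := hg.analyticOnNhd hAo
  obtain ⟨z1, h1, h2, hz1⟩ := hne
  set a := (2 * α + β) / 3 with ha
  set b := (α + 2 * β) / 3 with hb
  have hK : IsCompact {z : ℂ | a ≤ ‖z‖ ∧ ‖z‖ ≤ b} := by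
    apply (isCompact_closedBall (0 : ℂ) b).of_isClosed_subset
    · exact (isClosed_le continuous_const continuous_norm).inter
        (isClosed_le continuous_norm continuous_const)
    · intro z hz
      rw [Metric.mem_closedBall, dist_zero_right]; exact hz.2
  have hfin : ({z : ℂ | a ≤ ‖z‖ ∧ ‖z‖ ≤ b} ∩ {z | g z = 0}).Finite := by
    by_contra hinf
    obtain ⟨x, hx, hacc⟩ := Set.Infinite.exists_accPt_of_subset_isCompact hinf hK inter_subset_left
    have hxA : x ∈ A := ⟨by have := hx.1; simp only [ha] at this; linarith,
      by have := hx.2; simp only [hb] at this; linarith⟩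
    have hfr : ∃ᶠ z in 𝓝[≠] x, g z = 0 := by
      rw [accPt_iff_frequently_nhdsNE] at hacc
      exact hacc.mono fun z hz => hz.2
    have := han.eqOn_zero_of_preconnected_of_frequently_eq_zero (annulus_preconnected hα) hxA hfr
    exact hz1 (this ⟨h1, h2⟩)
  have hinf : (Ioo a b \ ((fun z : ℂ => ‖z‖) ''
      ({z : ℂ | a ≤ ‖z‖ ∧ ‖z‖ ≤ b} ∩ {z | g z = 0}))).Nonempty := by
    apply Set.Infinite.nonempty
    exact (Ioo_infinite (by simp only [ha, hb]; linarith)).sdiff (hfin.image _)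
  obtain ⟨s, hs, hs2⟩ := hinf
  refine ⟨s, by have := hs.1; simp only [ha] at this; linarith,
      by have := hs.2; simp only [hb] at this; linarith, ?_⟩
  intro z hz h0
  exact hs2 ⟨z, ⟨⟨by rw [hz]; exact hs.1.le, by rw [hz]; exact hs.2.le⟩, h0⟩, hz⟩

/-- The standing assumptions on `f`. -/
structure Cfg (θ₀ θ₁ θ₂ : ℝ) (f : ℂ → ℂ) (P : Set ℂ) : Prop where
  d01 : Ray θ₀ ≠ Ray θ₁
  d02 : Ray θ₀ ≠ Ray θ₂
  d12 : Ray θ₁ ≠ Ray θ₂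
  hf : MeromOn f P Set.univ
  htrans : ¬ IsRationalFn f P
  h0 : ({z : ℂ | z ∉ P ∧ f z = 0} \ Ray θ₀).Finite
  h1 : ({z : ℂ | z ∉ P ∧ f z = 1} \ Ray θ₁).Finite
  hp : (P \ Ray θ₂).Finite

lemma mem_ray_iff {θ : ℝ} {z : ℂ} : z ∈ Ray θ ↔ z ≠ 0 ∧ z = ‖z‖ * exp (θ * I) := by
  constructor
  · rintro ⟨t, ht, rfl⟩
    refine ⟨mul_ne_zero (by exact_mod_cast ht.ne') (exp_ne_zero _), ?_⟩
    simp [norm_exp_ofReal_mul_I, abs_of_pos ht]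
  · rintro ⟨h0, h⟩
    exact ⟨‖z‖, norm_pos_iff.2 h0, h⟩

lemma ray_eq_of_mem {θ θ' : ℝ} {z : ℂ} (h : z ∈ Ray θ) (h' : z ∈ Ray θ') : Ray θ = Ray θ' := by
  rw [mem_ray_iff] at h h'
  have hn : (‖z‖ : ℂ) ≠ 0 := by exact_mod_cast (norm_pos_iff.2 h.1).ne'
  have : exp (θ * I) = exp (θ' * I) := by
    apply mul_left_cancel₀ hn
    rw [← h.2, ← h'.2]
  unfold Ray
  rw [this]

lemma ray_smul {θ t : ℝ} (ht : 0 < t) {z : ℂ} (h : (t : ℂ) * z ∈ Ray θ) : z ∈ Ray θ := by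
  obtain ⟨s, hs, h⟩ := h
  refine ⟨s / t, by positivity, ?_⟩
  have : (t : ℂ) ≠ 0 := by exact_mod_cast ht.ne'
  push_cast
  rw [div_mul_eq_mul_div, eq_div_iff this, ← h]; ring

lemma ray_real {θ : ℝ} {ζ w : ℂ} (hζ : ζ ∈ Ray θ) (h : ζ * (1 + w) ∈ Ray θ) : w.im = 0 := by
  obtain ⟨s, hs, h⟩ := h
  obtain ⟨t, ht, hζ⟩ := hζ
  have htC : (t : ℂ) ≠ 0 := by exact_mod_cast ht.ne'
  have : 1 + w = ((s / t : ℝ) : ℂ) := by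
    rw [hζ] at h
    have h2 : (exp (θ * I)) * (t * (1 + w)) = exp (θ * I) * s := by linear_combination h
    have h3 := mul_left_cancel₀ (exp_ne_zero _) h2
    push_cast
    rw [eq_div_iff htC]; linear_combination h3
  have h4 := congrArg Complex.im this
  simpa using h4

lemma ray_nhds {θ : ℝ} {ζ : ℂ} (h0 : ζ ≠ 0) (h : ζ ∉ Ray θ) :
    ∃ r > 0, ∀ w : ℂ, ‖w‖ < r → ζ * (1 + w) ∉ Ray θ := by
  have hcl : IsClosed {z : ℂ | z = ‖z‖ * exp (θ * I)} :=
    isClosed_eq continuous_id (by fun_prop)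
  have hmem : ζ ∈ {z : ℂ | z = ‖z‖ * exp (θ * I)}ᶜ := fun hh => h (mem_ray_iff.2 ⟨h0, hh⟩)
  have hc : ContinuousAt (fun w : ℂ => ζ * (1 + w)) 0 := by fun_prop
  have := hc.preimage_mem_nhds (t := {z : ℂ | z = ‖z‖ * exp (θ * I)}ᶜ)
    (by simpa using hcl.isOpen_compl.mem_nhds hmem)
  obtain ⟨r, hr, hr2⟩ := Metric.mem_nhds_iff.1 this
  refine ⟨r, hr, fun w hw hh => ?_⟩
  exact hr2 (by rwa [Metric.mem_ball, dist_zero_right]) (mem_ray_iff.1 hh).2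

lemma MeromOn.notMem_nhds {f : ℂ → ℂ} {P : Set ℂ} (hf : MeromOn f P univ) (z : ℂ) :
    ∀ᶠ w in 𝓝[≠] z, w ∉ P := by
  have := hf.2.2.2 z (mem_univ _)
  rw [accPt_iff_frequently_nhdsNE, not_frequently] at this
  exact this

lemma MeromOn.isClosed {f : ℂ → ℂ} {P : Set ℂ} (hf : MeromOn f P univ) : IsClosed P := by
  rw [← isOpen_compl_iff, isOpen_iff_mem_nhds]
  intro z hz
  have := hf.notMem_nhds z
  rw [eventually_nhdsWithin_iff] at this
  filter_upwards [this] with w hw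
  by_cases h : w = z
  · rw [h]; exact hz
  · exact hw h

lemma MeromOn.analyticAt {f : ℂ → ℂ} {P : Set ℂ} (hf : MeromOn f P univ) {z : ℂ} (hz : z ∉ P) :
    AnalyticAt ℂ f z := hf.2.1 z ⟨mem_univ _, hz⟩

/-- Removing a pole by a Moebius change of variable. -/
lemma analyticAt_of_pole {f h : ℂ → ℂ} {P : Set ℂ} (hf : MeromOn f P univ) {p : ℂ} (hp : p ∈ P)
    (hd : ∀ᶠ z in 𝓝[≠] p, DifferentiableAt ℂ h z)
    (hc : ∀ᶠ z in 𝓝[≠] p, ‖h z - h p‖ ≤ 2 / ‖f z‖) : AnalyticAt ℂ h p := by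
  apply analyticAt_of_differentiable_on_punctured_nhds_of_continuousAt hd
  rw [continuousAt_iff_punctured_nhds, tendsto_iff_norm_sub_tendsto_zero]
  refine squeeze_zero' (Eventually.of_forall fun _ => norm_nonneg _) hc ?_
  exact Tendsto.div_atTop tendsto_const_nhds (hf.2.2.1 p hp)

open Classical in
/-- The function `f / (f - 1)`, extended by the value `1` at the poles. -/
def mob (f : ℂ → ℂ) (P : Set ℂ) (z : ℂ) : ℂ := if z ∈ P then 1 else f z / (f z - 1)

lemma mob_analyticAt {f : ℂ → ℂ} {P : Set ℂ} (hf : MeromOn f P univ) {z : ℂ}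
    (h1 : z ∉ P → f z ≠ 1) : AnalyticAt ℂ (mob f P) z := by
  have hoff : ∀ z ∉ P, f z ≠ 1 → AnalyticAt ℂ (mob f P) z := by
    intro z hz h1
    have : AnalyticAt ℂ (fun z => f z / (f z - 1)) z :=
      (hf.analyticAt hz).fun_div ((hf.analyticAt hz).fun_sub analyticAt_const) (sub_ne_zero.2 h1)
    refine this.congr ?_
    filter_upwards [hf.isClosed.isOpen_compl.mem_nhds hz] with w hw
    rw [mob, if_neg hw]
  by_cases hz : z ∈ P
  · have hbig : ∀ᶠ w in 𝓝[≠] z, 2 ≤ ‖f w‖ :=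
      (hf.2.2.1 z hz).eventually (eventually_ge_atTop 2)
    refine analyticAt_of_pole hf hz ?_ ?_
    · filter_upwards [hbig, hf.notMem_nhds z] with w hw hwP
      refine (hoff w hwP ?_).differentiableAt
      intro h; rw [h] at hw; norm_num at hw
    · filter_upwards [hbig, hf.notMem_nhds z] with w hw hwP
      rw [mob, mob, if_neg hwP, if_pos hz]
      have hne : f w - 1 ≠ 0 := by
        intro h; rw [sub_eq_zero] at h; rw [h] at hw; norm_num at hw
      have : f w / (f w - 1) - 1 = 1 / (f w - 1) := by field_simp; ring
      rw [this, norm_div, norm_one]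
      have h3 : ‖f w‖ / 2 ≤ ‖f w - 1‖ := by
        have := norm_sub_norm_le (f w) 1
        rw [norm_one] at this
        linarith
      calc 1 / ‖f w - 1‖ ≤ 1 / (‖f w‖ / 2) := by
            apply one_div_le_one_div_of_le _ h3
            linarith
        _ = 2 / ‖f w‖ := by field_simp
  · exact hoff z hz (h1 hz)

lemma Cfg.exceptional {θ₀ θ₁ θ₂ : ℝ} {f : ℂ → ℂ} {P : Set ℂ} (hc : Cfg θ₀ θ₁ θ₂ f P) :
    ∃ R0 > 0, ∀ z : ℂ, R0 < ‖z‖ → (z ∈ P → z ∈ Ray θ₂) ∧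
      (z ∉ P → f z = 0 → z ∈ Ray θ₀) ∧ (z ∉ P → f z = 1 → z ∈ Ray θ₁) := by
  have hfin := (hc.h0.union hc.h1).union hc.hp
  obtain ⟨R, hR⟩ := hfin.isBounded.subset_closedBall 0
  refine ⟨max R 1, by positivity, ?_⟩
  intro z hz
  have hout : z ∉ ({z : ℂ | z ∉ P ∧ f z = 0} \ Ray θ₀) ∪ ({z : ℂ | z ∉ P ∧ f z = 1} \ Ray θ₁)
      ∪ (P \ Ray θ₂) := by
    intro h
    have := hR h
    rw [Metric.mem_closedBall, dist_zero_right] at this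
    linarith [le_max_left R 1]
  refine ⟨fun h => ?_, fun h h' => ?_, fun h h' => ?_⟩
  · by_contra hh; exact hout (Or.inr ⟨h, hh⟩)
  · by_contra hh; exact hout (Or.inl (Or.inl ⟨⟨h, h'⟩, hh⟩))
  · by_contra hh; exact hout (Or.inl (Or.inr ⟨⟨h, h'⟩, hh⟩))

lemma local_picture {θ₀ θ₁ θ₂ : ℝ} {f : ℂ → ℂ} {P : Set ℂ} (hc : Cfg θ₀ θ₁ θ₂ f P)
    {ζ : ℂ} (hζ : ‖ζ‖ = 1) :
    ∃ (r R0 : ℝ) (Φ : ℂ → ℂ), 0 < r ∧ 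
      (∀ ρ : ℝ, R0 < ρ →
        DifferentiableOn ℂ (fun w => Φ (ρ * (ζ * (1 + w)))) (Metric.ball 0 r) ∧
        ∀ w : ℂ, ‖w‖ < r → w.im ≠ 0 → Φ (ρ * (ζ * (1 + w))) ≠ 0 ∧ Φ (ρ * (ζ * (1 + w))) ≠ 1) ∧
      ∀ z ∉ P, ‖f z‖ ≤ 1 / 4 → ‖Φ z‖ ≤ 2 * ‖f z‖ ∧ ‖f z‖ ≤ 2 * ‖Φ z‖ := by
  obtain ⟨R0, hR0, hex⟩ := hc.exceptional
  have hζ0 : ζ ≠ 0 := by rintro rfl; simp at hζ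
  have hray : ∀ θ : ℝ, ∃ r > 0, ∀ w : ℂ, ‖w‖ < r → ζ * (1 + w) ∈ Ray θ → ζ ∈ Ray θ ∧ w.im = 0 := by
    intro θ
    by_cases h : ζ ∈ Ray θ
    · exact ⟨1, one_pos, fun w _ hw => ⟨h, ray_real h hw⟩⟩
    · obtain ⟨r, hr, hr2⟩ := ray_nhds hζ0 h
      exact ⟨r, hr, fun w hw hh => absurd hh (hr2 w hw)⟩
  obtain ⟨r0, hr0, H0⟩ := hray θ₀
  obtain ⟨r1, hr1, H1⟩ := hray θ₁
  obtain ⟨r2, hr2, H2⟩ := hray θ₂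
  set r := min (1 / 2) (min r0 (min r1 r2)) with hr
  have hrpos : 0 < r := by positivity
  have hrh : r ≤ 1 / 2 := min_le_left _ _
  have hrr0 : r ≤ r0 := (min_le_right _ _).trans (min_le_left _ _)
  have hrr1 : r ≤ r1 := (min_le_right _ _).trans ((min_le_right _ _).trans (min_le_left _ _))
  have hrr2 : r ≤ r2 := (min_le_right _ _).trans ((min_le_right _ _).trans (min_le_right _ _))
  -- facts on the ball
  have hball : ∀ ρ : ℝ, 2 * R0 < ρ → ∀ w : ℂ, ‖w‖ < r →
      (ρ * (ζ * (1 + w)) ∈ P → ζ ∈ Ray θ₂ ∧ w.im = 0) ∧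
      (ρ * (ζ * (1 + w)) ∉ P → f (ρ * (ζ * (1 + w))) = 0 → ζ ∈ Ray θ₀ ∧ w.im = 0) ∧
      (ρ * (ζ * (1 + w)) ∉ P → f (ρ * (ζ * (1 + w))) = 1 → ζ ∈ Ray θ₁ ∧ w.im = 0) := by
    intro ρ hρ w hw
    have hρ0 : 0 < ρ := by linarith
    have hn : R0 < ‖(ρ : ℂ) * (ζ * (1 + w))‖ := by
      rw [norm_mul, norm_mul, hζ, one_mul, norm_real, Real.norm_of_nonneg hρ0.le]
      have h1 : 1 / 2 ≤ ‖1 + w‖ := by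
        have := norm_sub_norm_le 1 (-w)
        rw [norm_one, norm_neg, sub_neg_eq_add] at this
        linarith
      nlinarith
    obtain ⟨e2, e0, e1⟩ := hex _ hn
    exact ⟨fun h => H2 w (by linarith) (ray_smul hρ0 (e2 h)),
      fun h h' => H0 w (by linarith) (ray_smul hρ0 (e0 h h')),
      fun h h' => H1 w (by linarith) (ray_smul hρ0 (e1 h h'))⟩
  by_cases hpole : ζ ∈ Ray θ₂
  · have hz1 : ζ ∉ Ray θ₁ := fun h => hc.d12 (ray_eq_of_mem h hpole)
    refine ⟨r, 2 * R0, mob f P, hrpos, ?_, ?_⟩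
    · intro ρ hρ
      refine ⟨?_, ?_⟩
      · intro w hw
        rw [Metric.mem_ball, dist_zero_right] at hw
        obtain ⟨-, -, b1⟩ := hball ρ hρ w hw
        have := (mob_analyticAt hc.hf (z := ρ * (ζ * (1 + w)))
          (fun h h' => hz1 (b1 h h').1)).differentiableAt
        have h2 : DifferentiableAt ℂ (fun w => (ρ : ℂ) * (ζ * (1 + w))) w := by fun_prop
        exact (DifferentiableAt.comp w (f := fun w => (ρ : ℂ) * (ζ * (1 + w))) this
          h2).differentiableWithinAt
      · intro w hw hwi
        obtain ⟨b2, b0, b1⟩ := hball ρ hρ w hw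
        have hnP : ρ * (ζ * (1 + w)) ∉ P := fun h => hwi (b2 h).2
        have hn0 : f (ρ * (ζ * (1 + w))) ≠ 0 := fun h => hwi (b0 hnP h).2
        have hn1 : f (ρ * (ζ * (1 + w))) - 1 ≠ 0 := fun h =>
          hwi (b1 hnP (sub_eq_zero.1 h)).2
        rw [mob, if_neg hnP]
        refine ⟨div_ne_zero hn0 hn1, ?_⟩
        intro h
        rw [div_eq_one_iff_eq hn1] at h
        have : (1 : ℂ) = 0 := by linear_combination h
        exact one_ne_zero this
    · intro z hz hfz
      rw [mob, if_neg hz, norm_div]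
      have h1 : 3 / 4 ≤ ‖f z - 1‖ := by
        have := norm_sub_norm_le 1 (f z)
        rw [norm_one, norm_sub_rev] at this
        linarith
      have h2 : ‖f z - 1‖ ≤ 2 := by
        have := norm_sub_le (f z) 1
        rw [norm_one] at this
        linarith
      have h0 := norm_nonneg (f z)
      have hpos : 0 < ‖f z - 1‖ := by linarith
      constructor
      · rw [div_le_iff₀ hpos]; nlinarith
      · rw [← mul_div_assoc, le_div_iff₀ hpos]; nlinarith
  · refine ⟨r, 2 * R0, f, hrpos, ?_, ?_⟩
    · intro ρ hρ
      refine ⟨?_, ?_⟩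
      · intro w hw
        rw [Metric.mem_ball, dist_zero_right] at hw
        obtain ⟨b2, -, -⟩ := hball ρ hρ w hw
        have := (hc.hf.analyticAt (z := ρ * (ζ * (1 + w)))
          (fun h => hpole (b2 h).1)).differentiableAt
        have h2 : DifferentiableAt ℂ (fun w => (ρ : ℂ) * (ζ * (1 + w))) w := by fun_prop
        exact (DifferentiableAt.comp w (f := fun w => (ρ : ℂ) * (ζ * (1 + w))) this
          h2).differentiableWithinAt
      · intro w hw hwi
        obtain ⟨b2, b0, b1⟩ := hball ρ hρ w hw
        have hnP : ρ * (ζ * (1 + w)) ∉ P := fun h => hwi (b2 h).2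
        exact ⟨fun h => hwi (b0 hnP h).2, fun h => hwi (b1 hnP h).2⟩
    · intro z _ _
      have := norm_nonneg (f z)
      constructor <;> linarith

lemma scale_circle {θ₀ θ₁ θ₂ : ℝ} {f : ℂ → ℂ} {P : Set ℂ} (hc : Cfg θ₀ θ₁ θ₂ f P)
    {𝒰 : Ultrafilter ℕ} {ρ : ℕ → ℝ} (hρ : Tendsto ρ (𝒰 : Filter ℕ) atTop) {α β : ℝ}
    (hα : 0 < α) (hαβ : α < β)
    (hbase : ∀ r > 0, ∃ b : ℂ, ‖b‖ < r ∧ 0 < b.im ∧ α < ‖1 + b‖ ∧ ‖1 + b‖ < β)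
    (hA : ∀ᶠ k in (𝒰 : Filter ℕ), ∀ z : ℂ, α * ρ k < ‖z‖ → ‖z‖ < β * ρ k → z ∉ P ∧ ‖f z‖ < 1 / 4)
    {zs : ℕ → ℂ}
    (hzs : ∀ᶠ k in (𝒰 : Filter ℕ), ‖zs k‖ = ρ k ∧ zs k ∉ P ∧ ‖f (zs k)‖ = 1 / 4) :
    ∃ s, α < s ∧ s < β ∧ ∃ δ > 0, ∀ᶠ k in (𝒰 : Filter ℕ), ∀ z : ℂ, ‖z‖ = s * ρ k → δ ≤ ‖f z‖ := by
  set A : Set ℂ := {z : ℂ | α < ‖z‖ ∧ ‖z‖ < β} with hAdef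
  have hAo : IsOpen A := (isOpen_lt continuous_const continuous_norm).inter
    (isOpen_lt continuous_norm continuous_const)
  have hρpos : ∀ᶠ k in (𝒰 : Filter ℕ), 0 < ρ k := hρ.eventually (eventually_gt_atTop 0)
  have hscale : ∀ {k : ℕ}, 0 < ρ k → ∀ z : ℂ, ‖(ρ k : ℂ) * z‖ = ρ k * ‖z‖ := by
    intro k hk z
    rw [norm_mul, norm_real, Real.norm_of_nonneg hk.le]
  have hAk : ∀ᶠ k in (𝒰 : Filter ℕ), ∀ z ∈ A, (ρ k : ℂ) * z ∉ P ∧ ‖f (ρ k * z)‖ < 1 / 4 := by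
    filter_upwards [hA, hρpos] with k hk hk0 z hz
    apply hk
    · rw [hscale hk0, mul_comm]; have := hz.1; gcongr
    · rw [hscale hk0, mul_comm]; have := hz.2; gcongr
  obtain ⟨g, hgd, hgl⟩ := montel_ultra (𝒰 := 𝒰) (F := fun k z => f (ρ k * z)) hAo (C := 1 / 4) (by
    filter_upwards [hAk] with k hk
    refine ⟨fun z hz => ?_, fun z hz => (hk z hz).2.le⟩
    have h1 := (hc.hf.analyticAt (hk z hz).1).differentiableAt
    have h2 : DifferentiableAt ℂ (fun z => (ρ k : ℂ) * z) z := by fun_prop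
    exact (DifferentiableAt.comp z (f := fun z => (ρ k : ℂ) * z) h1 h2).differentiableWithinAt)
  by_cases hne : ∃ z, α < ‖z‖ ∧ ‖z‖ < β ∧ g z ≠ 0
  · obtain ⟨s, hs1, hs2, hs⟩ := exists_zero_free_circle hα hαβ hgd hne
    have hs0 : 0 < s := hα.trans hs1
    have hsub : Metric.sphere (0 : ℂ) s ⊆ A := by
      intro z hz
      rw [mem_sphere_zero_iff_norm] at hz
      exact ⟨by rw [hz]; exact hs1, by rw [hz]; exact hs2⟩
    have hcomp := isCompact_sphere (0 : ℂ) s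
    have hcont : ContinuousOn (fun z => ‖g z‖) (Metric.sphere 0 s) :=
      (hgd.continuousOn.mono hsub).norm
    obtain ⟨z1, hz1, hmin⟩ := hcomp.exists_isMinOn
      (NormedSpace.sphere_nonempty.2 hs0.le) hcont
    have hδ : 0 < ‖g z1‖ := norm_pos_iff.2 (hs z1 (by rwa [mem_sphere_zero_iff_norm] at hz1))
    refine ⟨s, hs1, hs2, ‖g z1‖ / 2, by positivity, ?_⟩
    have hunif := (tendstoLocallyUniformlyOn_iff_tendstoUniformlyOn_of_compact hcomp).1
      (hgl.mono hsub)
    have hu := (Metric.tendstoUniformlyOn_iff.1 hunif) (‖g z1‖ / 2) (by positivity)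
    filter_upwards [hu, hρpos] with k hk hk0 z hz
    have hkC : (ρ k : ℂ) ≠ 0 := by exact_mod_cast hk0.ne'
    have hz' : z / ρ k ∈ Metric.sphere (0 : ℂ) s := by
      rw [mem_sphere_zero_iff_norm, norm_div, norm_real, Real.norm_of_nonneg hk0.le, hz]
      field_simp
    have h1 := hk _ hz'
    rw [mul_div_cancel₀ _ hkC, dist_eq_norm] at h1
    have h2 : ‖g z1‖ ≤ ‖g (z / ρ k)‖ := hmin hz'
    have h3 := norm_sub_norm_le (g (z / ρ k)) (f z)
    linarith
  · exfalso
    push Not at hne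
    have hg0 : ∀ z ∈ A, g z = 0 := fun z hz => hne z hz.1 hz.2
    -- limit direction
    have h1 : ∀ᶠ k in (𝒰 : Filter ℕ), zs k / ρ k ∈ Metric.sphere (0 : ℂ) 1 := by
      filter_upwards [hzs, hρpos] with k hk hk0
      rw [mem_sphere_zero_iff_norm, norm_div, norm_real, Real.norm_of_nonneg hk0.le, hk.1,
        div_self hk0.ne']
    obtain ⟨ζ, hζ, hlim⟩ := (isCompact_sphere (0 : ℂ) 1).ultrafilter_le_nhds
      (𝒰.map (fun k => zs k / ρ k)) (by rw [le_principal_iff]; exact h1)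
    have hlim' : Tendsto (fun k => zs k / ρ k) (𝒰 : Filter ℕ) (𝓝 ζ) := hlim
    rw [mem_sphere_zero_iff_norm] at hζ
    have hζ0 : ζ ≠ 0 := by rintro rfl; simp at hζ
    obtain ⟨r, R0, Φ, hr, hΦ, hΦf⟩ := local_picture hc hζ
    obtain ⟨b, hbr, hbi, hb1, hb2⟩ := hbase r hr
    obtain ⟨C, r', hr', hC⟩ := schottky_line hr hbr hbi
    set H : ℕ → ℂ → ℂ := fun k w => Φ (ρ k * (ζ * (1 + w))) with hH
    have hAw : ∀ w : ℂ, α < ‖1 + w‖ → ‖1 + w‖ < β → ζ * (1 + w) ∈ A := by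
      intro w h1 h2
      simp only [hAdef, mem_ofPred_eq, norm_mul, hζ, one_mul]
      exact ⟨h1, h2⟩
    have hconjb : ‖1 + (starRingEnd ℂ) b‖ = ‖1 + b‖ := by
      rw [← norm_conj (1 + b), map_add, map_one]
    have hbd : ∀ᶠ k in (𝒰 : Filter ℕ), ∀ w : ℂ, ‖w‖ ≤ r' → ‖H k w‖ ≤ C := by
      filter_upwards [hAk, hρ.eventually (eventually_gt_atTop R0)] with k hk hkR
      obtain ⟨hd, hom⟩ := hΦ (ρ k) hkR
      have hpt : ∀ w : ℂ, α < ‖1 + w‖ → ‖1 + w‖ < β → ‖H k w‖ ≤ 1 / 2 := by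
        intro w h1 h2
        obtain ⟨h3, h4⟩ := hk _ (hAw w h1 h2)
        have := (hΦf _ h3 h4.le).1
        simp only [hH]; linarith
      exact hC _ hd hom (hpt b hb1 hb2) (hpt _ (by rwa [hconjb]) (by rwa [hconjb]))
    set r1 := min r r' with hr1
    have hr1pos : 0 < r1 := by positivity
    obtain ⟨h, hhd, hhl⟩ := montel_ultra (𝒰 := 𝒰) (F := H) (V := Metric.ball 0 r1)
      Metric.isOpen_ball (C := C) (by
        filter_upwards [hbd, hρ.eventually (eventually_gt_atTop R0)] with k hk hkR
        refine ⟨(hΦ (ρ k) hkR).1.mono (Metric.ball_subset_ball (min_le_left _ _)), ?_⟩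
        intro w hw
        rw [Metric.mem_ball, dist_zero_right] at hw
        exact hk w (hw.le.trans (min_le_right _ _)))
    -- h vanishes near a base point
    obtain ⟨b', hb'r, -, hb'1, hb'2⟩ := hbase r1 hr1pos
    have hb'ball : b' ∈ Metric.ball (0 : ℂ) r1 := by rwa [Metric.mem_ball, dist_zero_right]
    have hev : ∀ᶠ w in 𝓝 b', h w = 0 := by
      have hcn : Continuous (fun w : ℂ => ‖1 + w‖) := by fun_prop
      have hopen : IsOpen {w : ℂ | α < ‖1 + w‖ ∧ ‖1 + w‖ < β} :=
        (isOpen_lt continuous_const hcn).inter (isOpen_lt hcn continuous_const)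
      filter_upwards [hopen.mem_nhds ⟨hb'1, hb'2⟩, Metric.isOpen_ball.mem_nhds hb'ball] with w hw hwb
      have t1 : Tendsto (fun k => H k w) (𝒰 : Filter ℕ) (𝓝 (h w)) := hhl.tendsto_at hwb
      have hwA := hAw w hw.1 hw.2
      have t2 : Tendsto (fun k => f (ρ k * (ζ * (1 + w)))) (𝒰 : Filter ℕ) (𝓝 0) := by
        have := hgl.tendsto_at hwA
        rwa [hg0 _ hwA] at this
      have t3 : Tendsto (fun k => H k w) (𝒰 : Filter ℕ) (𝓝 0) := by
        have t4 : Tendsto (fun k => 2 * ‖f (ρ k * (ζ * (1 + w)))‖) (𝒰 : Filter ℕ) (𝓝 0) := by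
          have := (t2.norm).const_mul 2
          simpa using this
        refine squeeze_zero_norm' ?_ t4
        filter_upwards [hAk] with k hk
        obtain ⟨h3, h4⟩ := hk _ hwA
        exact (hΦf _ h3 h4.le).1
      exact tendsto_nhds_unique t1 t3
    have hh0 : EqOn h 0 (Metric.ball 0 r1) :=
      (hhd.analyticOnNhd Metric.isOpen_ball).eqOn_zero_of_preconnected_of_eventuallyEq_zero
        (convex_ball _ _).isPreconnected hb'ball hev
    -- contradiction at the points zs
    obtain ⟨t, ht, htu⟩ := (Metric.tendstoLocallyUniformlyOn_iff.1 hhl) (1 / 8) (by norm_num) 0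
      (Metric.mem_ball_self hr1pos)
    rw [nhdsWithin_eq_nhds.2 (Metric.ball_mem_nhds _ hr1pos)] at ht
    have hw : Tendsto (fun k => zs k / ρ k / ζ - 1) (𝒰 : Filter ℕ) (𝓝 0) := by
      have := (hlim'.div_const ζ).sub_const 1
      rwa [div_self hζ0, sub_self] at this
    have hfinal : ∀ᶠ k in (𝒰 : Filter ℕ), False := by
      filter_upwards [htu, hw.eventually ht, hw.eventually (Metric.ball_mem_nhds _ hr1pos), hzs,
        hρpos] with k hk1 hk2 hk3 hk4 hk0
      have hkC : (ρ k : ℂ) ≠ 0 := by exact_mod_cast hk0.ne'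
      have h5 := hk1 _ hk2
      have h6 : h (zs k / ρ k / ζ - 1) = 0 := hh0 hk3
      rw [h6, dist_zero_left] at h5
      have h7 : (ρ k : ℂ) * (ζ * (1 + (zs k / ρ k / ζ - 1))) = zs k := by field_simp; ring
      simp only [hH] at h5
      rw [h7] at h5
      have h8 := (hΦf _ hk4.2.1 hk4.2.2.le).2
      rw [hk4.2.2] at h8
      linarith
    rw [eventually_false_iff_eq_bot] at hfinal
    exact 𝒰.neBot.ne hfinal

lemma base_lt : ∀ r > 0, ∃ b : ℂ, ‖b‖ < r ∧ 0 < b.im ∧ 1 / 2 < ‖1 + b‖ ∧ ‖1 + b‖ < 1 := by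
  intro r hr
  set t := min (r / 4) (1 / 8) with ht
  have ht0 : 0 < t := by positivity
  have ht1 : t ≤ r / 4 := min_le_left _ _
  have ht2 : t ≤ 1 / 8 := min_le_right _ _
  have hn : ‖1 + (⟨-t, t⟩ : ℂ)‖ ^ 2 = (1 - t) ^ 2 + t ^ 2 := by
    rw [Complex.sq_norm, normSq_apply]; simp; ring
  have h0 := norm_nonneg (1 + (⟨-t, t⟩ : ℂ))
  refine ⟨⟨-t, t⟩, ?_, ht0, ?_, ?_⟩
  · refine (norm_le_abs_re_add_abs_im _).trans_lt ?_
    simp only [abs_neg, abs_of_pos ht0]; linarith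
  · by_contra hcon; push Not at hcon
    nlinarith
  · by_contra hcon; push Not at hcon
    nlinarith

lemma base_gt : ∀ r > 0, ∃ b : ℂ, ‖b‖ < r ∧ 0 < b.im ∧ 1 < ‖1 + b‖ ∧ ‖1 + b‖ < 2 := by
  intro r hr
  set t := min (r / 4) (1 / 8) with ht
  have ht0 : 0 < t := by positivity
  have ht1 : t ≤ r / 4 := min_le_left _ _
  have ht2 : t ≤ 1 / 8 := min_le_right _ _
  have hn : ‖1 + (⟨t, t⟩ : ℂ)‖ ^ 2 = (1 + t) ^ 2 + t ^ 2 := by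
    rw [Complex.sq_norm, normSq_apply]; simp; ring
  have h0 := norm_nonneg (1 + (⟨t, t⟩ : ℂ))
  refine ⟨⟨t, t⟩, ?_, ht0, ?_, ?_⟩
  · refine (norm_le_abs_re_add_abs_im _).trans_lt ?_
    simp only [abs_of_pos ht0]; linarith
  · by_contra hcon; push Not at hcon
    nlinarith
  · by_contra hcon; push Not at hcon
    nlinarith

open Classical in
/-- The function `1 / f`, extended by zero at the poles. -/
def recip (f : ℂ → ℂ) (P : Set ℂ) (z : ℂ) : ℂ := if z ∈ P then 0 else 1 / f z

lemma recip_analyticAt {f : ℂ → ℂ} {P : Set ℂ} (hf : MeromOn f P univ) {z : ℂ}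
    (h0 : z ∉ P → f z ≠ 0) : AnalyticAt ℂ (recip f P) z := by
  have hoff : ∀ z ∉ P, f z ≠ 0 → AnalyticAt ℂ (recip f P) z := by
    intro z hz h1
    have : AnalyticAt ℂ (fun z => 1 / f z) z :=
      analyticAt_const.fun_div (hf.analyticAt hz) h1
    refine this.congr ?_
    filter_upwards [hf.isClosed.isOpen_compl.mem_nhds hz] with w hw
    rw [recip, if_neg hw]
  by_cases hz : z ∈ P
  · have hbig : ∀ᶠ w in 𝓝[≠] z, 2 ≤ ‖f w‖ :=
      (hf.2.2.1 z hz).eventually (eventually_ge_atTop 2)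
    refine analyticAt_of_pole hf hz ?_ ?_
    · filter_upwards [hbig, hf.notMem_nhds z] with w hw hwP
      refine (hoff w hwP ?_).differentiableAt
      intro h; rw [h] at hw; norm_num at hw
    · filter_upwards [hbig, hf.notMem_nhds z] with w hw hwP
      rw [recip, recip, if_neg hwP, if_pos hz, sub_zero, norm_div, norm_one]
      gcongr; norm_num
  · exact hoff z hz (h0 hz)

lemma recip_congr {f : ℂ → ℂ} {P : Set ℂ} (hf : MeromOn f P univ) (z : ℂ) :
    f =ᶠ[𝓝[≠] z] (recip f P)⁻¹ := by
  filter_upwards [hf.notMem_nhds z] with w hw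
  rw [Pi.inv_apply, recip, if_neg hw]; simp

lemma MeromOn.meromorphicAt {f : ℂ → ℂ} {P : Set ℂ} (hf : MeromOn f P univ) (z : ℂ) :
    MeromorphicAt f z := by
  by_cases hz : z ∈ P
  · exact ((recip_analyticAt hf (fun h => absurd hz h)).meromorphicAt.inv).congr
      (recip_congr hf z).symm
  · exact (hf.analyticAt hz).meromorphicAt

lemma MeromOn.meromorphicAt_sub {f : ℂ → ℂ} {P : Set ℂ} (hf : MeromOn f P univ) (a z : ℂ) :
    MeromorphicAt (fun w => f w - a) z :=
  (hf.meromorphicAt z).fun_sub (MeromorphicAt.const a z)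

lemma MeromOn.ne_top {f : ℂ → ℂ} {P : Set ℂ} (hf : MeromOn f P univ) (ht : ¬ IsRationalFn f P)
    (a z : ℂ) : meromorphicOrderAt (fun w => f w - a) z ≠ ⊤ := by
  by_contra htop
  apply ht
  have hmer : MeromorphicOn (fun w => f w - a) univ := fun w _ => hf.meromorphicAt_sub a w
  have hall : ∀ w, meromorphicOrderAt (fun w => f w - a) w = ⊤ := by
    by_contra hex
    push Not at hex
    obtain ⟨w, hw⟩ := hex
    have := (hmer.exists_meromorphicOrderAt_ne_top_iff_forall
      (isConnected_univ)).1 ⟨⟨w, mem_univ _⟩, hw⟩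
    exact this ⟨z, mem_univ _⟩ htop
  refine ⟨Polynomial.C a, 1, one_ne_zero, fun w hw _ => ?_⟩
  have h1 := meromorphicOrderAt_eq_top_iff.1 (hall w)
  have hc : ContinuousAt (fun w => f w - a) w :=
    ((hf.analyticAt hw).fun_sub analyticAt_const).continuousAt
  have h2 : f w - a = 0 := by
    have h3 : Tendsto (fun w => f w - a) (𝓝[≠] w) (𝓝 (f w - a)) := hc.tendsto.mono_left inf_le_left
    have h4 : Tendsto (fun w => f w - a) (𝓝[≠] w) (𝓝 0) :=
      (tendsto_congr' h1).2 tendsto_const_nhds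
    exact tendsto_nhds_unique h3 h4
  simp [sub_eq_zero.1 h2]

lemma vOrder_eq {g : ℂ → ℂ} {z : ℂ} (hg : AnalyticAt ℂ g z) (hne : meromorphicOrderAt g z ≠ ⊤) :
    (vOrder g z : ℤ) = (meromorphicOrderAt g z).untop₀ := by
  have h1 : analyticOrderAt g z ≠ ⊤ := by
    intro h; rw [hg.meromorphicOrderAt_eq, h] at hne; exact hne rfl
  obtain ⟨n, hn⟩ := ENat.ne_top_iff_exists.1 h1
  rw [hg.meromorphicOrderAt_eq, ← hn]
  have hS : {m : ℕ | ∃ h : ℂ → ℂ, AnalyticAt ℂ h z ∧ h z ≠ 0 ∧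
    ∀ᶠ w in 𝓝 z, g w = (w - z) ^ m * h w} = {n} := by
    ext m
    simp only [mem_ofPred_eq, mem_singleton_iff]
    have := hg.analyticOrderAt_eq_natCast (n := m)
    simp only [smul_eq_mul] at this
    rw [← this, ← hn]
    constructor
    · intro h; exact_mod_cast h.symm
    · rintro rfl; rfl
  rw [vOrder, hS, csInf_singleton]
  simp

lemma poleOrder_eq {f : ℂ → ℂ} {P : Set ℂ} (hf : MeromOn f P univ) {p : ℂ} (hp : p ∈ P) :
    meromorphicOrderAt f p < 0 ∧ (poleOrder f p : ℤ) = -(meromorphicOrderAt f p).untop₀ := by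
  have hneg : meromorphicOrderAt f p < 0 := by
    rw [← tendsto_cobounded_iff_meromorphicOrderAt_neg (hf.meromorphicAt p),
      ← tendsto_norm_atTop_iff_cobounded]
    exact hf.2.2.1 p hp
  refine ⟨hneg, ?_⟩
  obtain ⟨n, hn⟩ := WithTop.ne_top_iff_exists.1 hneg.ne_top
  have hn0 : n < 0 := by rw [← hn] at hneg; exact_mod_cast hneg
  obtain ⟨m, hm⟩ := Int.eq_ofNat_of_zero_le (a := -n) (by omega)
  have hS : {m : ℕ | ∃ h : ℂ → ℂ, AnalyticAt ℂ h p ∧ h p ≠ 0 ∧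
    ∀ᶠ w in 𝓝[≠] p, f w = h w / (w - p) ^ m} = {m} := by
    ext m'
    simp only [mem_ofPred_eq, mem_singleton_iff]
    have := meromorphicOrderAt_eq_int_iff (hf.meromorphicAt p) (n := -(m' : ℤ))
    simp only [smul_eq_mul, zpow_neg, zpow_natCast] at this
    have h2 : (∃ h : ℂ → ℂ, AnalyticAt ℂ h p ∧ h p ≠ 0 ∧
      ∀ᶠ w in 𝓝[≠] p, f w = h w / (w - p) ^ m') ↔ meromorphicOrderAt f p = ((-(m' : ℤ) : ℤ) : WithTop ℤ) := by
      rw [this]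
      simp only [div_eq_inv_mul]
    rw [h2, ← hn]
    constructor
    · intro h
      have : n = -(m' : ℤ) := by exact_mod_cast h
      omega
    · rintro rfl
      have : n = -(m' : ℤ) := by omega
      rw [this]
  rw [poleOrder, hS, csInf_singleton, ← hn]
  simp [hm]

lemma finite_of_bounded_isolated {S : Set ℂ} (t : ℝ) (h : ∀ z, ∀ᶠ w in 𝓝[≠] z, w ∉ S) :
    {z : ℂ | ‖z‖ ≤ t ∧ z ∈ S}.Finite := by
  by_contra hinf
  obtain ⟨x, -, hx⟩ := Set.Infinite.exists_accPt_of_subset_isCompact hinf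
    (isCompact_closedBall (0 : ℂ) t) (fun z hz => by simpa using hz.1)
  rw [accPt_iff_frequently_nhdsNE] at hx
  exact hx ((h x).mono fun w hw hw2 => hw hw2.2)

lemma MeromOn.finite_poles {f : ℂ → ℂ} {P : Set ℂ} (hf : MeromOn f P univ) (t : ℝ) :
    {z : ℂ | ‖z‖ ≤ t ∧ z ∈ P}.Finite := finite_of_bounded_isolated t hf.notMem_nhds

lemma MeromOn.finite_value {f : ℂ → ℂ} {P : Set ℂ} (hf : MeromOn f P univ)
    (ht : ¬ IsRationalFn f P) (a : ℂ) (t : ℝ) :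
    {z : ℂ | ‖z‖ ≤ t ∧ z ∉ P ∧ f z = a}.Finite := by
  refine finite_of_bounded_isolated (S := {z | z ∉ P ∧ f z = a}) t fun z => ?_
  have h1 := hf.ne_top ht a z
  have h2 : ∀ᶠ w in 𝓝[≠] z, f w - a ≠ 0 :=
    (meromorphicOrderAt_ne_top_iff_eventually_ne_zero (hf.meromorphicAt_sub a z)).1 h1
  filter_upwards [h2] with w hw h3
  exact hw (sub_eq_zero.2 h3.2)

open Classical in
/-- Multiplicity of `z` as an `a`-point. -/
def wtV (f : ℂ → ℂ) (P : Set ℂ) (a z : ℂ) : ℝ :=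
  if z ∉ P ∧ f z = a then (vOrder (fun w => f w - a) z : ℝ) else 0

open Classical in
/-- Multiplicity of `z` as a pole. -/
def wtP (f : ℂ → ℂ) (P : Set ℂ) (z : ℂ) : ℝ := if z ∈ P then (poleOrder f z : ℝ) else 0

/-- Total weight. -/
def wt (f : ℂ → ℂ) (P : Set ℂ) (z : ℂ) : ℝ := wtV f P 0 z + wtV f P 1 z + wtP f P z

lemma wtV_nonneg (f : ℂ → ℂ) (P : Set ℂ) (a z : ℂ) : 0 ≤ wtV f P a z := by
  unfold wtV; split_ifs <;> positivity

lemma wtP_nonneg (f : ℂ → ℂ) (P : Set ℂ) (z : ℂ) : 0 ≤ wtP f P z := by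
  unfold wtP; split_ifs <;> positivity

lemma wt_nonneg (f : ℂ → ℂ) (P : Set ℂ) (z : ℂ) : 0 ≤ wt f P z :=
  add_nonneg (add_nonneg (wtV_nonneg ..) (wtV_nonneg ..)) (wtP_nonneg ..)

/-- Locally finite weights. -/
def LocFin (w : ℂ → ℝ) : Prop := ∀ t : ℝ, {z : ℂ | ‖z‖ ≤ t ∧ w z ≠ 0}.Finite

lemma LocFin.add {v w : ℂ → ℝ} (hv : LocFin v) (hw : LocFin w) : LocFin (fun z => v z + w z) := by
  intro t
  refine ((hv t).union (hw t)).subset ?_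
  rintro z ⟨h1, h2⟩
  by_cases h : v z = 0
  · right; exact ⟨h1, by simpa [h] using h2⟩
  · left; exact ⟨h1, h⟩

lemma LocFin.neg {v : ℂ → ℝ} (hv : LocFin v) : LocFin (fun z => - v z) := by
  intro t; simpa using hv t

lemma locFin_wtV {f : ℂ → ℂ} {P : Set ℂ} (hf : MeromOn f P univ)
    (ht : ¬ IsRationalFn f P) (a : ℂ) : LocFin (wtV f P a) := by
  intro t
  refine (hf.finite_value ht a t).subset ?_
  rintro z ⟨h1, h2⟩
  refine ⟨h1, ?_⟩
  by_contra h; exact h2 (by rw [wtV, if_neg h])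

lemma locFin_wtP {f : ℂ → ℂ} {P : Set ℂ} (hf : MeromOn f P univ) : LocFin (wtP f P) := by
  intro t
  refine (hf.finite_poles t).subset ?_
  rintro z ⟨h1, h2⟩
  refine ⟨h1, ?_⟩
  by_contra h; exact h2 (by rw [wtP, if_neg h])

lemma locFin_wt {f : ℂ → ℂ} {P : Set ℂ} (hf : MeromOn f P univ)
    (ht : ¬ IsRationalFn f P) : LocFin (wt f P) :=
  ((locFin_wtV hf ht 0).add (locFin_wtV hf ht 1)).add (locFin_wtP hf)

/-- Counting function of a weight on a set. -/
def cnt (w : ℂ → ℝ) (S : Set ℂ) : ℝ := ∑ᶠ z ∈ S, w z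

lemma LocFin.fin {w : ℂ → ℝ} (hw : LocFin w) {S : Set ℂ} {t : ℝ} (hS : ∀ z ∈ S, ‖z‖ ≤ t) :
    (S ∩ Function.support w).Finite :=
  (hw t).subset fun z hz => ⟨hS z hz.1, hz.2⟩

lemma cnt_nonneg {w : ℂ → ℝ} (h0 : ∀ z, 0 ≤ w z) (S : Set ℂ) : 0 ≤ cnt w S :=
  finsum_nonneg fun z => finsum_nonneg fun _ => h0 z

lemma LocFin.cnt_diff {w : ℂ → ℝ} (hw : LocFin w) {S T : Set ℂ} {t : ℝ} (hT : ∀ z ∈ T, ‖z‖ ≤ t)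
    (hST : S ⊆ T) : cnt w T = cnt w S + cnt w (T \ S) := by
  unfold cnt
  rw [← finsum_mem_union' disjoint_sdiff_right (hw.fin fun z hz => hT z (hST hz))
    (hw.fin fun z hz => hT z hz.1), union_sdiff_cancel hST]

lemma LocFin.cnt_mono {w : ℂ → ℝ} (hw : LocFin w) (h0 : ∀ z, 0 ≤ w z) {S T : Set ℂ} {t : ℝ}
    (hT : ∀ z ∈ T, ‖z‖ ≤ t) (hST : S ⊆ T) : cnt w S ≤ cnt w T := by
  rw [hw.cnt_diff hT hST]
  linarith [cnt_nonneg h0 (T \ S)]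

lemma LocFin.cnt_add {v w : ℂ → ℝ} (hv : LocFin v) (hw : LocFin w) {S : Set ℂ} {t : ℝ}
    (hS : ∀ z ∈ S, ‖z‖ ≤ t) : cnt (fun z => v z + w z) S = cnt v S + cnt w S :=
  finsum_mem_add_distrib' (hv.fin hS) (hw.fin hS)

lemma cnt_congr {v w : ℂ → ℝ} {S : Set ℂ} (h : ∀ z ∈ S, v z = w z) : cnt v S = cnt w S :=
  finsum_mem_congr rfl h

lemma cnt_zero {w : ℂ → ℝ} {S : Set ℂ} (h : ∀ z ∈ S, w z = 0) : cnt w S = 0 := by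
  rw [cnt, finsum_mem_eq_zero_of_forall_eq_zero h]

lemma LocFin.cnt_union_le {w : ℂ → ℝ} (hw : LocFin w) (h0 : ∀ z, 0 ≤ w z) {S T : Set ℂ} {t : ℝ}
    (hS : ∀ z ∈ S, ‖z‖ ≤ t) (hT : ∀ z ∈ T, ‖z‖ ≤ t) : cnt w (S ∪ T) ≤ cnt w S + cnt w T := by
  have h1 := hw.cnt_diff (S := S) (T := S ∪ T) (t := t)
    (fun z hz => hz.elim (hS z) (hT z)) subset_union_left
  have h2 : cnt w ((S ∪ T) \ S) ≤ cnt w T := by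
    refine hw.cnt_mono h0 hT ?_
    rintro z ⟨h | h, h'⟩
    · exact absurd h h'
    · exact h
  linarith

lemma nValue_eq (f : ℂ → ℂ) (P : Set ℂ) (a : ℂ) (t : ℝ) :
    nValue f P a t = cnt (wtV f P a) {z | ‖z‖ ≤ t} := by
  unfold nValue cnt
  rw [finsum_mem_def, finsum_mem_def]
  congr 1; ext z
  simp only [indicator, mem_ofPred_eq, wtV]
  by_cases h1 : ‖z‖ ≤ t <;> by_cases h2 : z ∉ P ∧ f z = a <;> simp [h1, h2]

lemma nPoles_eq (f : ℂ → ℂ) (P : Set ℂ) (t : ℝ) :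
    nPoles f P t = cnt (wtP f P) {z | ‖z‖ ≤ t} := by
  unfold nPoles cnt
  rw [finsum_mem_def, finsum_mem_def]
  congr 1; ext z
  simp only [indicator, mem_ofPred_eq, wtP]
  by_cases h1 : ‖z‖ ≤ t <;> by_cases h2 : z ∈ P <;> simp [h1, h2]

lemma nTotal_eq {f : ℂ → ℂ} {P : Set ℂ} (hf : MeromOn f P univ)
    (ht : ¬ IsRationalFn f P) (t : ℝ) :
    nTotal f P t = cnt (wt f P) {z | ‖z‖ ≤ t} := by
  unfold nTotal wt
  rw [nValue_eq, nValue_eq, nPoles_eq,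
    ((locFin_wtV hf ht 0).add (locFin_wtV hf ht 1)).cnt_add (locFin_wtP hf) (S := {z | ‖z‖ ≤ t}) (t := t)
      (fun z hz => hz),
    (locFin_wtV hf ht 0).cnt_add (locFin_wtV hf ht 1) (S := {z | ‖z‖ ≤ t}) (t := t)
      (fun z hz => hz)]

/-- The order of `f` as a real number. -/
def ordR (f : ℂ → ℂ) (z : ℂ) : ℝ := ((meromorphicOrderAt f z).untop₀ : ℝ)

lemma wtV_eq {f : ℂ → ℂ} {P : Set ℂ} (hf : MeromOn f P univ)
    (ht : ¬ IsRationalFn f P) (a : ℂ) {z : ℂ} (hz : z ∉ P) :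
    wtV f P a z = ordR (fun w => f w - a) z := by
  have han : AnalyticAt ℂ (fun w => f w - a) z := (hf.analyticAt hz).fun_sub analyticAt_const
  unfold wtV ordR
  split_ifs with h
  · rw [← vOrder_eq han (hf.ne_top ht a z)]; simp
  · have : f z - a ≠ 0 := fun h' => h ⟨hz, sub_eq_zero.1 h'⟩
    rw [han.meromorphicOrderAt_eq, han.analyticOrderAt_eq_zero.2 this]; simp

lemma ordR_eq {f : ℂ → ℂ} {P : Set ℂ} (hf : MeromOn f P univ)
    (ht : ¬ IsRationalFn f P) (z : ℂ) : ordR f z = wtV f P 0 z - wtP f P z := by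
  by_cases hz : z ∈ P
  · have := (poleOrder_eq hf hz).2
    rw [wtV, if_neg (fun h => h.1 hz), wtP, if_pos hz, ordR]
    have h2 : (poleOrder f z : ℝ) = ((poleOrder f z : ℤ) : ℝ) := by simp
    rw [h2, this]; simp
  · rw [wtV_eq hf ht 0 hz, wtP, if_neg hz]; simp

/-- The total weight takes natural values. -/
lemma nTotal_nat {f : ℂ → ℂ} {P : Set ℂ} (hf : MeromOn f P univ)
    (ht : ¬ IsRationalFn f P) (t : ℝ) : ∃ n : ℕ, nTotal f P t = n := by
  rw [nTotal_eq hf ht]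
  have hw : ∀ z, ∃ n : ℕ, wt f P z = n := by
    intro z
    have h1 : ∀ a, ∃ n : ℕ, wtV f P a z = n := by
      intro a; unfold wtV; split_ifs
      · exact ⟨_, rfl⟩
      · exact ⟨0, by simp⟩
    have h2 : ∃ n : ℕ, wtP f P z = n := by
      unfold wtP; split_ifs
      · exact ⟨_, rfl⟩
      · exact ⟨0, by simp⟩
    obtain ⟨a, ha⟩ := h1 0
    obtain ⟨b, hb⟩ := h1 1
    obtain ⟨c, hc⟩ := h2
    exact ⟨a + b + c, by rw [wt, ha, hb, hc]; push_cast; ring⟩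
  choose n hn using hw
  have hfin := (locFin_wt hf ht).fin (S := {z | ‖z‖ ≤ t}) (t := t) (fun z hz => hz)
  rw [cnt, ← finsum_mem_inter_support, finsum_mem_eq_finite_toFinset_sum _ hfin]
  exact ⟨∑ i ∈ hfin.toFinset, n i, by push_cast; exact Finset.sum_congr rfl fun i _ => hn i⟩

lemma cnt_finset {w : ℂ → ℝ} {S : Set ℂ} {T : Finset ℂ} (h1 : ∀ z ∈ T, z ∈ S)
    (h2 : ∀ z ∈ S, w z ≠ 0 → z ∈ T) : cnt w S = ∑ z ∈ T, w z := by
  unfold cnt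
  refine finsum_mem_eq_sum_of_inter_support_eq w ?_
  ext z
  simp only [mem_inter_iff, Function.mem_support, Finset.mem_coe]
  constructor
  · rintro ⟨h, h'⟩; exact ⟨h2 z h h', h'⟩
  · rintro ⟨h, h'⟩; exact ⟨h1 z h, h'⟩

lemma locFin_ordR {f : ℂ → ℂ} {P : Set ℂ} (hf : MeromOn f P univ)
    (ht : ¬ IsRationalFn f P) : LocFin (ordR f) := by
  have := (locFin_wtV hf ht 0).add (locFin_wtP hf).neg
  intro t
  refine (this t).subset ?_
  rintro z ⟨h1, h2⟩
  refine ⟨h1, ?_⟩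
  rw [ordR_eq hf ht] at h2
  simpa [← sub_eq_add_neg] using h2

lemma jensen_cnt {f : ℂ → ℂ} {P : Set ℂ} (hf : MeromOn f P univ) (ht : ¬ IsRationalFn f P) :
    ∃ C : ℝ, ∀ R > 0, Real.circleAverage (fun z => Real.log ‖f z‖) 0 R =
      cnt (fun u => ordR f u * (Real.log R - Real.log ‖u‖)) {z | ‖z‖ ≤ R} + C := by
  refine ⟨Real.log ‖meromorphicTrailingCoeffAt f 0‖, fun R hR => ?_⟩
  have hm : MeromorphicOn f (Metric.closedBall 0 |R|) := fun z _ => hf.meromorphicAt z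
  have := MeromorphicOn.circleAverage_log_norm hR.ne' hm
  rw [this]
  congr 1
  have hdiv : ∀ z : ℂ, ‖z‖ ≤ R → (MeromorphicOn.divisor f (Metric.closedBall 0 |R|) z : ℝ) = ordR f z := by
    intro z hz
    rw [MeromorphicOn.divisor_apply hm (by simpa [abs_of_pos hR] using hz), ordR]
  have hdiv2 : ∀ z : ℂ, ¬ ‖z‖ ≤ R → (MeromorphicOn.divisor f (Metric.closedBall 0 |R|) z : ℝ) = 0 := by
    intro z hz
    have : MeromorphicOn.divisor f (Metric.closedBall 0 |R|) z = 0 :=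
      Function.locallyFinsuppWithin.apply_eq_zero_of_notMem _ (by simpa [abs_of_pos hR] using hz)
    rw [this]; simp
  have hl := locFin_ordR hf ht
  have hfin := hl R
  set T := hfin.toFinset ∪ {0} with hT
  have hmem : ∀ z, z ∈ T ↔ (‖z‖ ≤ R ∧ ordR f z ≠ 0) ∨ z = 0 := by
    intro z; simp [hT, or_comm]
  have hTR : ∀ z ∈ T, ‖z‖ ≤ R := by
    intro z hz
    rcases (hmem z).1 hz with h | h
    · exact h.1
    · simp [h, hR.le]
  rw [cnt_finset (T := T)]
  · rw [finsum_eq_sum_of_support_subset (s := T)]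
    · have h0 : (0 : ℂ) ∈ T := (hmem 0).2 (Or.inr rfl)
      rw [hdiv 0 (by simpa using hR.le)]
      rw [← Finset.add_sum_erase _ _ h0, ← Finset.add_sum_erase _ _ h0]
      have : ∑ x ∈ T.erase 0, (MeromorphicOn.divisor f (Metric.closedBall 0 |R|) x : ℝ) *
          Real.log (R * ‖0 - x‖⁻¹) = ∑ x ∈ T.erase 0, ordR f x * (Real.log R - Real.log ‖x‖) := by
        refine Finset.sum_congr rfl fun x hx => ?_
        rw [Finset.mem_erase] at hx
        rw [hdiv x (hTR x hx.2), zero_sub, norm_neg, ← div_eq_mul_inv,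
          Real.log_div hR.ne' (norm_ne_zero_iff.2 hx.1)]
      rw [this]; simp; ring
    · intro z hz
      rw [Function.mem_support] at hz
      have hzR : ‖z‖ ≤ R := by
        by_contra h
        rw [hdiv2 z h] at hz; simp at hz
      rw [hdiv z hzR] at hz
      exact_mod_cast (hmem z).2 (Or.inl ⟨hzR, left_ne_zero_of_mul hz⟩)
  · exact hTR
  · intro z hz h
    exact (hmem z).2 (Or.inl ⟨hz, left_ne_zero_of_mul h⟩)

lemma jensen_slope {f : ℂ → ℂ} {P : Set ℂ} (hf : MeromOn f P univ) (ht : ¬ IsRationalFn f P)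
    {s t : ℝ} (hs : 0 < s) (hst : s < t) (hP : ∀ z, s < ‖z‖ → ‖z‖ ≤ t → z ∉ P) :
    cnt (ordR f) {z | ‖z‖ ≤ s} * Real.log (t / s) ≤
      Real.circleAverage (fun z => Real.log ‖f z‖) 0 t -
        Real.circleAverage (fun z => Real.log ‖f z‖) 0 s ∧
    Real.circleAverage (fun z => Real.log ‖f z‖) 0 t -
        Real.circleAverage (fun z => Real.log ‖f z‖) 0 s ≤
      cnt (ordR f) {z | ‖z‖ ≤ t} * Real.log (t / s) := by
  obtain ⟨C, hC⟩ := jensen_cnt hf ht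
  have ht0 : 0 < t := hs.trans hst
  rw [hC t ht0, hC s hs, add_sub_add_right_eq_sub]
  have hl := locFin_ordR hf ht
  set T := (hl t).toFinset with hT
  have hmem : ∀ z, z ∈ T ↔ (‖z‖ ≤ t ∧ ordR f z ≠ 0) := by
    intro z; simp [hT]
  have e1 : ∀ w : ℂ → ℝ, (∀ z, ordR f z = 0 → w z = 0) → cnt w {z | ‖z‖ ≤ t} = ∑ z ∈ T, w z := by
    intro w hw
    refine cnt_finset (fun z hz => ((hmem z).1 hz).1) fun z hz h => (hmem z).2 ⟨hz, fun h' => h (hw z h')⟩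
  have e2 : ∀ w : ℂ → ℝ, (∀ z, ordR f z = 0 → w z = 0) →
      cnt w {z | ‖z‖ ≤ s} = ∑ z ∈ T, if ‖z‖ ≤ s then w z else 0 := by
    intro w hw
    rw [← Finset.sum_filter]
    refine cnt_finset (fun z hz => (Finset.mem_filter.1 hz).2) fun z hz h => ?_
    exact Finset.mem_filter.2 ⟨(hmem z).2 ⟨le_trans hz hst.le, fun h' => h (hw z h')⟩, hz⟩
  rw [e1 (fun u => ordR f u * (Real.log t - Real.log ‖u‖)) (fun z h => by simp [h]),
    e2 (fun u => ordR f u * (Real.log s - Real.log ‖u‖)) (fun z h => by simp [h]),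
    e1 (ordR f) (fun z h => h), e2 (ordR f) (fun z h => h), ← Finset.sum_sub_distrib, Finset.sum_mul, Finset.sum_mul]
  rw [Real.log_div ht0.ne' hs.ne']
  have hpos : ∀ z, s < ‖z‖ → ‖z‖ ≤ t → 0 ≤ ordR f z := by
    intro z h1 h2
    rw [ordR_eq hf ht, wtP, if_neg (hP z h1 h2), sub_zero]
    exact wtV_nonneg ..
  constructor
  · refine Finset.sum_le_sum fun z hz => ?_
    have hzt := ((hmem z).1 hz).1
    split_ifs with h
    · apply le_of_eq; ring
    · push Not at h
      rw [zero_mul, sub_zero]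
      exact mul_nonneg (hpos z h hzt) (sub_nonneg.2 (Real.log_le_log (hs.trans h) hzt))
  · refine Finset.sum_le_sum fun z hz => ?_
    have hzt := ((hmem z).1 hz).1
    split_ifs with h
    · apply le_of_eq; ring
    · push Not at h
      rw [sub_zero]
      exact mul_le_mul_of_nonneg_left (by linarith [Real.log_le_log hs h.le]) (hpos z h hzt)

lemma circleAverage_log_nonpos {f : ℂ → ℂ} {P : Set ℂ} (hf : MeromOn f P univ) {R : ℝ} (hR : 0 < R)
    (h : ∀ z : ℂ, ‖z‖ = R → ‖f z‖ ≤ 1) : Real.circleAverage (fun z => Real.log ‖f z‖) 0 R ≤ 0 := by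
  refine Real.circleAverage_mono_on_of_le_circle ?_ ?_
  · exact MeromorphicOn.circleIntegrable_log_norm fun z _ => hf.meromorphicAt z
  · intro z hz
    rw [mem_sphere_zero_iff_norm, abs_of_pos hR] at hz
    exact Real.log_nonpos (norm_nonneg _) (h z hz)

lemma circleAverage_log_ge {f : ℂ → ℂ} {P : Set ℂ} (hf : MeromOn f P univ) {R δ : ℝ} (hR : 0 < R)
    (hδ : 0 < δ) (h : ∀ z : ℂ, ‖z‖ = R → δ ≤ ‖f z‖) :
    Real.log δ ≤ Real.circleAverage (fun z => Real.log ‖f z‖) 0 R := by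
  rw [← Real.circleAverage_const (Real.log δ) 0 R]
  refine Real.circleAverage_mono ?_ ?_ ?_
  · exact circleIntegrable_const _ _ _
  · exact MeromorphicOn.circleIntegrable_log_norm fun z _ => hf.meromorphicAt z
  · intro z hz
    rw [mem_sphere_zero_iff_norm, abs_of_pos hR] at hz
    exact Real.log_le_log hδ (h z hz)

lemma polynomial_of_growth (n : ℕ) : ∀ F : ℂ → ℂ, Differentiable ℂ F →
    (∃ C, ∀ z, ‖F z‖ ≤ C * (1 + ‖z‖) ^ n) → ∃ p : Polynomial ℂ, ∀ z, F z = p.eval z := by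
  induction n with
  | zero =>
    rintro F hF ⟨C, hC⟩
    obtain ⟨c, hc⟩ := hF.exists_const_forall_eq_of_bounded (by
      rw [isBounded_iff_forall_norm_le]
      refine ⟨C, ?_⟩
      rintro _ ⟨z, rfl⟩
      simpa using hC z)
    exact ⟨Polynomial.C c, fun z => by simp [hc z]⟩
  | succ n ih =>
    rintro F hF ⟨C, hC⟩
    have hd : Differentiable ℂ (dslope F 0) := by
      rw [← differentiableOn_univ]
      exact (differentiableOn_dslope univ_mem).2 hF.differentiableOn
    have hC0 : 0 ≤ C := by
      have := hC 0
      simp at this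
      exact (norm_nonneg _).trans this
    obtain ⟨p, hp⟩ := ih (dslope F 0) hd (by
      obtain ⟨B, hB⟩ := (isCompact_closedBall (0 : ℂ) 1).exists_bound_of_continuousOn
        hd.continuous.continuousOn
      have hB0 : 0 ≤ B := (norm_nonneg _).trans (hB 0 (by simp))
      refine ⟨max B (4 * C), fun z => ?_⟩
      by_cases hz : ‖z‖ ≤ 1
      · have h1 := hB z (by simpa using hz)
        have h2 : (1 : ℝ) ≤ (1 + ‖z‖) ^ n := one_le_pow₀ (by linarith [norm_nonneg z])
        calc ‖dslope F 0 z‖ ≤ B := h1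
          _ ≤ max B (4 * C) * 1 := by rw [mul_one]; exact le_max_left _ _
          _ ≤ _ := by gcongr
      · push Not at hz
        have hz0 : z ≠ 0 := by rintro rfl; simp at hz; linarith
        rw [dslope_of_ne _ hz0, slope_def_field, norm_div, sub_zero,
          div_le_iff₀ (by linarith)]
        have h1 := hC z
        have h2 : ‖F 0‖ ≤ C := by simpa using hC 0
        have h3 := norm_sub_le (F z) (F 0)
        have h4 : (1 : ℝ) ≤ (1 + ‖z‖) ^ n := one_le_pow₀ (by linarith [norm_nonneg z])
        have h5 : C * (1 + ‖z‖) ^ (n + 1) ≤ 2 * C * (1 + ‖z‖) ^ n * ‖z‖ := by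
          rw [pow_succ]
          have : 0 ≤ C * (1 + ‖z‖) ^ n := by positivity
          nlinarith
        have h6 : C ≤ 2 * C * (1 + ‖z‖) ^ n * ‖z‖ := by
          have : 1 ≤ (1 + ‖z‖) ^ n * ‖z‖ := by nlinarith
          nlinarith
        calc ‖F z - F 0‖ ≤ 4 * C * (1 + ‖z‖) ^ n * ‖z‖ := by linarith
          _ ≤ _ := by gcongr; exact le_max_right _ _)
    refine ⟨Polynomial.C (F 0) + Polynomial.X * p, fun z => ?_⟩
    have := sub_smul_dslope F 0 z
    simp only [sub_zero, smul_eq_mul] at this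
    simp only [Polynomial.eval_add, Polynomial.eval_C, Polynomial.eval_mul, Polynomial.eval_X]
    rw [← hp z, this]; ring

lemma poly_growth (q : Polynomial ℂ) : ∃ C, ∀ z : ℂ, ‖q.eval z‖ ≤ C * (1 + ‖z‖) ^ q.natDegree := by
  refine ⟨∑ i ∈ Finset.range (q.natDegree + 1), ‖q.coeff i‖, fun z => ?_⟩
  rw [Polynomial.eval_eq_sum_range, Finset.sum_mul]
  refine (norm_sum_le _ _).trans (Finset.sum_le_sum fun i hi => ?_)
  rw [norm_mul, norm_pow]
  have h1 : ‖z‖ ^ i ≤ (1 + ‖z‖) ^ i := by gcongr; linarith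
  have h2 : (1 + ‖z‖) ^ i ≤ (1 + ‖z‖) ^ q.natDegree := by
    apply pow_le_pow_right₀ (by linarith [norm_nonneg z])
    have := Finset.mem_range.1 hi; omega
  have := h1.trans h2
  gcongr

open Classical in
lemma rational_of_bounded {f : ℂ → ℂ} {P : Set ℂ} (hf : MeromOn f P univ) {R0 : ℝ}
    (h : ∀ z : ℂ, R0 ≤ ‖z‖ → z ∉ P ∧ ‖f z‖ < 1 / 4) : IsRationalFn f P := by
  have hfin : P.Finite := by
    refine (hf.finite_poles R0).subset fun z hz => ⟨?_, hz⟩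
    by_contra h'
    exact (h z (by linarith [not_le.1 h'])).1 hz
  set T := hfin.toFinset with hT
  have hTm : ∀ z, z ∈ T ↔ z ∈ P := fun z => by simp [hT]
  set q : Polynomial ℂ := ∏ u ∈ T, (Polynomial.X - Polynomial.C u) ^ (poleOrder f u + 1) with hq
  have hq0 : q ≠ 0 := Finset.prod_ne_zero_iff.2 fun u _ => pow_ne_zero _ (Polynomial.X_sub_C_ne_zero u)
  set F : ℂ → ℂ := fun z => if z ∈ P then 0 else q.eval z * f z with hF
  have hoff : ∀ z ∉ P, F =ᶠ[𝓝 z] fun z => q.eval z * f z := by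
    intro z hz
    filter_upwards [hf.isClosed.isOpen_compl.mem_nhds hz] with w hw
    simp only [hF]; rw [if_neg hw]
  have hqan : ∀ (r : Polynomial ℂ) z, AnalyticAt ℂ (fun z => r.eval z) z := fun r z =>
    (r.differentiable).analyticAt z
  have hFd : Differentiable ℂ F := by
    intro z
    by_cases hz : z ∈ P
    · obtain ⟨hneg, hord⟩ := poleOrder_eq hf hz
      have h1 : meromorphicOrderAt f z = ((-(poleOrder f z : ℤ) : ℤ) : WithTop ℤ) := by
        rw [hord, neg_neg, WithTop.coe_untop₀_of_ne_top hneg.ne_top]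
      obtain ⟨g, hg, hg0, hge⟩ := (meromorphicOrderAt_eq_int_iff (hf.meromorphicAt z)).1 h1
      set r : Polynomial ℂ := ∏ u ∈ T.erase z, (Polynomial.X - Polynomial.C u) ^ (poleOrder f u + 1) with hr
      have hqr : ∀ w, q.eval w = (w - z) ^ (poleOrder f z + 1) * r.eval w := by
        intro w
        rw [hq, ← Finset.mul_prod_erase T _ ((hTm z).2 hz), Polynomial.eval_mul]
        simp [hr]
      have he : F =ᶠ[𝓝 z] fun w => (w - z) * r.eval w * g w := by
        have := (hge.and (hf.notMem_nhds z))
        rw [eventually_nhdsWithin_iff] at this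
        filter_upwards [this] with w hw
        by_cases hwz : w = z
        · subst hwz
          simp only [hF]; rw [if_pos hz]; simp
        · obtain ⟨h2, h3⟩ := hw hwz
          simp only [hF]; rw [if_neg h3, h2, hqr w, smul_eq_mul, zpow_neg, zpow_natCast]
          have : (w - z) ≠ 0 := sub_ne_zero.2 hwz
          field_simp
          ring
      have : AnalyticAt ℂ (fun w => (w - z) * r.eval w * g w) z :=
        ((analyticAt_id.fun_sub analyticAt_const).fun_mul (hqan r z)).fun_mul hg
      exact (this.congr he.symm).differentiableAt
    · have : AnalyticAt ℂ (fun w => q.eval w * f w) z := (hqan q z).fun_mul (hf.analyticAt hz)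
      exact (this.congr (hoff z hz).symm).differentiableAt
  obtain ⟨C, hC⟩ := poly_growth q
  have hC0 : 0 ≤ C := by
    have := hC 0
    simp at this
    exact (norm_nonneg _).trans this
  obtain ⟨p, hp⟩ := polynomial_of_growth q.natDegree F hFd (by
    obtain ⟨B, hB⟩ := (isCompact_closedBall (0 : ℂ) R0).exists_bound_of_continuousOn
      hFd.continuous.continuousOn
    refine ⟨max B C, fun z => ?_⟩
    have h4 : (1 : ℝ) ≤ (1 + ‖z‖) ^ q.natDegree := one_le_pow₀ (by linarith [norm_nonneg z])
    by_cases hz : ‖z‖ ≤ R0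
    · have h1 := hB z (by simpa using hz)
      calc ‖F z‖ ≤ B := h1
        _ ≤ max B C * 1 := by rw [mul_one]; exact le_max_left _ _
        _ ≤ _ := by
          have : 0 ≤ max B C := hC0.trans (le_max_right _ _)
          gcongr
    · obtain ⟨h1, h2⟩ := h z (by linarith [not_le.1 hz])
      have : F z = q.eval z * f z := by simp only [hF]; rw [if_neg h1]
      rw [this, norm_mul]
      calc ‖q.eval z‖ * ‖f z‖ ≤ ‖q.eval z‖ * 1 := by gcongr; linarith
        _ ≤ C * (1 + ‖z‖) ^ q.natDegree := by rw [mul_one]; exact hC z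
        _ ≤ _ := by gcongr; exact le_max_right _ _)
  refine ⟨p, q, hq0, fun z hz hqz => ?_⟩
  rw [eq_div_iff hqz, ← hp z]
  simp only [hF]; rw [if_neg hz]; ring

/-- The set where `f` is not small. -/
def bad (f : ℂ → ℂ) (P : Set ℂ) : Set ℂ := {z | z ∈ P ∨ 1 / 4 ≤ ‖f z‖}

lemma not_bad {f : ℂ → ℂ} {P : Set ℂ} {z : ℂ} : z ∉ bad f P ↔ z ∉ P ∧ ‖f z‖ < 1 / 4 := by
  simp only [bad, mem_ofPred_eq, not_or, not_le]

lemma isClosed_bad {f : ℂ → ℂ} {P : Set ℂ} (hf : MeromOn f P univ) : IsClosed (bad f P) := by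
  rw [← isOpen_compl_iff, isOpen_iff_mem_nhds]
  intro z hz
  obtain ⟨h1, h2⟩ := not_bad.1 hz
  filter_upwards [hf.isClosed.isOpen_compl.mem_nhds h1,
    (hf.analyticAt h1).continuousAt.norm.eventually_lt_const h2] with w hw hw2
  exact not_bad.2 ⟨hw, hw2⟩

lemma boundary_bad {f : ℂ → ℂ} {P : Set ℂ} (hf : MeromOn f P univ) {z : ℂ} (hz : z ∈ bad f P)
    (hz0 : z ≠ 0) {σ : ℝ} (hσ : σ ≠ 0)
    (h : ∀ᶠ t : ℝ in 𝓝[>] 0, ((1 + σ * t : ℝ) : ℂ) * z ∉ bad f P) : z ∉ P ∧ ‖f z‖ = 1 / 4 := by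
  have hγ1 : Tendsto (fun t : ℝ => ((1 + σ * t : ℝ) : ℂ) * z) (𝓝[>] 0) (𝓝 z) := by
    have : ContinuousAt (fun t : ℝ => ((1 + σ * t : ℝ) : ℂ) * z) 0 := by fun_prop
    have h2 := this.tendsto
    simp only [mul_zero, add_zero, ofReal_one, one_mul] at h2
    exact h2.mono_left inf_le_left
  have hγ : Tendsto (fun t : ℝ => ((1 + σ * t : ℝ) : ℂ) * z) (𝓝[>] 0) (𝓝[≠] z) := by
    refine tendsto_nhdsWithin_iff.2 ⟨hγ1, ?_⟩
    filter_upwards [self_mem_nhdsWithin] with t ht hh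
    have h2 : ((1 + σ * t : ℝ) : ℂ) * z = 1 * z := by rw [one_mul]; exact hh
    have h3 := mul_right_cancel₀ hz0 h2
    have h4 : 1 + σ * t = 1 := by exact_mod_cast h3
    have h5 : σ * t = 0 := by linarith
    rcases mul_eq_zero.1 h5 with h6 | h6
    · exact hσ h6
    · exact (ne_of_gt ht) h6
  have hP : z ∉ P := by
    intro hP
    have h2 := (hγ.eventually ((hf.2.2.1 z hP).eventually (eventually_ge_atTop 1))).and h
    obtain ⟨t, ht1, ht2⟩ := h2.exists
    linarith [(not_bad.1 ht2).2]
  refine ⟨hP, le_antisymm ?_ ?_⟩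
  · have h3 : Tendsto (fun t : ℝ => ‖f (((1 + σ * t : ℝ) : ℂ) * z)‖) (𝓝[>] 0) (𝓝 ‖f z‖) :=
      (hf.analyticAt hP).continuousAt.norm.tendsto.comp hγ1
    exact le_of_tendsto h3 (h.mono fun t ht => (not_bad.1 ht).2.le)
  · rcases hz with hz | hz
    · exact absurd hz hP
    · exact hz

lemma next_bad {f : ℂ → ℂ} {P : Set ℂ} (hf : MeromOn f P univ) (ht : ¬ IsRationalFn f P)
    {r : ℝ} (hr : 0 < r) (hcirc : ∀ z, ‖z‖ = r → z ∉ bad f P) :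
    ∃ z, r < ‖z‖ ∧ (z ∉ P ∧ ‖f z‖ = 1 / 4) ∧ ∀ w, r ≤ ‖w‖ → ‖w‖ < ‖z‖ → w ∉ bad f P := by
  have hex : ∃ z0, r ≤ ‖z0‖ ∧ z0 ∈ bad f P := by
    by_contra hcon
    push Not at hcon
    exact ht (rational_of_bounded hf fun z hz => not_bad.1 (hcon z hz))
  obtain ⟨z0, hz0, hz0b⟩ := hex
  have hcomp : IsCompact (Metric.closedBall (0 : ℂ) ‖z0‖ ∩ (bad f P ∩ {z | r ≤ ‖z‖})) :=
    (isCompact_closedBall _ _).inter_right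
      ((isClosed_bad hf).inter (isClosed_le continuous_const continuous_norm))
  obtain ⟨z, ⟨hz1, hz2, hz3⟩, hmin⟩ := hcomp.exists_isMinOn ⟨z0, by simp, hz0b, hz0⟩
    continuous_norm.continuousOn
  rw [mem_closedBall_zero_iff] at hz1
  have hlt : r < ‖z‖ := lt_of_le_of_ne hz3 fun h => hcirc z h.symm hz2
  have hall : ∀ w, r ≤ ‖w‖ → ‖w‖ < ‖z‖ → w ∉ bad f P := by
    intro w h1 h2 h3
    have : ‖z‖ ≤ ‖w‖ := hmin ⟨by rw [mem_closedBall_zero_iff]; linarith, h3, h1⟩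
    linarith
  have hzpos : 0 < ‖z‖ := hr.trans hlt
  refine ⟨z, hlt, boundary_bad hf hz2 (norm_pos_iff.1 hzpos) (σ := -1) (by norm_num) ?_, hall⟩
  have hr1 : 0 < 1 - r / ‖z‖ := by rw [sub_pos, div_lt_one hzpos]; exact hlt
  filter_upwards [Ioo_mem_nhdsGT hr1] with t ht
  have h1 := ht.2
  have h2 : r / ‖z‖ < 1 + -1 * t := by linarith
  have h3 : 0 < 1 + -1 * t := lt_trans (by positivity) h2
  have h4 := ht.1
  apply hall
  · rw [norm_mul, norm_real, Real.norm_of_nonneg h3.le]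
    rw [div_lt_iff₀ hzpos] at h2; exact h2.le
  · rw [norm_mul, norm_real, Real.norm_of_nonneg h3.le]
    nlinarith

lemma prev_bad {f : ℂ → ℂ} {P : Set ℂ} (hf : MeromOn f P univ)
    {r : ℝ} {z0 : ℂ} (hz0 : z0 ≠ 0) (hz0r : ‖z0‖ ≤ r) (hz0b : z0 ∈ bad f P)
    (hcirc : ∀ z, ‖z‖ = r → z ∉ bad f P) :
    ∃ z, ‖z0‖ ≤ ‖z‖ ∧ ‖z‖ < r ∧ (z ∉ P ∧ ‖f z‖ = 1 / 4) ∧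
      ∀ w, ‖z‖ < ‖w‖ → ‖w‖ ≤ r → w ∉ bad f P := by
  have hcomp : IsCompact (Metric.closedBall (0 : ℂ) r ∩ bad f P) :=
    (isCompact_closedBall _ _).inter_right (isClosed_bad hf)
  obtain ⟨z, ⟨hz1, hz2⟩, hmax⟩ := hcomp.exists_isMaxOn ⟨z0, by simpa using hz0r, hz0b⟩
    continuous_norm.continuousOn
  rw [mem_closedBall_zero_iff] at hz1
  have hlt : ‖z‖ < r := lt_of_le_of_ne hz1 fun h => hcirc z h hz2
  have hall : ∀ w, ‖z‖ < ‖w‖ → ‖w‖ ≤ r → w ∉ bad f P := by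
    intro w h1 h2 h3
    have : ‖w‖ ≤ ‖z‖ := hmax ⟨by rwa [mem_closedBall_zero_iff], h3⟩
    linarith
  have h00 : ‖z0‖ ≤ ‖z‖ := hmax ⟨by rwa [mem_closedBall_zero_iff], hz0b⟩
  have hzpos : 0 < ‖z‖ := (norm_pos_iff.2 hz0).trans_le h00
  refine ⟨z, h00, hlt, boundary_bad hf hz2 (norm_pos_iff.1 hzpos) (σ := 1) (by norm_num) ?_, hall⟩
  have hr1 : 0 < r / ‖z‖ - 1 := by rw [sub_pos, one_lt_div hzpos]; exact hlt
  filter_upwards [Ioo_mem_nhdsGT hr1] with t ht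
  have h1 := ht.2
  have h2 : 1 + 1 * t < r / ‖z‖ := by linarith
  have h4 := ht.1
  have h3 : 0 < 1 + 1 * t := by linarith
  apply hall
  · rw [norm_mul, norm_real, Real.norm_of_nonneg h3.le]
    nlinarith
  · rw [norm_mul, norm_real, Real.norm_of_nonneg h3.le]
    rw [lt_div_iff₀ hzpos] at h2; exact h2.le

lemma ord_cnt_mono {f : ℂ → ℂ} {P : Set ℂ} (hf : MeromOn f P univ) (ht : ¬ IsRationalFn f P)
    {a b : ℝ} (hab : a ≤ b) (hP : ∀ z, a < ‖z‖ → ‖z‖ ≤ b → z ∉ P) :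
    cnt (ordR f) {z | ‖z‖ ≤ a} ≤ cnt (ordR f) {z | ‖z‖ ≤ b} := by
  rw [(locFin_ordR hf ht).cnt_diff (S := {z | ‖z‖ ≤ a}) (T := {z | ‖z‖ ≤ b}) (t := b)
    (fun z hz => hz) (fun z hz => le_trans hz hab)]
  have : 0 ≤ cnt (ordR f) ({z | ‖z‖ ≤ b} \ {z | ‖z‖ ≤ a}) := by
    rw [cnt_congr (w := wtV f P 0)]
    · exact cnt_nonneg (wtV_nonneg f P 0) _
    · intro z hz
      have h1 : a < ‖z‖ := not_le.1 hz.2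
      rw [ordR_eq hf ht, wtP, if_neg (hP z h1 hz.1), sub_zero]
  linarith

lemma core {θ₀ θ₁ θ₂ : ℝ} {f : ℂ → ℂ} {P : Set ℂ} (hc : Cfg θ₀ θ₁ θ₂ f P)
    {rk : ℕ → ℝ} (hrk : Tendsto rk atTop atTop)
    (H : ∀ R > 1, ∀ᶠ k in atTop, ∀ z : ℂ, rk k / R ≤ ‖z‖ → ‖z‖ ≤ R * rk k → z ∉ P ∧ ‖f z‖ < 1 / 4) :
    ∃ B : ℝ, ∀ R > 1, ∃ᶠ k in atTop, nTotal f P (R * rk k) - nTotal f P (rk k / R) ≤ B := by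
  have hf := hc.hf
  have htr := hc.htrans
  set 𝒰 : Ultrafilter ℕ := hyperfilter ℕ with h𝒰
  have hle : (𝒰 : Filter ℕ) ≤ atTop := by rw [← Nat.cofinite_eq_atTop]; exact hyperfilter_le_cofinite
  have hH : ∀ R > 1, ∀ᶠ k in (𝒰 : Filter ℕ), ∀ z : ℂ, rk k / R ≤ ‖z‖ → ‖z‖ ≤ R * rk k →
      z ∉ bad f P := fun R hR => ((H R hR).filter_mono hle).mono
        fun k hk z h1 h2 => not_bad.2 (hk z h1 h2)
  have hrk' : Tendsto rk (𝒰 : Filter ℕ) atTop := hrk.mono_left hle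
  have hpos : ∀ᶠ k in (𝒰 : Filter ℕ), 0 < rk k := hrk'.eventually (eventually_gt_atTop 0)
  have hcirc : ∀ᶠ k in (𝒰 : Filter ℕ), ∀ z : ℂ, ‖z‖ = rk k → z ∉ bad f P := by
    filter_upwards [hH 2 (by norm_num), hpos] with k hk h0 z hz
    exact hk z (by rw [hz]; linarith) (by rw [hz]; linarith)
  -- outer points
  have hout : ∀ k, ∃ z : ℂ, 0 < rk k → (∀ z : ℂ, ‖z‖ = rk k → z ∉ bad f P) →
      rk k < ‖z‖ ∧ (z ∉ P ∧ ‖f z‖ = 1 / 4) ∧ ∀ w, rk k ≤ ‖w‖ → ‖w‖ < ‖z‖ → w ∉ bad f P := by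
    intro k
    by_cases h : 0 < rk k ∧ (∀ z : ℂ, ‖z‖ = rk k → z ∉ bad f P)
    · obtain ⟨z, hz⟩ := next_bad hf htr h.1 h.2
      exact ⟨z, fun _ _ => hz⟩
    · exact ⟨0, fun h1 h2 => absurd ⟨h1, h2⟩ h⟩
  choose zo hzo using hout
  have hzo' : ∀ᶠ k in (𝒰 : Filter ℕ), rk k < ‖zo k‖ ∧ (zo k ∉ P ∧ ‖f (zo k)‖ = 1 / 4) ∧
      ∀ w, rk k ≤ ‖w‖ → ‖w‖ < ‖zo k‖ → w ∉ bad f P := by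
    filter_upwards [hpos, hcirc] with k h1 h2 using hzo k h1 h2
  have hobad : ∀ {z}, (z ∉ P ∧ ‖f z‖ = 1 / 4) → z ∈ bad f P := fun h => Or.inr h.2.ge
  have hofar : ∀ R > 1, ∀ᶠ k in (𝒰 : Filter ℕ), R * rk k < ‖zo k‖ := by
    intro R hR
    filter_upwards [hzo', hH R hR, hpos] with k h1 h2 h0
    by_contra h3
    refine h2 _ ?_ (not_lt.1 h3) (hobad h1.2.1)
    refine le_trans ?_ h1.1.le
    exact div_le_self h0.le hR.le
  -- inner points
  have hunb : ∀ N : ℝ, ∃ z : ℂ, N ≤ ‖z‖ ∧ z ∈ bad f P := by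
    intro N
    by_contra hcon
    push Not at hcon
    exact htr (rational_of_bounded hf fun z hz => not_bad.1 (hcon z hz))
  obtain ⟨b0, hb01, hb0⟩ := hunb 1
  have hinn : ∀ k, ∃ z : ℂ, ‖b0‖ ≤ rk k → (∀ z : ℂ, ‖z‖ = rk k → z ∉ bad f P) →
      ‖b0‖ ≤ ‖z‖ ∧ ‖z‖ < rk k ∧ (z ∉ P ∧ ‖f z‖ = 1 / 4) ∧
        ∀ w, ‖z‖ < ‖w‖ → ‖w‖ ≤ rk k → w ∉ bad f P := by
    intro k
    by_cases h : ‖b0‖ ≤ rk k ∧ (∀ z : ℂ, ‖z‖ = rk k → z ∉ bad f P)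
    · obtain ⟨z, hz⟩ := prev_bad hf (norm_pos_iff.1 (by linarith)) h.1 hb0 h.2
      exact ⟨z, fun _ _ => hz⟩
    · exact ⟨0, fun h1 h2 => absurd ⟨h1, h2⟩ h⟩
  choose zi hzi using hinn
  have hzi' : ∀ᶠ k in (𝒰 : Filter ℕ), ‖b0‖ ≤ ‖zi k‖ ∧ ‖zi k‖ < rk k ∧
      (zi k ∉ P ∧ ‖f (zi k)‖ = 1 / 4) ∧ ∀ w, ‖zi k‖ < ‖w‖ → ‖w‖ ≤ rk k → w ∉ bad f P := by
    filter_upwards [hrk'.eventually (eventually_ge_atTop ‖b0‖), hcirc] with k h1 h2 using hzi k h1 h2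
  have hifar : ∀ R > 1, ∀ᶠ k in (𝒰 : Filter ℕ), ‖zi k‖ < rk k / R := by
    intro R hR
    filter_upwards [hzi', hH R hR, hpos] with k h1 h2 h0
    by_contra h3
    refine h2 _ (not_lt.1 h3) ?_ (hobad h1.2.2.1)
    refine h1.2.1.le.trans ?_
    nlinarith
  have hotop : Tendsto (fun k => ‖zo k‖) (𝒰 : Filter ℕ) atTop :=
    tendsto_atTop_mono' _ (hzo'.mono fun k hk => hk.1.le) hrk'
  have hitop : Tendsto (fun k => ‖zi k‖) (𝒰 : Filter ℕ) atTop := by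
    rw [tendsto_atTop]
    intro N
    obtain ⟨z, hz1, hz2⟩ := hunb N
    filter_upwards [hzi', hrk'.eventually (eventually_ge_atTop ‖z‖)] with k h1 h2
    by_contra h3
    exact h1.2.2.2 z (by linarith [not_le.1 h3]) h2 hz2
  -- circles
  obtain ⟨s, hs1, hs2, δ, hδ, hsδ⟩ := scale_circle hc (α := 1 / 2) (β := 1) hotop (by norm_num)
    (by norm_num) base_lt (zs := zo) (by
      filter_upwards [hzo', hofar 2 (by norm_num)] with k h1 h2 z h3 h4
      exact not_bad.1 (h1.2.2 z (by linarith) (by linarith)))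
    (hzo'.mono fun k hk => ⟨rfl, hk.2.1⟩)
  obtain ⟨s₂, hs₂1, hs₂2, δ₂, hδ₂, hsδ₂⟩ := scale_circle hc (α := 1) (β := 2) hitop (by norm_num)
    (by norm_num) base_gt (zs := zi) (by
      filter_upwards [hzi', hifar 2 (by norm_num)] with k h1 h2 z h3 h4
      exact not_bad.1 (h1.2.2.2 z (by linarith) (by linarith)))
    (hzi'.mono fun k hk => ⟨rfl, hk.2.2.1⟩)
  have hs0 : 0 < s := by linarith
  have hs₂0 : 0 < s₂ := by linarith
  set s' := (s + 1) / 2 with hs'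
  set t' := (s₂ + 1) / 2 with ht'
  have hl1 : 0 < Real.log (s' / s) := Real.log_pos (by rw [one_lt_div hs0]; linarith)
  have hl2 : 0 < Real.log (s₂ / t') := Real.log_pos (by rw [one_lt_div (by linarith)]; linarith)
  have hB1 : ∀ᶠ k in (𝒰 : Filter ℕ), cnt (ordR f) {z | ‖z‖ ≤ s * ‖zo k‖} ≤
      -Real.log δ / Real.log (s' / s) := by
    filter_upwards [hsδ, hzo', hofar 2 (by norm_num), hpos] with k h1 h2 h3 h0
    have hρ : 0 < ‖zo k‖ := by linarith
    have hgood : ∀ z, s * ‖zo k‖ ≤ ‖z‖ → ‖z‖ ≤ s' * ‖zo k‖ → z ∉ P ∧ ‖f z‖ < 1 / 4 := by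
      intro z h4 h5
      exact not_bad.1 (h2.2.2 z (by nlinarith) (by nlinarith))
    have h4 := (jensen_slope hf htr (s := s * ‖zo k‖) (t := s' * ‖zo k‖) (by positivity)
      (by gcongr; linarith) (fun z h4 h5 => (hgood z h4.le h5).1)).1
    have h5 := circleAverage_log_nonpos hf (R := s' * ‖zo k‖) (by positivity)
      (fun z hz => by have := (hgood z (by rw [hz]; gcongr; linarith) hz.le).2; linarith)
    have h6 := circleAverage_log_ge hf (R := s * ‖zo k‖) (by positivity) hδ h1
    rw [mul_div_mul_right _ _ hρ.ne'] at h4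
    rw [le_div_iff₀ hl1]
    linarith
  have hB2 : ∀ᶠ k in (𝒰 : Filter ℕ), Real.log δ₂ / Real.log (s₂ / t') ≤
      cnt (ordR f) {z | ‖z‖ ≤ s₂ * ‖zi k‖} := by
    filter_upwards [hsδ₂, hzi', hifar 2 (by norm_num), hpos] with k h1 h2 h3 h0
    have hρ : 0 < ‖zi k‖ := by linarith
    have hgood : ∀ z, t' * ‖zi k‖ ≤ ‖z‖ → ‖z‖ ≤ s₂ * ‖zi k‖ → z ∉ P ∧ ‖f z‖ < 1 / 4 := by
      intro z h4 h5
      exact not_bad.1 (h2.2.2.2 z (by nlinarith) (by nlinarith))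
    have htt : 0 < t' := by linarith
    have h4 := (jensen_slope hf htr (s := t' * ‖zi k‖) (t := s₂ * ‖zi k‖) (by positivity)
      (by gcongr; linarith) (fun z h4 h5 => (hgood z h4.le h5).1)).2
    have h5 := circleAverage_log_nonpos hf (R := t' * ‖zi k‖) (by positivity)
      (fun z hz => by have := (hgood z hz.ge (by rw [hz]; gcongr; linarith)).2; linarith)
    have h6 := circleAverage_log_ge hf (R := s₂ * ‖zi k‖) (by positivity) hδ₂ h1
    rw [mul_div_mul_right _ _ hρ.ne'] at h4
    rw [div_le_iff₀ hl2]
    linarith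
  refine ⟨-Real.log δ / Real.log (s' / s) - Real.log δ₂ / Real.log (s₂ / t'), fun R hR => ?_⟩
  have hfin : ∀ᶠ k in (𝒰 : Filter ℕ), nTotal f P (R * rk k) - nTotal f P (rk k / R) ≤
      -Real.log δ / Real.log (s' / s) - Real.log δ₂ / Real.log (s₂ / t') := by
    filter_upwards [hB1, hB2, hofar (2 * R) (by linarith), hifar (2 * R) (by linarith), hzo', hzi',
      hH R hR, hpos] with k b1 b2 o i zo1 zi1 hk h0
    have hRk : rk k ≤ R * rk k := by nlinarith
    have hRk2 : rk k / R ≤ rk k := div_le_self h0.le hR.le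
    have m1 : cnt (ordR f) {z | ‖z‖ ≤ R * rk k} ≤ cnt (ordR f) {z | ‖z‖ ≤ s * ‖zo k‖} := by
      refine ord_cnt_mono hf htr (by nlinarith) fun z h1 h2 => ?_
      have := norm_nonneg (zo k)
      exact (not_bad.1 (zo1.2.2 z (by linarith) (by nlinarith))).1
    have hi2 : 2 * ‖zi k‖ ≤ rk k / R := by
      have : rk k / (2 * R) = rk k / R / 2 := by field_simp
      linarith
    have hb0' : 0 < ‖zi k‖ := by linarith [zi1.1]
    have m2 : cnt (ordR f) {z | ‖z‖ ≤ s₂ * ‖zi k‖} ≤ cnt (ordR f) {z | ‖z‖ ≤ rk k / R} := by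
      refine ord_cnt_mono hf htr (by nlinarith) fun z h1 h2 => ?_
      exact (not_bad.1 (zi1.2.2.2 z (by nlinarith) (by linarith))).1
    have hsub : {z : ℂ | ‖z‖ ≤ rk k / R} ⊆ {z | ‖z‖ ≤ R * rk k} := fun z hz =>
      le_trans (le_trans hz hRk2) hRk
    rw [nTotal_eq hf htr, nTotal_eq hf htr,
      (locFin_wt hf htr).cnt_diff (S := {z | ‖z‖ ≤ rk k / R})
        (T := {z | ‖z‖ ≤ R * rk k}) (t := R * rk k) (fun z hz => hz) hsub, add_sub_cancel_left,
      cnt_congr (w := ordR f)]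
    · have := (locFin_ordR hf htr).cnt_diff (S := {z | ‖z‖ ≤ rk k / R})
        (T := {z | ‖z‖ ≤ R * rk k}) (t := R * rk k) (fun z hz => hz) hsub
      linarith
    · intro z hz
      have h1 : rk k / R < ‖z‖ := not_le.1 hz.2
      obtain ⟨h2, h3⟩ := not_bad.1 (hk z h1.le hz.1)
      rw [ordR_eq hf htr, wt]
      have : wtV f P 1 z = 0 := by
        rw [wtV, if_neg]
        rintro ⟨-, h⟩
        rw [h] at h3; norm_num at h3
      rw [this, wtP, if_neg h2]; ring
  exact hfin.frequently.filter_mono hle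

lemma meromOn_one_sub {f : ℂ → ℂ} {P : Set ℂ} (hf : MeromOn f P univ) :
    MeromOn (fun z => 1 - f z) P univ := by
  refine ⟨hf.1, fun z hz => analyticAt_const.fun_sub (hf.2.1 z hz), fun p hp => ?_, hf.2.2.2⟩
  refine tendsto_atTop_mono (f := fun z => ‖f z‖ - 1) (fun z => ?_)
    (tendsto_atTop_add_const_right _ (-1) (hf.2.2.1 p hp))
  have := norm_sub_norm_le (f z) 1
  rw [norm_one, norm_sub_rev] at this
  exact this

lemma vOrder_neg (g : ℂ → ℂ) (z : ℂ) : vOrder (fun w => - g w) z = vOrder g z := by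
  unfold vOrder
  congr 1
  ext m
  constructor
  · rintro ⟨h, h1, h2, h3⟩
    exact ⟨fun w => - h w, h1.fun_neg, neg_ne_zero.2 h2, h3.mono fun w hw => by
      rw [mul_neg, ← hw, neg_neg]⟩
  · rintro ⟨h, h1, h2, h3⟩
    exact ⟨fun w => - h w, h1.fun_neg, neg_ne_zero.2 h2, h3.mono fun w hw => by
      rw [mul_neg, ← hw]⟩

lemma wtV_one_sub (f : ℂ → ℂ) (P : Set ℂ) (a z : ℂ) :
    wtV (fun z => 1 - f z) P a z = wtV f P (1 - a) z := by
  unfold wtV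
  have h1 : (fun w => 1 - f w - a) = fun w => -(f w - (1 - a)) := by ext w; ring
  rw [h1, vOrder_neg]
  have h2 : (1 - f z = a) ↔ (f z = 1 - a) := by
    constructor
    · intro h; rw [← h]; ring
    · intro h; rw [h]; ring
  by_cases h3 : z ∉ P ∧ f z = 1 - a
  · rw [if_pos h3, if_pos ⟨h3.1, h2.2 h3.2⟩]
  · rw [if_neg h3, if_neg fun h => h3 ⟨h.1, h2.1 h.2⟩]

lemma poleOrder_one_sub {f : ℂ → ℂ} {P : Set ℂ} (hf : MeromOn f P univ) {p : ℂ} (hp : p ∈ P) :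
    poleOrder (fun z => 1 - f z) p = poleOrder f p := by
  obtain ⟨h1, h2⟩ := poleOrder_eq hf hp
  obtain ⟨-, h4⟩ := poleOrder_eq (meromOn_one_sub hf) hp
  have h5 : meromorphicOrderAt (fun z => 1 - f z) p = meromorphicOrderAt f p := by
    have e : (fun z => 1 - f z) = (fun _ => (1 : ℂ)) + (-f) := by ext z; simp [sub_eq_add_neg]
    have hn : meromorphicOrderAt (-f) p = meromorphicOrderAt f p := meromorphicOrderAt_neg.symm
    rw [e, meromorphicOrderAt_add_eq_right_of_lt (MeromorphicAt.const _ _), hn]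
    rw [hn, meromorphicOrderAt_const, if_neg one_ne_zero]
    exact h1
  have : (poleOrder (fun z => 1 - f z) p : ℤ) = poleOrder f p := by rw [h4, h5, h2]
  exact_mod_cast this

lemma nTotal_one_sub {f : ℂ → ℂ} {P : Set ℂ} (hf : MeromOn f P univ) (t : ℝ) :
    nTotal (fun z => 1 - f z) P t = nTotal f P t := by
  unfold nTotal
  rw [nValue_eq, nValue_eq, nPoles_eq, nValue_eq, nValue_eq, nPoles_eq]
  have e : ∀ a, wtV (fun z => 1 - f z) P a = wtV f P (1 - a) := fun a => funext (wtV_one_sub f P a)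
  have e2 : wtP (fun z => 1 - f z) P = wtP f P := by
    ext z; unfold wtP
    split_ifs with h
    · rw [poleOrder_one_sub hf h]
    · rfl
  rw [e, e, e2]; simp; ring

lemma Cfg.one_sub {θ₀ θ₁ θ₂ : ℝ} {f : ℂ → ℂ} {P : Set ℂ} (hc : Cfg θ₀ θ₁ θ₂ f P) :
    Cfg θ₁ θ₀ θ₂ (fun z => 1 - f z) P where
  d01 := hc.d01.symm
  d02 := hc.d12
  d12 := hc.d02
  hf := meromOn_one_sub hc.hf
  htrans := by
    rintro ⟨p, q, hq, h⟩
    refine hc.htrans ⟨q - p, q, hq, fun z hz hqz => ?_⟩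
    have := h z hz hqz
    rw [Polynomial.eval_sub, sub_div, div_self hqz, ← this]; ring
  h0 := hc.h1.subset fun z hz => ⟨⟨hz.1.1, (sub_eq_zero.1 hz.1.2).symm⟩, hz.2⟩
  h1 := hc.h0.subset fun z hz => ⟨⟨hz.1.1, by have := hz.1.2; simpa using this⟩, hz.2⟩
  hp := hc.hp

/-- Bounded growth along a subsequence gives Polya peaks of order zero. -/
lemma peaks_of_bounded {f : ℂ → ℂ} {P : Set ℂ} (hf : MeromOn f P univ) (ht : ¬ IsRationalFn f P)
    {s : ℕ → ℝ} (hs : Tendsto s atTop atTop)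
    (h : ∀ R > 1, ∃ B : ℝ, ∀ᶠ k in atTop, nTotal f P (R * s k) - nTotal f P (s k / R) ≤ B) :
    PolyaPeaks1 (nTotal f P) s 0 ∧ PolyaPeaks2 (nTotal f P) s 0 := by
  have hmono : Monotone (nTotal f P) := by
    intro a b hab
    rw [nTotal_eq hf ht, nTotal_eq hf ht]
    exact (locFin_wt hf ht).cnt_mono (wt_nonneg f P) (t := b) (fun z hz => hz)
      (fun z hz => le_trans hz hab)
  have hnn : ∀ t, 0 ≤ nTotal f P t := by
    intro t; rw [nTotal_eq hf ht]; exact cnt_nonneg (wt_nonneg f P) _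
  have key : ∀ ε > (0 : ℝ), ∀ᶠ k in atTop, ∀ t : ℝ, ε ≤ t → t ≤ ε⁻¹ →
      |nTotal f P (t * s k) - nTotal f P (s k)| ≤ ε * nTotal f P (s k) := by
    intro ε hε
    by_cases hb : ∃ M : ℕ, ∀ t, nTotal f P t ≤ M
    · -- eventually constant
      choose n hn using nTotal_nat hf ht
      classical
      obtain ⟨M, hM⟩ := hb
      have hex : ∃ M : ℕ, ∀ t, n t ≤ M := ⟨M, fun t => by
        have := hM t; rw [hn t] at this; exact_mod_cast this⟩
      have hmin := Nat.find_spec hex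
      set m := Nat.find hex with hm
      have hatt : ∃ t0, n t0 = m := by
        by_contra hcon
        push Not at hcon
        have hlt : ∀ t, n t < m := fun t => lt_of_le_of_ne (hmin t) (hcon t)
        have hm0 : 0 < m := (Nat.zero_le _).trans_lt (hlt 0)
        have := Nat.find_min hex (m := m - 1) (by omega)
        exact this fun t => by have := hlt t; omega
      obtain ⟨t0, ht0⟩ := hatt
      have hconst : ∀ t, t0 ≤ t → nTotal f P t = m := by
        intro t htt
        apply le_antisymm
        · rw [hn t]; exact_mod_cast hmin t
        · rw [← ht0, ← hn t0]; exact hmono htt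
      filter_upwards [hs.eventually (eventually_ge_atTop (max t0 (t0 / ε))),
        hs.eventually (eventually_ge_atTop 0)] with k hk hk0 t h1 h2
      have a1 : t0 ≤ s k := (le_max_left _ _).trans hk
      have a2 : t0 ≤ t * s k := by
        have := (le_max_right _ _).trans hk
        rw [div_le_iff₀ hε] at this
        nlinarith
      rw [hconst _ a1, hconst _ a2]
      simp; positivity
    · push Not at hb
      set R := max 2 ε⁻¹ with hR
      obtain ⟨B, hB⟩ := h R (lt_of_lt_of_le one_lt_two (le_max_left _ _))
      obtain ⟨M, hM⟩ := exists_nat_gt (B / ε)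
      obtain ⟨t0, ht0⟩ := hb M
      filter_upwards [hB, hs.eventually (eventually_ge_atTop t0),
        hs.eventually (eventually_ge_atTop 0)] with k hk hk1 hk0 t h1 h2
      have hRpos : 0 < R := lt_of_lt_of_le two_pos (le_max_left _ _)
      have hR1 : 1 ≤ R := le_trans (by norm_num) (le_max_left 2 ε⁻¹)
      have b1 : nTotal f P (t * s k) ≤ nTotal f P (R * s k) := hmono (by
        have := h2.trans (le_max_right 2 ε⁻¹); gcongr)
      have b2 : nTotal f P (s k / R) ≤ nTotal f P (t * s k) := hmono (by
        rw [div_le_iff₀ hRpos]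
        have h3 : 1 ≤ t * R := by
          have : ε * ε⁻¹ ≤ t * R := by
            have h4 : ε⁻¹ ≤ R := le_max_right _ _
            have h5 : 0 ≤ t := hε.le.trans h1
            gcongr
          rwa [mul_inv_cancel₀ hε.ne'] at this
        nlinarith)
      have b3 : nTotal f P (s k) ≤ nTotal f P (R * s k) := hmono (by nlinarith)
      have b4 : nTotal f P (s k / R) ≤ nTotal f P (s k) := hmono (div_le_self hk0 hR1)
      have b5 : B ≤ ε * nTotal f P (s k) := by
        have : B / ε ≤ nTotal f P (s k) := hM.le.trans (ht0.le.trans (hmono hk1))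
        rwa [div_le_iff₀ hε, mul_comm] at this
      rw [abs_le]
      constructor <;> linarith
  refine ⟨⟨hs, fun ε hε => ?_⟩, ⟨hs, fun ε hε => ?_⟩⟩
  · filter_upwards [key ε hε] with k hk t h1 h2
    have := (abs_le.1 (hk t h1 h2)).2
    rw [Real.rpow_zero]; linarith
  · filter_upwards [key ε hε] with k hk t h1 h2
    have := (abs_le.1 (hk t h1 h2)).1
    rw [Real.rpow_zero]; linarith

lemma peaks_of_small {θ₀ θ₁ θ₂ : ℝ} {f : ℂ → ℂ} {P : Set ℂ} (hc : Cfg θ₀ θ₁ θ₂ f P)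
    {rk : ℕ → ℝ} (hrk : Tendsto rk atTop atTop)
    (H : ∀ R > 1, ∀ᶠ k in atTop, ∀ z : ℂ, rk k / R ≤ ‖z‖ → ‖z‖ ≤ R * rk k → z ∉ P ∧ ‖f z‖ < 1 / 4) :
    ∃ φ : ℕ → ℕ, StrictMono φ ∧
      PolyaPeaks1 (nTotal f P) (fun k => rk (φ k)) 0 ∧
      PolyaPeaks2 (nTotal f P) (fun k => rk (φ k)) 0 := by
  obtain ⟨B, hB⟩ := core hc hrk H
  obtain ⟨φ, hφ, hφ2⟩ := extraction_forall_of_frequently (P := fun n k =>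
    nTotal f P (((n : ℝ) + 2) * rk k) - nTotal f P (rk k / ((n : ℝ) + 2)) ≤ B)
    (fun n => hB ((n : ℝ) + 2) (by have : (0 : ℝ) ≤ n := Nat.cast_nonneg n; linarith))
  have hs : Tendsto (fun k => rk (φ k)) atTop atTop := hrk.comp hφ.tendsto_atTop
  refine ⟨φ, hφ, peaks_of_bounded hc.hf hc.htrans hs fun R hR => ⟨B, ?_⟩⟩
  have hmono : Monotone (nTotal f P) := by
    intro a b hab
    rw [nTotal_eq hc.hf hc.htrans, nTotal_eq hc.hf hc.htrans]
    exact (locFin_wt hc.hf hc.htrans).cnt_mono (wt_nonneg f P) (t := b) (fun z hz => hz)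
      (fun z hz => le_trans hz hab)
  obtain ⟨N, hN⟩ := exists_nat_gt R
  filter_upwards [eventually_ge_atTop N, hs.eventually (eventually_ge_atTop 0)] with k hk hk0
  have h1 := hφ2 k
  have h2 : (N : ℝ) ≤ k := by exact_mod_cast hk
  have b1 : nTotal f P (R * rk (φ k)) ≤ nTotal f P (((k : ℝ) + 2) * rk (φ k)) := hmono (by
    gcongr; linarith)
  have b2 : nTotal f P (rk (φ k) / ((k : ℝ) + 2)) ≤ nTotal f P (rk (φ k) / R) := hmono (by
    gcongr; linarith)
  linarith

lemma sqrt_le_one_add (x : ℝ) (hx : 0 ≤ x) : Real.sqrt (1 + x ^ 2) ≤ 1 + x := by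
  rw [Real.sqrt_le_left (by linarith)]; nlinarith

lemma sqrt_pos_aux (x : ℝ) : 0 < Real.sqrt (1 + x ^ 2) := Real.sqrt_pos.2 (by positivity)

lemma sph_near {M η : ℝ} (hM : 0 ≤ M) (hη : 0 < η) : ∃ ε > 0, ∀ w : ℂ, ‖w‖ ≤ M → ∀ x : Option ℂ,
    sphDist x (Option.some w) < ε → ∃ v, x = Option.some v ∧ ‖v - w‖ < η := by
  have hK : 0 < 1 + M := by linarith
  refine ⟨min (1 / (1 + M)) (η / (1 + M) ^ 2), by positivity, fun w hw x hx => ?_⟩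
  have hw1 : Real.sqrt (1 + ‖w‖ ^ 2) ≤ 1 + M :=
    (sqrt_le_one_add _ (norm_nonneg _)).trans (by linarith)
  have hx1 := hx.trans_le (min_le_left _ _)
  have hx2 := hx.trans_le (min_le_right _ _)
  cases x with
  | none =>
    exfalso
    simp only [sphDist] at hx1
    have : 1 / (1 + M) ≤ 2 / Real.sqrt (1 + ‖w‖ ^ 2) := by
      have := sqrt_pos_aux ‖w‖
      gcongr; norm_num
    linarith
  | some v =>
    refine ⟨v, rfl, ?_⟩
    simp only [sphDist] at hx1 hx2
    have hv1 : Real.sqrt (1 + ‖v‖ ^ 2) ≤ 1 + M + dist v w := by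
      refine (sqrt_le_one_add _ (norm_nonneg _)).trans ?_
      have := norm_sub_norm_le v w
      rw [dist_eq_norm]; linarith
    have hpos : 0 < Real.sqrt (1 + ‖v‖ ^ 2) * Real.sqrt (1 + ‖w‖ ^ 2) :=
      mul_pos (sqrt_pos_aux _) (sqrt_pos_aux _)
    rw [div_lt_iff₀ hpos] at hx1 hx2
    have hd : 0 ≤ dist v w := dist_nonneg
    have hprod : Real.sqrt (1 + ‖v‖ ^ 2) * Real.sqrt (1 + ‖w‖ ^ 2) ≤ (1 + M + dist v w) * (1 + M) := by
      gcongr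
    have h1 : 2 * dist v w < (1 + M) + dist v w := by
      calc 2 * dist v w < 1 / (1 + M) * ((1 + M + dist v w) * (1 + M)) := by
            refine hx1.trans_le ?_; gcongr
        _ = _ := by field_simp
    have h2 : dist v w < 1 + M := by linarith
    have h3 : 2 * dist v w < 2 * η := by
      calc 2 * dist v w < η / (1 + M) ^ 2 * ((1 + M + dist v w) * (1 + M)) := by
            refine hx2.trans_le ?_; gcongr
        _ ≤ η / (1 + M) ^ 2 * ((1 + M + (1 + M)) * (1 + M)) := by gcongr
        _ = _ := by field_simp; ring
    rw [← dist_eq_norm]; linarith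

lemma sph_far {x w : Option ℂ} (hw : ∀ u, w = Option.some u → 3 ≤ ‖u‖) (hx : sphDist x w < 1 / 6) :
    ∀ v, x = Option.some v → 2 ≤ ‖v‖ := by
  rintro v rfl
  by_contra hv
  push Not at hv
  have hv1 : Real.sqrt (1 + ‖v‖ ^ 2) ≤ 3 :=
    (sqrt_le_one_add _ (norm_nonneg _)).trans (by linarith)
  cases w with
  | none =>
    simp only [sphDist] at hx
    rw [div_lt_iff₀ (sqrt_pos_aux _)] at hx
    linarith
  | some u =>
    have hu := hw u rfl
    simp only [sphDist] at hx
    rw [div_lt_iff₀ (mul_pos (sqrt_pos_aux _) (sqrt_pos_aux _))] at hx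
    have h1 : Real.sqrt (1 + ‖v‖ ^ 2) * Real.sqrt (1 + ‖u‖ ^ 2) ≤ 3 * (1 + ‖u‖) := by
      have := sqrt_le_one_add ‖u‖ (norm_nonneg _)
      gcongr
    have h2 := norm_sub_norm_le u v
    rw [dist_comm, dist_eq_norm] at hx
    linarith

lemma conv_near {f g : ℂ → ℂ} {P Q : Set ℂ} {rk : ℕ → ℝ}
    (hconv : SphConvOn
      (fun k => toSphere (fun z => f ((rk k : ℂ) * z)) {z : ℂ | ((rk k : ℂ) * z) ∈ P})
      (toSphere g Q) {z : ℂ | z ≠ 0}) {K : Set ℂ} (hK : IsCompact K) (hK0 : ∀ z ∈ K, z ≠ 0)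
    (hKQ : ∀ z ∈ K, z ∉ Q) {M : ℝ} (hM : ∀ z ∈ K, ‖g z‖ ≤ M) {η : ℝ} (hη : 0 < η) :
    ∀ᶠ k in atTop, ∀ z ∈ K, (rk k : ℂ) * z ∉ P ∧ ‖f (rk k * z) - g z‖ < η := by
  obtain ⟨ε, hε, h⟩ := sph_near (le_max_right M 0) hη
  filter_upwards [hconv K hK0 hK ε hε] with k hk z hz
  have h1 := hk z hz
  have e : toSphere g Q z = Option.some (g z) := by rw [toSphere, if_neg (hKQ z hz)]
  rw [e] at h1
  obtain ⟨v, hv, hv2⟩ := h (g z) ((hM z hz).trans (le_max_left _ _)) _ h1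
  unfold toSphere at hv
  split_ifs at hv with h2
  refine ⟨h2, ?_⟩
  rw [Option.some.injEq] at hv
  subst hv; exact hv2

lemma conv_far {f g : ℂ → ℂ} {P Q : Set ℂ} {rk : ℕ → ℝ}
    (hconv : SphConvOn
      (fun k => toSphere (fun z => f ((rk k : ℂ) * z)) {z : ℂ | ((rk k : ℂ) * z) ∈ P})
      (toSphere g Q) {z : ℂ | z ≠ 0}) {K : Set ℂ} (hK : IsCompact K) (hK0 : ∀ z ∈ K, z ≠ 0)
    (hM : ∀ z ∈ K, z ∉ Q → 3 ≤ ‖g z‖) :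
    ∀ᶠ k in atTop, ∀ z ∈ K, (rk k : ℂ) * z ∉ P → 2 ≤ ‖f (rk k * z)‖ := by
  filter_upwards [hconv K hK0 hK (1 / 6) (by norm_num)] with k hk z hz hzP
  refine sph_far ?_ (hk z hz) (f (rk k * z)) ?_
  · intro u hu
    unfold toSphere at hu
    split_ifs at hu with h2
    rw [Option.some.injEq] at hu
    rw [← hu]; exact hM z hz h2
  · exact if_neg (show z ∉ {z : ℂ | (rk k : ℂ) * z ∈ P} from hzP)

lemma meromorphicAt_of_tendsto {g : ℂ → ℂ} {q : ℂ} (h1 : ∀ᶠ w in 𝓝[≠] q, AnalyticAt ℂ g w)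
    (h2 : Tendsto (fun z => ‖g z‖) (𝓝[≠] q) atTop) : MeromorphicAt g q := by
  have hne : ∀ᶠ w in 𝓝[≠] q, g w ≠ 0 := (h2.eventually (eventually_ge_atTop 1)).mono
    fun w hw h => by rw [h] at hw; norm_num at hw
  have han : AnalyticAt ℂ (Function.update (fun w => (g w)⁻¹) q 0) q := by
    apply analyticAt_of_differentiable_on_punctured_nhds_of_continuousAt
    · filter_upwards [h1, hne, self_mem_nhdsWithin] with w hw hw2 hw3
      have := (hw.inv hw2).differentiableAt
      refine this.congr_of_eventuallyEq ?_
      filter_upwards [isOpen_ne.mem_nhds hw3] with u hu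
      rw [Function.update_of_ne hu]; rfl
    · rw [continuousAt_update_same, tendsto_zero_iff_norm_tendsto_zero]
      simp only [norm_inv]
      exact h2.inv_tendsto_atTop
  refine (han.meromorphicAt.inv).congr ?_
  filter_upwards [self_mem_nhdsWithin] with w hw
  rw [Pi.inv_apply, Function.update_of_ne hw, inv_inv]

lemma MeromOn.open_compl {g : ℂ → ℂ} {Q : Set ℂ} {U : Set ℂ} (hU : IsOpen U)
    (hg : MeromOn g Q U) {z : ℂ} (hz : z ∈ U) : ∀ᶠ w in 𝓝[≠] z, w ∈ U ∧ w ∉ Q := by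
  have h1 := hg.2.2.2 z hz
  rw [accPt_iff_frequently_nhdsNE, not_frequently] at h1
  filter_upwards [h1, nhdsWithin_le_nhds (hU.mem_nhds hz)] with w hw hw2 using ⟨hw2, hw⟩

lemma limit_dichotomy {g : ℂ → ℂ} {Q : Set ℂ} (hg : MeromOn g Q {z : ℂ | z ≠ 0}) (a : ℂ) :
    (∀ z, z ≠ 0 → z ∉ Q ∧ g z = a) ∨ ∀ z, z ≠ 0 → ∀ᶠ w in 𝓝[≠] z, g w ≠ a := by
  have hU : IsOpen {z : ℂ | z ≠ 0} := isOpen_ne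
  have hmer : MeromorphicOn (fun w => g w - a) {z : ℂ | z ≠ 0} := by
    intro z hz
    refine MeromorphicAt.fun_sub ?_ (MeromorphicAt.const a z)
    by_cases hzQ : z ∈ Q
    · exact meromorphicAt_of_tendsto ((hg.open_compl hU hz).mono fun w hw => hg.2.1 w hw)
        (hg.2.2.1 z hzQ)
    · exact (hg.2.1 z ⟨hz, hzQ⟩).meromorphicAt
  have hconn : IsConnected {z : ℂ | z ≠ 0} :=
    isConnected_compl_singleton_of_one_lt_rank (by simp [Complex.rank_real_complex]) 0
  by_cases hex : ∃ u : {z : ℂ | z ≠ 0}, meromorphicOrderAt (fun w => g w - a) u ≠ ⊤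
  · right
    intro z hz
    have := (hmer.exists_meromorphicOrderAt_ne_top_iff_forall hconn).1 hex ⟨z, hz⟩
    have h2 := (meromorphicOrderAt_ne_top_iff_eventually_ne_zero (hmer z hz)).1 this
    exact h2.mono fun w hw => sub_ne_zero.1 hw
  · left
    push Not at hex
    intro z hz
    have h1 : ∀ᶠ w in 𝓝[≠] z, g w = a :=
      (meromorphicOrderAt_eq_top_iff.1 (hex ⟨z, hz⟩)).mono fun w hw => sub_eq_zero.1 hw
    have hzQ : z ∉ Q := by
      intro hzQ
      have h2 := (hg.2.2.1 z hzQ).eventually (eventually_gt_atTop ‖a‖)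
      obtain ⟨w, hw, hw2⟩ := (h2.and h1).exists
      rw [hw2] at hw; exact lt_irrefl _ hw
    refine ⟨hzQ, ?_⟩
    have h3 : Tendsto g (𝓝[≠] z) (𝓝 (g z)) :=
      (hg.2.1 z ⟨hz, hzQ⟩).continuousAt.tendsto.mono_left inf_le_left
    exact tendsto_nhds_unique h3 ((tendsto_congr' h1).2 tendsto_const_nhds)

lemma small_of_limit {f g : ℂ → ℂ} {P Q : Set ℂ} {rk : ℕ → ℝ} (hrk : Tendsto rk atTop atTop)
    (hconv : SphConvOn
      (fun k => toSphere (fun z => f ((rk k : ℂ) * z)) {z : ℂ | ((rk k : ℂ) * z) ∈ P})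
      (toSphere g Q) {z : ℂ | z ≠ 0}) {a : ℂ} (ha : ∀ z, z ≠ 0 → z ∉ Q ∧ g z = a) :
    ∀ R > 1, ∀ᶠ k in atTop, ∀ z : ℂ, rk k / R ≤ ‖z‖ → ‖z‖ ≤ R * rk k →
      z ∉ P ∧ ‖f z - a‖ < 1 / 4 := by
  intro R hR
  have hR0 : 0 < R := by linarith
  have hcomp : IsCompact (Metric.closedBall (0 : ℂ) R ∩ {z | 1 / R ≤ ‖z‖}) :=
    (isCompact_closedBall _ _).inter_right (isClosed_le continuous_const continuous_norm)
  have h0 : ∀ z ∈ Metric.closedBall (0 : ℂ) R ∩ {z | 1 / R ≤ ‖z‖}, z ≠ 0 := by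
    rintro z ⟨-, hz⟩ rfl
    simp only [mem_ofPred_eq, norm_zero] at hz
    have : 0 < 1 / R := by positivity
    linarith
  filter_upwards [conv_near hconv hcomp h0 (fun z hz => (ha z (h0 z hz)).1) (M := ‖a‖)
    (fun z hz => by rw [(ha z (h0 z hz)).2]) (η := 1 / 4) (by norm_num),
    hrk.eventually (eventually_gt_atTop 0)] with k hk hk0 z h1 h2
  have hkC : (rk k : ℂ) ≠ 0 := by exact_mod_cast hk0.ne'
  have hn : ‖z / rk k‖ = ‖z‖ / rk k := by rw [norm_div, norm_real, Real.norm_of_nonneg hk0.le]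
  have hm : z / rk k ∈ Metric.closedBall (0 : ℂ) R ∩ {z | 1 / R ≤ ‖z‖} := by
    refine ⟨?_, ?_⟩
    · rw [mem_closedBall_zero_iff, hn, div_le_iff₀ hk0]; exact h2
    · rw [mem_ofPred_eq, hn, le_div_iff₀ hk0, one_div, inv_mul_eq_div]; exact h1
  have h3 := hk _ hm
  rw [mul_div_cancel₀ _ hkC, (ha _ (h0 _ hm)).2] at h3
  exact h3

lemma cnt_bound {F : ℂ → ℂ} {c : ℂ} {r M m : ℝ} (hr : 0 < r) (hM : 1 ≤ M)
    (hF : AnalyticOnNhd ℂ F (Metric.closedBall c (2 * r)))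
    (hb : ∀ z ∈ Metric.closedBall c (2 * r), ‖F z‖ ≤ M) (hm : 0 < m) (hmc : m ≤ ‖F c‖) :
    cnt (ordR F) (Metric.closedBall c r) ≤ Real.log (M / m) / Real.log 2 := by
  have h2r : |2 * r| = 2 * r := abs_of_pos (by positivity)
  have hra : |r| = r := abs_of_pos hr
  have h := AnalyticOnNhd.sum_divisor_le (f := F) (c := c) (r := r) (R := 2 * r) (M := M)
    (by rw [hra]; exact hr) (by rw [hra, h2r]; linarith) hM (by rw [h2r]; exact hF)
    (norm_pos_iff.1 (hm.trans_le hmc))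
    (by rw [h2r]; exact fun z hz => hb z (Metric.sphere_subset_closedBall hz))
  rw [hra] at h
  have hmer : MeromorphicOn F (Metric.closedBall c r) := fun z hz =>
    (hF z (Metric.closedBall_subset_closedBall (by linarith) hz)).meromorphicAt
  have hfin := (MeromorphicOn.divisor F (Metric.closedBall c r)).finiteSupport (isCompact_closedBall _ _)
  have e : cnt (ordR F) (Metric.closedBall c r) =
      ((∑ᶠ u, MeromorphicOn.divisor F (Metric.closedBall c r) u : ℤ) : ℝ) := by
    rw [finsum_eq_sum_of_support_subset (s := hfin.toFinset) _ (by simp)]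
    rw [cnt_finset (T := hfin.toFinset)]
    · push_cast
      refine Finset.sum_congr rfl fun z hz => ?_
      rw [Set.Finite.mem_toFinset] at hz
      rw [MeromorphicOn.divisor_apply hmer, ordR]
      exact (MeromorphicOn.divisor F (Metric.closedBall c r)).supportWithinDomain hz
    · intro z hz
      rw [Set.Finite.mem_toFinset] at hz
      exact (MeromorphicOn.divisor F (Metric.closedBall c r)).supportWithinDomain hz
    · intro z hz hz2
      rw [Set.Finite.mem_toFinset, Function.mem_support, MeromorphicOn.divisor_apply hmer hz]
      intro h0; apply hz2; rw [ordR, h0]; simp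
  rw [e]
  refine (h.trans_eq ?_).trans ?_ (b := Real.log (M / ‖F c‖) / Real.log 2)
  · congr 2; field_simp
  · have : 0 < Real.log 2 := Real.log_pos (by norm_num)
    have hc : 0 < ‖F c‖ := hm.trans_le hmc
    gcongr

lemma scale_ball {s : ℝ} (hs : 0 < s) {c w : ℂ} {ρ : ℝ} :
    w ∈ Metric.closedBall ((s : ℂ) * c) (s * ρ) ↔ w / s ∈ Metric.closedBall c ρ := by
  have hsC : (s : ℂ) ≠ 0 := by exact_mod_cast hs.ne'
  rw [Metric.mem_closedBall, Metric.mem_closedBall, dist_eq_norm, dist_eq_norm]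
  have : w - s * c = s * (w / s - c) := by field_simp
  rw [this, norm_mul, norm_real, Real.norm_of_nonneg hs.le]
  exact mul_le_mul_iff_right₀ hs

lemma wtP_eq_recip {f : ℂ → ℂ} {P : Set ℂ} (hf : MeromOn f P univ) {z : ℂ}
    (h : z ∉ P → 2 ≤ ‖f z‖) : wt f P z = ordR (recip f P) z := by
  by_cases hz : z ∈ P
  · have h1 := (poleOrder_eq hf hz).2
    have h2 : meromorphicOrderAt f z = -meromorphicOrderAt (recip f P) z := by
      rw [meromorphicOrderAt_congr (recip_congr hf z), meromorphicOrderAt_inv]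
    rw [h2] at h1
    rw [wt, wtV, wtV, wtP, if_neg (fun h => h.1 hz), if_neg (fun h => h.1 hz), if_pos hz, ordR]
    have h3 : (poleOrder f z : ℝ) = ((poleOrder f z : ℤ) : ℝ) := by simp
    rw [h3, h1]; simp
  · have h1 := h hz
    have hne : ∀ a : ℂ, ‖a‖ ≤ 1 → f z ≠ a := by
      rintro a ha rfl; linarith
    have h0 : f z ≠ 0 := hne 0 (by simp)
    rw [wt, wtV, wtV, wtP, if_neg (fun h => h0 h.2), if_neg (fun h => hne 1 (by simp) h.2),
      if_neg hz, ordR]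
    have han := recip_analyticAt hf (z := z) fun _ => h0
    have : meromorphicOrderAt (recip f P) z = 0 := by
      rw [han.meromorphicOrderAt_eq, han.analyticOrderAt_eq_zero.2]
      · rfl
      · rw [recip, if_neg hz]; simpa using h0
    rw [this]; simp

lemma local_reg {f g : ℂ → ℂ} {P Q : Set ℂ} {rk : ℕ → ℝ} (hf : MeromOn f P univ)
    (ht : ¬ IsRationalFn f P) (hrk : Tendsto rk atTop atTop)
    (hg : MeromOn g Q {z : ℂ | z ≠ 0})
    (hconv : SphConvOn
      (fun k => toSphere (fun z => f ((rk k : ℂ) * z)) {z : ℂ | ((rk k : ℂ) * z) ∈ P})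
      (toSphere g Q) {z : ℂ | z ≠ 0})
    (hn0 : ∀ z, z ≠ 0 → ∀ᶠ w in 𝓝[≠] z, g w ≠ 0)
    (hn1 : ∀ z, z ≠ 0 → ∀ᶠ w in 𝓝[≠] z, g w ≠ 1) {z₀ : ℂ} (hz₀ : z₀ ≠ 0) (hz₀Q : z₀ ∉ Q) :
    ∃ c r B, 0 < r ∧ dist z₀ c < r ∧
      ∀ᶠ k in atTop, cnt (wt f P) (Metric.closedBall ((rk k : ℂ) * c) (rk k * r)) ≤ B := by
  have hopen : ∀ᶠ w in 𝓝 z₀, w ≠ 0 ∧ w ∉ Q := by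
    have h1 := hg.open_compl isOpen_ne hz₀
    rw [eventually_nhdsWithin_iff] at h1
    filter_upwards [h1] with w hw
    by_cases h : w = z₀
    · subst h; exact ⟨hz₀, hz₀Q⟩
    · exact hw h
  obtain ⟨ρ, hρ, hball⟩ := Metric.nhds_basis_closedBall.eventually_iff.1 hopen
  have hr : 0 < ρ / 4 := by positivity
  obtain ⟨c, ⟨hc0, hc1⟩, hcd⟩ := (((hn0 z₀ hz₀).and (hn1 z₀ hz₀)).and
    (nhdsWithin_le_nhds (Metric.ball_mem_nhds z₀ hr))).exists
  set r := ρ / 4 with hrdef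
  have hKsub : Metric.closedBall c (2 * r) ⊆ Metric.closedBall z₀ ρ := by
    apply Metric.closedBall_subset_closedBall'; linarith
  have hK : IsCompact (Metric.closedBall c (2 * r)) := isCompact_closedBall _ _
  have hcont : ContinuousOn g (Metric.closedBall c (2 * r)) := fun z hz =>
    (hg.2.1 z (hball (hKsub hz))).continuousAt.continuousWithinAt
  obtain ⟨M, hM⟩ := hK.exists_bound_of_continuousOn hcont
  have hM0 : 0 ≤ M := (norm_nonneg _).trans (hM c (Metric.mem_closedBall_self (by positivity)))
  have hp0 : 0 < ‖g c‖ := norm_pos_iff.2 hc0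
  have hp1 : 0 < ‖g c - 1‖ := norm_pos_iff.2 (sub_ne_zero.2 hc1)
  have hη : 0 < min 1 (min (‖g c‖ / 2) (‖g c - 1‖ / 2)) := by positivity
  refine ⟨c, r, Real.log ((M + 2) / (‖g c‖ / 2)) / Real.log 2 +
    Real.log ((M + 2) / (‖g c - 1‖ / 2)) / Real.log 2, hr, by rwa [dist_comm], ?_⟩
  filter_upwards [conv_near hconv hK (fun z hz => (hball (hKsub hz)).1)
    (fun z hz => (hball (hKsub hz)).2) hM hη, hrk.eventually (eventually_gt_atTop 0)] with k hk hk0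
  have hkC : (rk k : ℂ) ≠ 0 := by exact_mod_cast hk0.ne'
  have key : ∀ w ∈ Metric.closedBall ((rk k : ℂ) * c) (2 * (rk k * r)), w ∉ P ∧ ‖f w‖ ≤ M + 1 := by
    intro w hw
    rw [show 2 * (rk k * r) = rk k * (2 * r) by ring, scale_ball hk0] at hw
    have h1 := hk _ hw
    rw [mul_div_cancel₀ _ hkC] at h1
    refine ⟨h1.1, ?_⟩
    have h2 := h1.2.trans_le (min_le_left _ _)
    have h3 := norm_sub_norm_le (f w) (g (w / rk k))
    linarith [hM _ hw]
  have hsub : Metric.closedBall ((rk k : ℂ) * c) (rk k * r) ⊆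
      Metric.closedBall ((rk k : ℂ) * c) (2 * (rk k * r)) :=
    Metric.closedBall_subset_closedBall (by nlinarith [mul_pos hk0 hr])
  have hcc := (hk c (Metric.mem_closedBall_self (by positivity))).2
  have hc2 := (hcc.trans_le (min_le_right _ _)).trans_le (min_le_left _ _)
  have hc3 := (hcc.trans_le (min_le_right _ _)).trans_le (min_le_right _ _)
  have b0 : cnt (ordR fun w => f w - 0) (Metric.closedBall ((rk k : ℂ) * c) (rk k * r)) ≤
      Real.log ((M + 2) / (‖g c‖ / 2)) / Real.log 2 := by
    refine cnt_bound (mul_pos hk0 hr) (by linarith)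
      (fun w hw => (hf.analyticAt (key w hw).1).fun_sub analyticAt_const) ?_ (by positivity) ?_
    · intro w hw
      rw [sub_zero]; linarith [(key w hw).2]
    · rw [sub_zero]
      have := norm_sub_norm_le (g c) (f (rk k * c))
      rw [norm_sub_rev] at this; linarith
  have b1 : cnt (ordR fun w => f w - 1) (Metric.closedBall ((rk k : ℂ) * c) (rk k * r)) ≤
      Real.log ((M + 2) / (‖g c - 1‖ / 2)) / Real.log 2 := by
    refine cnt_bound (mul_pos hk0 hr) (by linarith)
      (fun w hw => (hf.analyticAt (key w hw).1).fun_sub analyticAt_const) ?_ (by positivity) ?_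
    · intro w hw
      have := norm_sub_le (f w) 1
      rw [norm_one] at this
      linarith [(key w hw).2]
    · have := norm_sub_norm_le (g c - 1) (f (rk k * c) - 1)
      rw [sub_sub_sub_cancel_right, norm_sub_rev (g c) (f _)] at this; linarith
  have hbd : ∀ z ∈ Metric.closedBall ((rk k : ℂ) * c) (rk k * r), ‖z‖ ≤ ‖(rk k : ℂ) * c‖ + rk k * r := by
    intro z hz
    rw [Metric.mem_closedBall, dist_eq_norm] at hz
    have := norm_sub_norm_le z (rk k * c)
    linarith
  have e : cnt (wt f P) (Metric.closedBall ((rk k : ℂ) * c) (rk k * r)) =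
      cnt (wtV f P 0) (Metric.closedBall ((rk k : ℂ) * c) (rk k * r)) +
      cnt (wtV f P 1) (Metric.closedBall ((rk k : ℂ) * c) (rk k * r)) := by
    rw [← (locFin_wtV hf ht 0).cnt_add (locFin_wtV hf ht 1) hbd]
    refine cnt_congr fun z hz => ?_
    rw [wt, wtP, if_neg (key z (hsub hz)).1, add_zero]
  rw [e, cnt_congr fun z hz => wtV_eq hf ht 0 (key z (hsub hz)).1,
    cnt_congr fun z hz => wtV_eq hf ht 1 (key z (hsub hz)).1]
  linarith

lemma local_pole {f g : ℂ → ℂ} {P Q : Set ℂ} {rk : ℕ → ℝ} (hf : MeromOn f P univ)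
    (hrk : Tendsto rk atTop atTop)
    (hg : MeromOn g Q {z : ℂ | z ≠ 0})
    (hconv : SphConvOn
      (fun k => toSphere (fun z => f ((rk k : ℂ) * z)) {z : ℂ | ((rk k : ℂ) * z) ∈ P})
      (toSphere g Q) {z : ℂ | z ≠ 0}) {z₀ : ℂ} (hz₀ : z₀ ≠ 0) (hz₀Q : z₀ ∈ Q) :
    ∃ c r B, 0 < r ∧ dist z₀ c < r ∧
      ∀ᶠ k in atTop, cnt (wt f P) (Metric.closedBall ((rk k : ℂ) * c) (rk k * r)) ≤ B := by
  have hev : ∀ᶠ w in 𝓝 z₀, w ≠ 0 ∧ (w ∉ Q → 3 ≤ ‖g w‖) := by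
    have h1 := (hg.2.2.1 z₀ hz₀Q).eventually (eventually_ge_atTop 3)
    rw [eventually_nhdsWithin_iff] at h1
    filter_upwards [h1, isOpen_ne.mem_nhds hz₀] with w hw hw0
    refine ⟨hw0, fun hwQ => hw ?_⟩
    rintro rfl; exact hwQ hz₀Q
  obtain ⟨ρ, hρ, hball⟩ := Metric.nhds_basis_closedBall.eventually_iff.1 hev
  have hr : 0 < ρ / 4 := by positivity
  obtain ⟨c, ⟨hc0, hcQ⟩, hcd⟩ := ((hg.open_compl isOpen_ne hz₀).and
    (nhdsWithin_le_nhds (Metric.ball_mem_nhds z₀ hr))).exists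
  set r := ρ / 4 with hrdef
  have hKsub : Metric.closedBall c (2 * r) ⊆ Metric.closedBall z₀ ρ := by
    apply Metric.closedBall_subset_closedBall'; linarith
  have hK : IsCompact (Metric.closedBall c (2 * r)) := isCompact_closedBall _ _
  refine ⟨c, r, Real.log (1 / (1 / (‖g c‖ + 1))) / Real.log 2, hr, by rwa [dist_comm], ?_⟩
  filter_upwards [conv_far hconv hK (fun z hz => (hball (hKsub hz)).1)
    (fun z hz => (hball (hKsub hz)).2), conv_near hconv (isCompact_singleton (x := c))
      (M := ‖g c‖) (η := 1) (by rintro z rfl; exact hc0) (by rintro z rfl; exact hcQ)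
      (by rintro z rfl; exact le_rfl) one_pos,
    hrk.eventually (eventually_gt_atTop 0)] with k hk hkc hk0
  have hkC : (rk k : ℂ) ≠ 0 := by exact_mod_cast hk0.ne'
  have key : ∀ w ∈ Metric.closedBall ((rk k : ℂ) * c) (2 * (rk k * r)), w ∉ P → 2 ≤ ‖f w‖ := by
    intro w hw
    rw [show 2 * (rk k * r) = rk k * (2 * r) by ring, scale_ball hk0] at hw
    have h1 := hk _ hw
    rwa [mul_div_cancel₀ _ hkC] at h1
  have hsub : Metric.closedBall ((rk k : ℂ) * c) (rk k * r) ⊆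
      Metric.closedBall ((rk k : ℂ) * c) (2 * (rk k * r)) :=
    Metric.closedBall_subset_closedBall (by nlinarith [mul_pos hk0 hr])
  rw [cnt_congr fun z hz => wtP_eq_recip hf (key z (hsub hz))]
  refine cnt_bound (mul_pos hk0 hr) le_rfl (fun w hw => recip_analyticAt hf fun h h' => ?_) ?_
    (by positivity) ?_
  · have := key w hw h
    rw [h', norm_zero] at this; linarith
  · intro w hw
    by_cases hwP : w ∈ P
    · rw [recip, if_pos hwP]; simp
    · have := key w hw hwP
      rw [recip, if_neg hwP, norm_div, norm_one, div_le_one (by linarith)]; linarith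
  · obtain ⟨h1, h2⟩ := hkc c rfl
    have h4 := key _ (Metric.mem_closedBall_self (by positivity)) h1
    rw [recip, if_neg h1, norm_div, norm_one]
    have h3 := norm_sub_norm_le (f (rk k * c)) (g c)
    gcongr; linarith

lemma bounded_case {f g : ℂ → ℂ} {P Q : Set ℂ} {rk : ℕ → ℝ} (hf : MeromOn f P univ)
    (ht : ¬ IsRationalFn f P) (hrk : Tendsto rk atTop atTop)
    (hg : MeromOn g Q {z : ℂ | z ≠ 0})
    (hconv : SphConvOn
      (fun k => toSphere (fun z => f ((rk k : ℂ) * z)) {z : ℂ | ((rk k : ℂ) * z) ∈ P})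
      (toSphere g Q) {z : ℂ | z ≠ 0})
    (hn0 : ∀ z, z ≠ 0 → ∀ᶠ w in 𝓝[≠] z, g w ≠ 0)
    (hn1 : ∀ z, z ≠ 0 → ∀ᶠ w in 𝓝[≠] z, g w ≠ 1) :
    ∀ R > 1, ∃ B, ∀ᶠ k in atTop, nTotal f P (R * rk k) - nTotal f P (rk k / R) ≤ B := by
  intro R hR
  have hR0 : 0 < R := by linarith
  set A : Set ℂ := Metric.closedBall (0 : ℂ) R ∩ {z | 1 / R ≤ ‖z‖} with hA
  have hcomp : IsCompact A :=
    (isCompact_closedBall _ _).inter_right (isClosed_le continuous_const continuous_norm)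
  have h0 : ∀ z ∈ A, z ≠ 0 := by
    rintro z ⟨-, hz⟩ rfl
    simp only [mem_ofPred_eq, norm_zero] at hz
    have : 0 < 1 / R := by positivity
    linarith
  have hw := locFin_wt hf ht
  have hw0 := wt_nonneg f P
  have hbd : ∀ k, 0 < rk k → ∀ S, ∀ w ∈ {w : ℂ | w / rk k ∈ S ∩ A}, ‖w‖ ≤ R * rk k := by
    rintro k hk S w ⟨-, hw, -⟩
    rw [mem_closedBall_zero_iff, norm_div, norm_real, Real.norm_of_nonneg hk.le,
      div_le_iff₀ hk] at hw
    exact hw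
  have main : ∃ B, ∀ᶠ k in atTop, cnt (wt f P) {w : ℂ | w / rk k ∈ A ∩ A} ≤ B := by
    refine hcomp.induction_on
      (p := fun S => ∃ B, ∀ᶠ k in atTop, cnt (wt f P) {w : ℂ | w / rk k ∈ S ∩ A} ≤ B) ?_ ?_ ?_ ?_
    · refine ⟨0, Eventually.of_forall fun k => ?_⟩
      rw [cnt_zero]
      rintro z ⟨h, -⟩; exact h.elim
    · rintro S T hST ⟨B, hB⟩
      refine ⟨B, ?_⟩
      filter_upwards [hB, hrk.eventually (eventually_gt_atTop 0)] with k hk hk0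
      exact (hw.cnt_mono hw0 (hbd k hk0 T) fun w h => ⟨hST h.1, h.2⟩).trans hk
    · rintro S T ⟨B, hB⟩ ⟨C, hC⟩
      refine ⟨B + C, ?_⟩
      filter_upwards [hB, hC, hrk.eventually (eventually_gt_atTop 0)] with k hk hk2 hk0
      have e : {w : ℂ | w / rk k ∈ (S ∪ T) ∩ A} =
          {w : ℂ | w / rk k ∈ S ∩ A} ∪ {w : ℂ | w / rk k ∈ T ∩ A} := by
        ext w; simp only [mem_ofPred_eq, mem_inter_iff, mem_union]; tauto
      rw [e]
      exact (hw.cnt_union_le hw0 (hbd k hk0 S) (hbd k hk0 T)).trans (add_le_add hk hk2)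
    · intro z hz
      have hl : ∃ c r B, 0 < r ∧ dist z c < r ∧ ∀ᶠ k in atTop,
          cnt (wt f P) (Metric.closedBall ((rk k : ℂ) * c) (rk k * r)) ≤ B := by
        by_cases hzQ : z ∈ Q
        · exact local_pole hf hrk hg hconv (h0 z hz) hzQ
        · exact local_reg hf ht hrk hg hconv hn0 hn1 (h0 z hz) hzQ
      obtain ⟨c, r, B, hr, hd, hB⟩ := hl
      refine ⟨Metric.closedBall c r, nhdsWithin_le_nhds ?_, B, ?_⟩
      · exact mem_of_superset (Metric.isOpen_ball.mem_nhds hd) Metric.ball_subset_closedBall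
      · filter_upwards [hB, hrk.eventually (eventually_gt_atTop 0)] with k hk hk0
        refine (hw.cnt_mono hw0 (t := ‖(rk k : ℂ) * c‖ + rk k * r) ?_ ?_).trans hk
        · intro z hz
          rw [Metric.mem_closedBall, dist_eq_norm] at hz
          have := norm_sub_norm_le z (rk k * c)
          linarith
        · rintro w ⟨h, -⟩
          exact (scale_ball hk0).2 h
  obtain ⟨B, hB⟩ := main
  refine ⟨B, ?_⟩
  filter_upwards [hB, hrk.eventually (eventually_gt_atTop 0)] with k hk hk0
  rw [nTotal_eq hf ht, nTotal_eq hf ht]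
  have hle : rk k / R ≤ R * rk k := by
    rw [div_le_iff₀ hR0]; nlinarith [mul_pos hk0 hR0]
  have h1 := hw.cnt_diff (S := {z | ‖z‖ ≤ rk k / R}) (T := {z | ‖z‖ ≤ R * rk k}) (t := R * rk k)
    (fun z hz => hz) (fun z (hz : ‖z‖ ≤ rk k / R) => hz.trans hle)
  have h2 : cnt (wt f P) ({z | ‖z‖ ≤ R * rk k} \ {z | ‖z‖ ≤ rk k / R}) ≤
      cnt (wt f P) {w : ℂ | w / rk k ∈ A ∩ A} := by
    refine hw.cnt_mono hw0 (hbd k hk0 A) ?_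
    rintro w ⟨h3, h4⟩
    simp only [mem_ofPred_eq, not_le] at h3 h4
    have hn : ‖w / rk k‖ = ‖w‖ / rk k := by rw [norm_div, norm_real, Real.norm_of_nonneg hk0.le]
    have hm : w / rk k ∈ A := by
      refine ⟨?_, ?_⟩
      · rw [mem_closedBall_zero_iff, hn, div_le_iff₀ hk0]; exact h3
      · rw [mem_ofPred_eq, hn, le_div_iff₀ hk0, one_div, inv_mul_eq_div]; exact h4.le
    exact ⟨hm, hm⟩
  linarith

theorem polya_final
    (θ₀ θ₁ θ₂ : ℝ)
    (hd01 : Ray θ₀ ≠ Ray θ₁) (hd02 : Ray θ₀ ≠ Ray θ₂) (hd12 : Ray θ₁ ≠ Ray θ₂)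
    (f : ℂ → ℂ) (P : Set ℂ)
    (hf : MeromOn f P Set.univ) (htrans : ¬ IsRationalFn f P)
    (h0 : ({z : ℂ | z ∉ P ∧ f z = 0} \ Ray θ₀).Finite)
    (h1 : ({z : ℂ | z ∉ P ∧ f z = 1} \ Ray θ₁).Finite)
    (hp : (P \ Ray θ₂).Finite)
    (rk : ℕ → ℝ) (hrk : Tendsto rk atTop atTop)
    (g : ℂ → ℂ) (Q : Set ℂ) (hg : MeromOn g Q {z : ℂ | z ≠ 0})
    (hconv : SphConvOn
      (fun k => toSphere (fun z => f ((rk k : ℂ) * z)) {z : ℂ | ((rk k : ℂ) * z) ∈ P})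
      (toSphere g Q) {z : ℂ | z ≠ 0}) :
    ∃ φ : ℕ → ℕ, StrictMono φ ∧
      PolyaPeaks1 (nTotal f P) (fun k => rk (φ k)) 0 ∧
      PolyaPeaks2 (nTotal f P) (fun k => rk (φ k)) 0 := by
  have hc : Cfg θ₀ θ₁ θ₂ f P := ⟨hd01, hd02, hd12, hf, htrans, h0, h1, hp⟩
  rcases limit_dichotomy hg 0 with ha | hn0
  · refine peaks_of_small hc hrk ?_
    have := small_of_limit hrk hconv ha
    simpa only [sub_zero] using this
  rcases limit_dichotomy hg 1 with ha | hn1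
  · have e : nTotal (fun z => 1 - f z) P = nTotal f P := funext (nTotal_one_sub hf)
    rw [← e]
    refine peaks_of_small hc.one_sub hrk ?_
    have := small_of_limit hrk hconv ha
    simpa only [norm_sub_rev] using this
  · exact ⟨id, strictMono_id, peaks_of_bounded hf htrans hrk
      (bounded_case hf htrans hrk hg hconv hn0 hn1)⟩

/-- **Claim (a) in the proof of Theorem 3.** Let `f` be a transcendental meromorphic function
whose zeros, `1`-points and poles lie, with finitely many exceptions, on three distinct
equally spaced rays. If `(rₖ) → ∞` is such that `fₖ(z) = f(rₖ z)` converges locally uniformly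
on `ℂ \ {0}` (spherical metric) to a meromorphic limit, then `(rₖ)` has a subsequence which is
a sequence of Pólya peaks of order `0`, of both kinds, for `n(r)`. -/
theorem polya_peaks_of_normal_rescaling
    (θ₀ θ₁ θ₂ : ℝ)
    (hd01 : Ray θ₀ ≠ Ray θ₁) (hd02 : Ray θ₀ ≠ Ray θ₂) (hd12 : Ray θ₁ ≠ Ray θ₂)
    (hes : EquallySpaced (Ray θ₀) (Ray θ₁) (Ray θ₂))
    (f : ℂ → ℂ) (P : Set ℂ)
    (hf : MeromOn f P Set.univ) (htrans : ¬ IsRationalFn f P)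
    (h0 : ({z : ℂ | z ∉ P ∧ f z = 0} \ Ray θ₀).Finite)
    (h1 : ({z : ℂ | z ∉ P ∧ f z = 1} \ Ray θ₁).Finite)
    (hp : (P \ Ray θ₂).Finite)
    (rk : ℕ → ℝ) (hrk : Tendsto rk atTop atTop)
    (g : ℂ → ℂ) (Q : Set ℂ) (hg : MeromOn g Q {z : ℂ | z ≠ 0})
    (hconv : SphConvOn
      (fun k => toSphere (fun z => f ((rk k : ℂ) * z)) {z : ℂ | ((rk k : ℂ) * z) ∈ P})
      (toSphere g Q) {z : ℂ | z ≠ 0}) :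
    ∃ φ : ℕ → ℕ, StrictMono φ ∧
      PolyaPeaks1 (nTotal f P) (fun k => rk (φ k)) 0 ∧
      PolyaPeaks2 (nTotal f P) (fun k => rk (φ k)) 0 := by
  exact polya_final θ₀ θ₁ θ₂ hd01 hd02 hd12 f P hf htrans h0 h1 hp rk hrk g Q hg hconv
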